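/- Let m ≥ 1 be a fixed integer and fix γ ∈ (0,1); set R := N^γ. There exist a constant C_m > 0 and, for every δ > 0, a threshold N_0 (depending only on m, γ, δ) such that the following holds for all N ≥ N_0. Let B be an interval of integers of length at least R^{10m}, and let h_1, …, h_m be distinct integers with |h_i| ≤ N² for all i and with x + h_i ≥ 0 for all x ∈ B and all i; set Δ := ∏_{1≤i<j≤m} |h_i − h_j|. Then E( Λ_R(W(x+h_1)+1)²·…·Λ_R(W(x+h_m)+1)² | x ∈ B ) ≤ (1+δ)·(W·log R/φ(W))^m·∏_{p | Δ, p prime}(1 + C_m·p^{−1/2}). -/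

import Mathlib

open Finset Filter
open scoped Classical

noncomputable section

/-- `ε_k := 1/(2^k (k+4)!)`. -/
def epsk (k : ℕ) : ℝ := 1 / (2 ^ k * (Nat.factorial (k + 4)))

/-- `W(N) := ∏_{p ≤ w(N)} p`. -/
def Wprim (w : ℕ → ℕ) (N : ℕ) : ℕ := ∏ p ∈ (Finset.range (w N + 1)).filter Nat.Prime, p

/-- W-tricked von Mangoldt function. -/
def tildeLambda (W n : ℕ) : ℝ :=
  if Nat.Prime (W * n + 1) then (Nat.totient W : ℝ) / W * Real.log (W * n + 1) else 0

/-- truncated divisor sum `Λ_R`. -/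
def LambdaR (R : ℝ) (n : ℕ) : ℝ :=
  ∑ d ∈ n.divisors.filter (fun d : ℕ => (d : ℝ) ≤ R),
    ((ArithmeticFunction.moebius d : ℤ) : ℝ) * Real.log (R / (d : ℝ))

/-- the representative of `n : ZMod m` lying in `[N, N+m)`. -/
def reprN (N : ℕ) {m : ℕ} (n : ZMod m) : ℕ := N + (n - (N : ZMod m)).val

/-- the condition `ε_k M ≤ n - N ≤ 2 ε_k M` on the representative in `[N, N+m)`. -/
def inWindow (k N : ℕ) {m : ℕ} (n : ZMod m) : Prop :=
  epsk k * m ≤ ((n - (N : ZMod m)).val : ℝ) ∧ ((n - (N : ZMod m)).val : ℝ) ≤ 2 * epsk k * m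

/-- `R := M^(1/(k 2^(k+4)))`. -/
def Rpar (k m : ℕ) : ℝ := (m : ℝ) ^ ((1 : ℝ) / (k * 2 ^ (k + 4)))

/-- the Green–Tao majorant `ν`. -/
def nuGT (k N W : ℕ) {m : ℕ} (n : ZMod m) : ℝ :=
  if inWindow k N n then
    (Nat.totient W : ℝ) / W * (LambdaR (Rpar k m) (W * reprN N n + 1)) ^ 2 / Real.log (Rpar k m)
  else 1

/-- the function `f`. -/
def fGT (k N W : ℕ) {m : ℕ} (n : ZMod m) : ℝ :=
  if inWindow k N n then tildeLambda W (reprN N n) / (k * 2 ^ (k + 5)) else 0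

/-- the set of integers `n` with `ε_k M ≤ n - N ≤ 2 ε_k M`. -/
def windowSet (k N m : ℕ) : Finset ℕ :=
  (Finset.range (N + m + 1)).filter
    (fun n => epsk k * m ≤ (n : ℝ) - N ∧ (n : ℝ) - N ≤ 2 * epsk k * m)

/-- `E(Λ̃(n) | ε_k M ≤ n - N ≤ 2 ε_k M)`. -/
def avgWindow (k N m W : ℕ) : ℝ :=
  (∑ n ∈ windowSet k N m, tildeLambda W n) / (windowSet k N m).card

/-- `E(g(x) | x ∈ Z_m)`. -/
def avgZ (m : ℕ) (g : ZMod m → ℝ) : ℝ := (∑ x ∈ Finset.range m, g (x : ZMod m)) / m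

/-- `E(g(x) g(x+r) ⋯ g(x+(k-1)r) | x, r ∈ Z_m)`. -/
def apAvg (k m : ℕ) (g : ZMod m → ℝ) : ℝ :=
  (∑ x ∈ Finset.range m, ∑ r ∈ Finset.range m,
    ∏ i ∈ Finset.range k, g ((x : ZMod m) + (i : ZMod m) * (r : ZMod m))) / (m : ℝ) ^ 2

/-- a rational number interpreted in `ZMod m`. -/
def ratZMod (q : ℚ) (m : ℕ) : ZMod m := (q.num : ZMod m) * (q.den : ZMod m)⁻¹

/-- the `(m₀,t₀,L₀)`-linear forms condition for a family `ν = ν_N : Z_{M(N)} → ℝ`. -/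
def LinearFormsCondition (M : ℕ → ℕ) (ν : ∀ N : ℕ, ZMod (M N) → ℝ) (m₀ t₀ L₀ : ℕ) : Prop :=
  ∀ m t : ℕ, m ≤ m₀ → t ≤ t₀ →
    ∀ L : Fin m → Fin t → ℚ,
      (∀ i j, (L i j).num.natAbs ≤ L₀ ∧ (L i j).den ≤ L₀) →
      (∀ i, L i ≠ 0) →
      (∀ i i', i ≠ i' → ∀ q : ℚ, L i ≠ q • L i') →
      ∀ δ : ℝ, 0 < δ → ∃ N₀ : ℕ, ∀ N ≥ N₀, L₀ < M N →
        ∀ b : Fin m → ZMod (M N),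
          |(∑ x : Fin t → Fin (M N), ∏ i : Fin m,
              ν N (∑ j : Fin t, ratZMod (L i j) (M N) * ((x j : ℕ) : ZMod (M N)) + b i)) /
              (M N : ℝ) ^ t - 1| ≤ δ

/-- the `m₀`-correlation condition for a family `ν = ν_N : Z_{M(N)} → ℝ`. -/
def CorrelationCondition (M : ℕ → ℕ) (ν : ∀ N : ℕ, ZMod (M N) → ℝ) (m₀ : ℕ) : Prop :=
  ∀ m : ℕ, 1 < m → m ≤ m₀ →
    ∃ τ : ∀ N : ℕ, ZMod (M N) → ℝ,
      (∀ N n, 0 ≤ τ N n) ∧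
      (∀ q : ℝ, 1 ≤ q → ∃ C : ℝ, ∀ N, avgZ (M N) (fun n => τ N n ^ q) ≤ C) ∧
      (∀ N : ℕ, ∀ h : Fin m → ZMod (M N),
        avgZ (M N) (fun x => ∏ i, ν N (x + h i)) ≤
          ∑ i : Fin m, ∑ j : Fin m, if i < j then τ N (h i - h j) else 0)

/-- `k`-pseudorandom measure. -/
def Pseudorandom (k : ℕ) (M : ℕ → ℕ) (ν : ∀ N : ℕ, ZMod (M N) → ℝ) : Prop :=
  (∀ δ : ℝ, 0 < δ → ∃ N₀, ∀ N ≥ N₀, |avgZ (M N) (ν N) - 1| ≤ δ) ∧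
  LinearFormsCondition M ν (k * 2 ^ (k - 1)) (3 * k - 4) k ∧
  CorrelationCondition M ν (2 ^ (k - 1))

theorem abs_sum_moebius_div_le (N : ℕ) :
    |∑ n ∈ Ioc 0 N, (ArithmeticFunction.moebius n : ℝ) / n| ≤ 1 := by
  rcases Nat.eq_zero_or_pos N with rfl | hN
  · simp
  have key := ArithmeticFunction.sum_Ioc_mul_zeta_eq_sum
    (R := ℝ) (ArithmeticFunction.moebius : ArithmeticFunction ℝ) N
  rw [ArithmeticFunction.coe_moebius_mul_coe_zeta] at key
  have h1 : ∑ n ∈ Ioc 0 N, (1 : ArithmeticFunction ℝ) n = 1 := by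
    rw [Finset.sum_eq_single 1]
    · simp
    · intro b _ hb; exact ArithmeticFunction.one_apply_ne hb
    · intro h; exact absurd (Finset.mem_Ioc.2 ⟨one_pos, hN⟩) h
  rw [h1] at key
  simp only [ArithmeticFunction.intCoe_apply] at key
  have hNr : (0 : ℝ) < N := by exact_mod_cast hN
  have hfr : ∀ n ∈ Ioc 0 N, |(N : ℝ) / n - ((N / n : ℕ) : ℝ)| ≤ if n = N then 0 else 1 := by
    intro n hn
    have hn0 : 0 < n := (Finset.mem_Ioc.1 hn).1
    have hnr : (0 : ℝ) < n := by exact_mod_cast hn0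
    split_ifs with h
    · subst h
      rw [div_self hnr.ne', Nat.div_self hn0]; simp
    · have a1 : ((N / n : ℕ) : ℝ) ≤ (N : ℝ) / n := Nat.cast_div_le
      have a2 : (N : ℝ) / n < ((N / n : ℕ) : ℝ) + 1 := by
        rw [← Nat.floor_div_eq_div (K := ℝ)]
        exact Nat.lt_floor_add_one _
      rw [abs_le]; constructor <;> linarith
  have hsum : |∑ n ∈ Ioc 0 N, (ArithmeticFunction.moebius n : ℝ) *
      ((N : ℝ) / n - ((N / n : ℕ) : ℝ))| ≤ N - 1 := by
    refine (Finset.abs_sum_le_sum_abs _ _).trans ?_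
    have : ∀ n ∈ Ioc 0 N, |(ArithmeticFunction.moebius n : ℝ) *
      ((N : ℝ) / n - ((N / n : ℕ) : ℝ))| ≤ 1 - if n = N then 1 else 0 := by
      intro n hn
      rw [abs_mul]
      have b1 : |(ArithmeticFunction.moebius n : ℝ)| ≤ 1 := by
        exact_mod_cast ArithmeticFunction.abs_moebius_le_one
      have b2 := hfr n hn
      have b3 := mul_le_mul b1 b2 (abs_nonneg _) zero_le_one
      refine b3.trans ?_
      split_ifs <;> simp
    refine (Finset.sum_le_sum this).trans ?_
    rw [Finset.sum_sub_distrib, Finset.sum_ite_eq' (Ioc 0 N) N]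
    simp [hN]
  have e1 : ∑ n ∈ Ioc 0 N, (ArithmeticFunction.moebius n : ℝ) *
      ((N : ℝ) / n - ((N / n : ℕ) : ℝ)) =
      N * (∑ n ∈ Ioc 0 N, (ArithmeticFunction.moebius n : ℝ) / n) - 1 := by
    rw [key, Finset.mul_sum, ← Finset.sum_sub_distrib]
    refine Finset.sum_congr rfl fun n _ => by ring
  rw [e1] at hsum
  have h3 : |(N : ℝ) * (∑ n ∈ Ioc 0 N, (ArithmeticFunction.moebius n : ℝ) / n)| ≤ N := by
    have := abs_le.1 hsum
    rw [abs_le]; constructor <;> linarith [this.1, this.2]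
  rw [abs_mul, abs_of_pos hNr] at h3
  exact le_of_mul_le_mul_left (by linarith) hNr

/-- The logarithmically weighted sum `∑_{d ≤ x} μ(d)/d · log (x/d)`. -/
def moebiusLog (x : ℝ) : ℝ :=
  ∑ d ∈ Ioc 0 ⌊x⌋₊, (ArithmeticFunction.moebius d : ℝ) / d * Real.log (x / d)

theorem sum_moebius_div_mul_harmonic {N : ℕ} (hN : 0 < N) :
    ∑ n ∈ Ioc 0 N, (ArithmeticFunction.moebius n : ℝ) / n * (harmonic (N / n) : ℝ) = 1 := by
  let f : ArithmeticFunction ℝ := ⟨fun n => (ArithmeticFunction.moebius n : ℝ) / n, by simp⟩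
  let g : ArithmeticFunction ℝ := ⟨fun n => (n : ℝ)⁻¹, by simp⟩
  have key := ArithmeticFunction.sum_Ioc_mul_eq_sum_sum f g N
  have hfg : f * g = 1 := by
    ext n
    have h1 := congrArg (fun F : ArithmeticFunction ℝ => F n)
      (ArithmeticFunction.coe_moebius_mul_coe_zeta (R := ℝ))
    simp only [ArithmeticFunction.mul_apply] at h1 ⊢
    rcases eq_or_ne n 0 with rfl | hn
    · simp
    have h2 : ∑ x ∈ n.divisorsAntidiagonal, f x.1 * g x.2 =
        (∑ x ∈ n.divisorsAntidiagonal, ((ArithmeticFunction.moebius : ArithmeticFunction ℝ) x.1) *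
          ((ArithmeticFunction.zeta : ArithmeticFunction ℝ) x.2)) / n := by
      rw [Finset.sum_div]
      refine Finset.sum_congr rfl fun x hx => ?_
      obtain ⟨h3, h4⟩ := Nat.mem_divisorsAntidiagonal.1 hx
      have h5 : x.2 ≠ 0 := by rintro h; apply h4; rw [← h3, h]; simp
      have h6 : x.1 ≠ 0 := by rintro h; apply h4; rw [← h3, h]; simp
      simp only [f, g, ArithmeticFunction.coe_mk, ArithmeticFunction.intCoe_apply,
        ArithmeticFunction.natCoe_apply, ArithmeticFunction.zeta_apply, h5, if_false, ← h3]
      push_cast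
      field_simp
    rw [h2, h1]
    rcases eq_or_ne n 1 with rfl | hn1
    · simp
    · simp [ArithmeticFunction.one_apply_ne hn1]
  rw [hfg] at key
  have h1 : ∑ n ∈ Ioc 0 N, (1 : ArithmeticFunction ℝ) n = 1 := by
    rw [Finset.sum_eq_single 1]
    · simp
    · intro b _ hb; exact ArithmeticFunction.one_apply_ne hb
    · intro h; exact absurd (Finset.mem_Ioc.2 ⟨one_pos, hN⟩) h
  rw [h1] at key
  rw [key]
  refine Finset.sum_congr rfl fun n _ => ?_
  simp only [f, g, ArithmeticFunction.coe_mk, harmonic_eq_sum_Icc]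
  push_cast
  rfl

theorem abs_harmonic_floor_sub_log_le {y : ℝ} (hy : 1 ≤ y) :
    |(harmonic ⌊y⌋₊ : ℝ) - Real.log y - Real.eulerMascheroniConstant| ≤ 2 / y := by
  set n := ⌊y⌋₊ with hn
  have hn1 : 1 ≤ n := Nat.one_le_floor_iff _ |>.2 hy
  have hnr : (1 : ℝ) ≤ n := by exact_mod_cast hn1
  have h1 := Real.eulerMascheroniSeq_lt_eulerMascheroniConstant n
  have h2 := Real.eulerMascheroniConstant_lt_eulerMascheroniSeq' n
  rw [Real.eulerMascheroniSeq] at h1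
  rw [Real.eulerMascheroniSeq', if_neg (by omega)] at h2
  have h3 : (n : ℝ) ≤ y := Nat.floor_le (by linarith)
  have h4 : y < n + 1 := Nat.lt_floor_add_one y
  have h5 : Real.log n ≤ Real.log y := Real.log_le_log (by linarith) h3
  have h6 : Real.log y ≤ Real.log (n + 1) := Real.log_le_log (by linarith) h4.le
  have h7 : Real.log (n + 1) - Real.log n ≤ 1 / n := by
    rw [← Real.log_div (by linarith) (by linarith)]
    have := Real.log_le_sub_one_of_pos (x := ((n : ℝ) + 1) / n) (by positivity)
    refine this.trans_eq ?_
    field_simp; ring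
  have h8 : 1 / (n : ℝ) ≤ 2 / y := by
    rw [div_le_div_iff₀ (by linarith) (by linarith)]; linarith
  rw [abs_le]; constructor <;> linarith

theorem moebiusLog_of_lt_one {x : ℝ} (hx : x < 1) : moebiusLog x = 0 := by
  unfold moebiusLog
  rw [Nat.floor_eq_zero.2 hx]; simp

theorem abs_moebiusLog_le (x : ℝ) : |moebiusLog x| ≤ 4 := by
  rcases lt_or_ge x 1 with hx | hx
  · rw [moebiusLog_of_lt_one hx]; norm_num
  have hN : 0 < ⌊x⌋₊ := Nat.floor_pos.2 hx
  have hxN : (⌊x⌋₊ : ℝ) ≤ x := Nat.floor_le (by linarith)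
  have h1 := sum_moebius_div_mul_harmonic hN
  have h2 := abs_sum_moebius_div_le ⌊x⌋₊
  have hE : |∑ n ∈ Ioc 0 ⌊x⌋₊, (ArithmeticFunction.moebius n : ℝ) / n *
      ((harmonic (⌊x⌋₊ / n) : ℝ) - Real.log (x / n) - Real.eulerMascheroniConstant)| ≤ 2 := by
    refine (Finset.abs_sum_le_sum_abs _ _).trans ?_
    have : ∀ n ∈ Ioc 0 ⌊x⌋₊, |(ArithmeticFunction.moebius n : ℝ) / n *
      ((harmonic (⌊x⌋₊ / n) : ℝ) - Real.log (x / n) - Real.eulerMascheroniConstant)| ≤ 2 / x := by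
      intro n hn
      obtain ⟨hn0, hn1⟩ := Finset.mem_Ioc.1 hn
      have hnr : (0 : ℝ) < n := by exact_mod_cast hn0
      have hnx : (n : ℝ) ≤ x := le_trans (by exact_mod_cast hn1) hxN
      have hy : 1 ≤ x / n := by rw [le_div_iff₀ hnr]; linarith
      have := abs_harmonic_floor_sub_log_le hy
      rw [Nat.floor_div_natCast] at this
      have b1 : |(ArithmeticFunction.moebius n : ℝ)| ≤ 1 := by
        exact_mod_cast ArithmeticFunction.abs_moebius_le_one
      rw [abs_mul, abs_div, abs_of_pos hnr]
      calc _ ≤ 1 / (n : ℝ) * (2 / (x / n)) := by gcongr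
        _ = 2 / x := by field_simp
    refine (Finset.sum_le_sum this).trans ?_
    rw [Finset.sum_const, Nat.card_Ioc, nsmul_eq_mul, Nat.sub_zero]
    calc _ ≤ x * (2 / x) := by gcongr
      _ = 2 := by field_simp
  have e1 : ∑ n ∈ Ioc 0 ⌊x⌋₊, (ArithmeticFunction.moebius n : ℝ) / n *
      ((harmonic (⌊x⌋₊ / n) : ℝ) - Real.log (x / n) - Real.eulerMascheroniConstant) =
      1 - moebiusLog x - Real.eulerMascheroniConstant *
        ∑ n ∈ Ioc 0 ⌊x⌋₊, (ArithmeticFunction.moebius n : ℝ) / n := by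
    rw [← h1, moebiusLog, Finset.mul_sum, ← Finset.sum_sub_distrib, ← Finset.sum_sub_distrib]
    refine Finset.sum_congr rfl fun n _ => by ring
  rw [e1] at hE
  have hg0 := Real.one_half_lt_eulerMascheroniConstant
  have hg1 := Real.eulerMascheroniConstant_lt_two_thirds
  have h4 : |Real.eulerMascheroniConstant *
        ∑ n ∈ Ioc 0 ⌊x⌋₊, (ArithmeticFunction.moebius n : ℝ) / n| ≤ 1 := by
    rw [abs_mul, abs_of_pos (by linarith)]
    exact mul_le_one₀ (by linarith) (abs_nonneg _) h2
  rw [abs_le] at *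
  constructor <;> linarith [hE.1, hE.2, h4.1, h4.2]

theorem sub_posPart_eq_integral (a u v : ℝ) (huv : u ≤ v) :
    max (v - a) 0 - max (u - a) 0 = ∫ t in u..v, if a ≤ t then (1 : ℝ) else 0 := by
  rw [intervalIntegral.integral_of_le huv]
  have : (fun t : ℝ => if a ≤ t then (1 : ℝ) else 0) = (Set.Ici a).indicator (fun _ => 1) := by
    ext t; simp [Set.indicator]
  rw [this, MeasureTheory.setIntegral_indicator measurableSet_Ici]
  have h2 : ∫ x in Set.Ioc u v ∩ Set.Ici a, (1 : ℝ) = ∫ x in Set.Ioc (max u a) v, (1 : ℝ) := by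
    apply MeasureTheory.setIntegral_congr_set
    have hne : ∀ᵐ t : ℝ, t ≠ a := by
      simp [MeasureTheory.ae_iff]
    filter_upwards [hne] with t ht
    refine propext ⟨fun ⟨⟨h1, h2⟩, h3⟩ => ⟨max_lt h1 (lt_of_le_of_ne h3 ht.symm), h2⟩,
      fun ⟨h1, h2⟩ => ⟨⟨(le_max_left _ _).trans_lt h1, h2⟩,
        ((le_max_right _ _).trans_lt h1).le⟩⟩
  rw [h2]
  simp
  rcases le_total a u with h | h
  · rw [max_eq_left h, max_eq_left (by linarith), max_eq_left (by linarith),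
      max_eq_left (by linarith)]; ring
  · rw [max_eq_right h, max_eq_right (a := u - a) (by linarith)]; ring_nf

theorem moebiusLog_exp_eq {u : ℝ} {M : ℕ} (hM : Real.exp u ≤ M) :
    moebiusLog (Real.exp u) =
      ∑ d ∈ Ioc 0 M, (ArithmeticFunction.moebius d : ℝ) / d * max (u - Real.log d) 0 := by
  have hsub : Ioc 0 ⌊Real.exp u⌋₊ ⊆ Ioc 0 M := by
    apply Finset.Ioc_subset_Ioc_right
    exact Nat.floor_le_of_le hM
  rw [moebiusLog]
  refine (Finset.sum_congr rfl ?_).trans (Finset.sum_subset hsub ?_)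
  · intro d hd
    obtain ⟨hd0, hd1⟩ := Finset.mem_Ioc.1 hd
    have hdr : (0 : ℝ) < d := by exact_mod_cast hd0
    rw [Real.log_div (Real.exp_pos u).ne' hdr.ne', Real.log_exp, max_eq_left]
    have : Real.log d ≤ u := by
      rw [Real.log_le_iff_le_exp hdr]
      exact (Nat.le_floor_iff (Real.exp_pos u).le).1 hd1
    linarith
  · intro d hd hd'
    have hd0 := (Finset.mem_Ioc.1 hd).1
    have hdr : (0 : ℝ) < d := by exact_mod_cast hd0
    have : ¬ d ≤ ⌊Real.exp u⌋₊ := fun h => hd' (Finset.mem_Ioc.2 ⟨hd0, h⟩)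
    rw [Nat.le_floor_iff (Real.exp_pos u).le, not_le] at this
    have : u < Real.log d := by rwa [Real.lt_log_iff_exp_lt hdr]
    rw [max_eq_right (by linarith), mul_zero]

theorem abs_moebiusLog_exp_sub_le {u v : ℝ} (huv : u ≤ v) :
    |moebiusLog (Real.exp v) - moebiusLog (Real.exp u)| ≤ v - u := by
  obtain ⟨M, hM⟩ := exists_nat_ge (Real.exp v)
  have hMu : Real.exp u ≤ M := (Real.exp_le_exp.2 huv).trans hM
  rw [moebiusLog_exp_eq hM, moebiusLog_exp_eq hMu, ← Finset.sum_sub_distrib]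
  have hint : ∀ a : ℝ, IntervalIntegrable (fun t : ℝ => if a ≤ t then (1 : ℝ) else 0)
      MeasureTheory.volume u v := by
    intro a
    have : Monotone (fun t : ℝ => if a ≤ t then (1 : ℝ) else 0) := by
      intro s t hst
      dsimp only
      split_ifs <;> linarith
    exact this.intervalIntegrable
  have e : ∀ d ∈ Ioc 0 M, (ArithmeticFunction.moebius d : ℝ) / d * max (v - Real.log d) 0 -
      (ArithmeticFunction.moebius d : ℝ) / d * max (u - Real.log d) 0 =
      ∫ t in u..v, (ArithmeticFunction.moebius d : ℝ) / d *
        (if Real.log d ≤ t then (1 : ℝ) else 0) := by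
    intro d _
    rw [← mul_sub, sub_posPart_eq_integral _ _ _ huv, intervalIntegral.integral_const_mul]
  rw [Finset.sum_congr rfl e, ← intervalIntegral.integral_finsetSum
    (fun d _ => (hint _).const_mul _)]
  have := intervalIntegral.norm_integral_le_of_norm_le_const (a := u) (b := v) (C := 1)
    (f := fun t => ∑ d ∈ Ioc 0 M, (ArithmeticFunction.moebius d : ℝ) / d *
        (if Real.log d ≤ t then (1 : ℝ) else 0)) ?_
  · rwa [one_mul, abs_of_nonneg (by linarith)] at this
  · intro t ht
    rw [Set.uIoc_of_le huv] at ht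
    have : ∑ d ∈ Ioc 0 M, (ArithmeticFunction.moebius d : ℝ) / d *
        (if Real.log d ≤ t then (1 : ℝ) else 0) =
        ∑ d ∈ Ioc 0 ⌊Real.exp t⌋₊, (ArithmeticFunction.moebius d : ℝ) / d := by
      simp only [mul_ite, mul_one, mul_zero]
      rw [← Finset.sum_filter]
      congr 1
      ext d
      simp only [Finset.mem_filter, Finset.mem_Ioc, Nat.le_floor_iff (Real.exp_pos t).le]
      constructor
      · rintro ⟨⟨h1, h2⟩, h3⟩
        exact ⟨h1, (Real.log_le_iff_le_exp (by exact_mod_cast h1)).1 h3⟩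
      · rintro ⟨h1, h3⟩
        refine ⟨⟨h1, ?_⟩, (Real.log_le_iff_le_exp (by exact_mod_cast h1)).2 h3⟩
        have : (d : ℝ) ≤ M := h3.trans ((Real.exp_le_exp.2 ht.2).trans hM)
        exact_mod_cast this
    rw [this]
    exact abs_sum_moebius_div_le _

/-- The Fejér kernel `2 (1 - cos x) / x²`. -/
def fejerKernel (x : ℝ) : ℝ := 2 * (1 - Real.cos x) / x ^ 2

theorem fejerKernel_nonneg (x : ℝ) : 0 ≤ fejerKernel x := by
  unfold fejerKernel
  have := Real.cos_le_one x
  have : 0 ≤ 1 - Real.cos x := by linarith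
  positivity

theorem fejerKernel_le (x : ℝ) : fejerKernel x ≤ 5 * (1 + x ^ 2)⁻¹ := by
  unfold fejerKernel
  rcases eq_or_ne x 0 with rfl | hx
  · simp
  have hx2 : 0 < x ^ 2 := by positivity
  rw [div_le_iff₀ hx2, mul_assoc, inv_mul_eq_div, mul_div_assoc', le_div_iff₀ (by positivity)]
  have h1 := Real.neg_one_le_cos x
  have h2 := Real.one_sub_sq_div_two_le_cos (x := x)
  nlinarith

theorem measurable_fejerKernel : Measurable fejerKernel := by
  unfold fejerKernel; fun_prop

theorem integrable_fejerKernel : MeasureTheory.Integrable fejerKernel := by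
  refine (integrable_inv_one_add_sq.const_mul 5).mono' measurable_fejerKernel.aestronglyMeasurable
    (Eventually.of_forall fun x => ?_)
  rw [Real.norm_of_nonneg (fejerKernel_nonneg x)]
  exact fejerKernel_le x

theorem integral_fejerKernel_pos : 0 < ∫ x, fejerKernel x := by
  rw [MeasureTheory.integral_pos_iff_support_of_nonneg fejerKernel_nonneg integrable_fejerKernel]
  have : Set.Ioo (1 : ℝ) 2 ⊆ Function.support fejerKernel := by
    intro x hx
    have h1 : Real.cos x < 1 := by
      rw [← Real.cos_zero]
      exact Real.cos_lt_cos_of_nonneg_of_le_pi le_rfl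
        (by linarith [hx.2, Real.pi_gt_three]) (by linarith [hx.1])
    have h2 : 0 < x := by linarith [hx.1]
    have h3 : 0 < 1 - Real.cos x := by linarith
    have : 0 < fejerKernel x := by unfold fejerKernel; positivity
    exact this.ne'
  refine lt_of_lt_of_le ?_ (MeasureTheory.measure_mono this)
  simp

theorem integral_triangle_mul_cexp {x : ℝ} (hx : x ≠ 0) :
    ∫ t in (-1 : ℝ)..1, ((1 - |t| : ℝ) : ℂ) * Complex.exp (Complex.I * t * x) =
      (fejerKernel x : ℂ) := by
  have hc : Continuous fun t : ℝ => ((1 - |t| : ℝ) : ℂ) * Complex.exp (Complex.I * t * x) := by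
    fun_prop
  have hxc : (x : ℂ) ≠ 0 := by exact_mod_cast hx
  have hI := Complex.I_ne_zero
  rw [← intervalIntegral.integral_add_adjacent_intervals (b := 0)
    (hc.intervalIntegrable _ _) (hc.intervalIntegrable _ _)]
  have h1 : ∫ t in (-1 : ℝ)..0, ((1 - |t| : ℝ) : ℂ) * Complex.exp (Complex.I * t * x) =
      ∫ t in (-1 : ℝ)..0, (1 + (t : ℂ)) * Complex.exp (Complex.I * t * x) := by
    apply intervalIntegral.integral_congr
    intro t ht
    rw [Set.uIcc_of_le (by norm_num)] at ht
    simp only [abs_of_nonpos ht.2]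
    push_cast; ring
  have h2 : ∫ t in (0 : ℝ)..1, ((1 - |t| : ℝ) : ℂ) * Complex.exp (Complex.I * t * x) =
      ∫ t in (0 : ℝ)..1, (1 - (t : ℂ)) * Complex.exp (Complex.I * t * x) := by
    apply intervalIntegral.integral_congr
    intro t ht
    rw [Set.uIcc_of_le (by norm_num)] at ht
    simp only [abs_of_nonneg ht.1]
    push_cast; ring
  have hexp : ∀ t : ℝ, HasDerivAt (fun t : ℝ => Complex.exp (Complex.I * t * x))
      (Complex.I * x * Complex.exp (Complex.I * t * x)) t := by
    intro t
    have h := (((Complex.ofRealCLM.hasDerivAt (x := t)).const_mul Complex.I).mul_const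
      (x : ℂ)).cexp
    simp only [Complex.ofRealCLM_apply, Complex.ofReal_one, mul_one] at h
    rw [mul_comm]; exact h
  have h3 := intervalIntegral.integral_eq_sub_of_hasDerivAt (a := -1) (b := 0)
    (f := fun t : ℝ => (1 + (t : ℂ)) * Complex.exp (Complex.I * t * x) / (Complex.I * x) +
      Complex.exp (Complex.I * t * x) / x ^ 2)
    (f' := fun t : ℝ => (1 + (t : ℂ)) * Complex.exp (Complex.I * t * x))
    (fun t _ => by
      have a := ((((Complex.ofRealCLM.hasDerivAt (x := t)).const_add (1 : ℂ)).mul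
        (hexp t)).div_const (Complex.I * x)).add ((hexp t).div_const ((x : ℂ) ^ 2))
      refine a.congr_deriv ?_
      simp only [Complex.ofRealCLM_apply, Complex.ofReal_one]
      field_simp
      linear_combination Complex.I_sq)
    (Continuous.intervalIntegrable (by fun_prop) _ _)
  have h4 := intervalIntegral.integral_eq_sub_of_hasDerivAt (a := 0) (b := 1)
    (f := fun t : ℝ => (1 - (t : ℂ)) * Complex.exp (Complex.I * t * x) / (Complex.I * x) -
      Complex.exp (Complex.I * t * x) / x ^ 2)
    (f' := fun t : ℝ => (1 - (t : ℂ)) * Complex.exp (Complex.I * t * x))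
    (fun t _ => by
      have a := ((((Complex.ofRealCLM.hasDerivAt (x := t)).const_sub (1 : ℂ)).mul
        (hexp t)).div_const (Complex.I * x)).sub ((hexp t).div_const ((x : ℂ) ^ 2))
      refine a.congr_deriv ?_
      simp only [Complex.ofRealCLM_apply, Complex.ofReal_one]
      field_simp
      linear_combination -Complex.I_sq)
    (Continuous.intervalIntegrable (by fun_prop) _ _)
  rw [h1, h2, h3, h4]
  have e1 : Complex.exp (Complex.I * ((1 : ℝ) : ℂ) * x) =
      Complex.cos x + Complex.sin x * Complex.I := by
    rw [← Complex.exp_mul_I]; congr 1; push_cast; ring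
  have e2 : Complex.exp (Complex.I * ((-1 : ℝ) : ℂ) * x) =
      Complex.cos x - Complex.sin x * Complex.I := by
    have : Complex.I * ((-1 : ℝ) : ℂ) * x = (-(x : ℂ)) * Complex.I := by push_cast; ring
    rw [this, Complex.exp_mul_I, Complex.cos_neg, Complex.sin_neg]; ring
  rw [e1, e2, fejerKernel]
  push_cast
  simp
  field_simp
  ring

section Tauberian

open MeasureTheory

variable {θ : ℝ → ℝ} {K : ℝ} {G : ℂ → ℂ}

theorem integral_mul_fejerKernel_laplace (hθm : Measurable θ) (hK : ∀ u, |θ u| ≤ K)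
    (h0 : ∀ u ≤ 0, θ u = 0)
    (hL : ∀ s : ℂ, 0 < s.re → ∫ u : ℝ, (θ u : ℂ) * Complex.exp (-(s * u)) = G s)
    {l x σ : ℝ} (hl : 0 < l) (hσ : 0 < σ) :
    ∫ u : ℝ, ((θ u * Real.exp (-(σ * u)) * fejerKernel (l * (x - u)) : ℝ) : ℂ) =
      ∫ t in (-1 : ℝ)..1, ((1 - |t| : ℝ) : ℂ) * Complex.exp (Complex.I * t * (l * x)) *
        G (σ + Complex.I * (l * t)) := by
  have hf0 : Integrable (fun u : ℝ => θ u * Real.exp (-(σ * u))) := by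
    have h1 : Integrable (Set.indicator (Set.Ioi 0) fun u : ℝ => K * Real.exp (-(σ * u))) := by
      rw [integrable_indicator_iff measurableSet_Ioi]
      apply Integrable.const_mul
      have := exp_neg_integrableOn_Ioi 0 hσ
      show IntegrableOn _ _ _
      simpa [neg_mul] using this
    refine h1.mono' (by fun_prop) (Eventually.of_forall fun u => ?_)
    by_cases hu : 0 < u
    · rw [Set.indicator_of_mem (by exact hu), norm_mul, Real.norm_eq_abs, Real.norm_eq_abs,
        Real.abs_exp]
      exact mul_le_mul_of_nonneg_right (hK u) (Real.exp_pos _).le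
    · rw [h0 u (not_lt.1 hu)]; simp [Set.indicator, hu]
  have hf : Integrable (fun u : ℝ => ((θ u * Real.exp (-(σ * u)) : ℝ) : ℂ)) := hf0.ofReal
  have hswap : ∀ u : ℝ, l * (x - u) ≠ 0 →
      ((θ u * Real.exp (-(σ * u)) * fejerKernel (l * (x - u)) : ℝ) : ℂ) =
      ∫ t in Set.Ioc (-1 : ℝ) 1, ((θ u * Real.exp (-(σ * u)) : ℝ) : ℂ) * (((1 - |t| : ℝ) : ℂ) *
        Complex.exp (Complex.I * t * ((l * (x - u) : ℝ) : ℂ))) := by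
    intro u hu
    rw [integral_const_mul, ← intervalIntegral.integral_of_le (by norm_num),
      integral_triangle_mul_cexp hu]
    push_cast; ring
  have hae : ∀ᵐ u : ℝ, l * (x - u) ≠ 0 := by
    have : ∀ᵐ u : ℝ, u ≠ x := by simp [ae_iff]
    filter_upwards [this] with u hu
    exact mul_ne_zero hl.ne' (sub_ne_zero.2 hu.symm)
  rw [integral_congr_ae (hae.mono hswap), integral_integral_swap,
    intervalIntegral.integral_of_le (by norm_num)]
  · apply integral_congr_ae
    refine Eventually.of_forall fun t => ?_
    dsimp only
    rw [← hL _ (by simp [hσ]), ← integral_const_mul]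
    apply integral_congr_ae
    refine Eventually.of_forall fun u => ?_
    dsimp only
    have : Complex.exp (Complex.I * t * ((l * (x - u) : ℝ) : ℂ)) *
        Complex.exp (-(σ * u : ℂ)) = Complex.exp (Complex.I * t * (l * x)) *
        Complex.exp (-((σ + Complex.I * (l * t)) * u)) := by
      rw [← Complex.exp_add, ← Complex.exp_add]; congr 1; push_cast; ring
    push_cast at this ⊢
    linear_combination (θ u : ℂ) * (1 - ((|t| : ℝ) : ℂ)) * this
  · have hg : Integrable (fun t : ℝ => ((1 - |t| : ℝ) : ℂ)) (volume.restrict (Set.Ioc (-1) 1)) := by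
      have : Continuous (fun t : ℝ => ((1 - |t| : ℝ) : ℂ)) := by fun_prop
      exact (this.integrableOn_Icc (a := -1) (b := 1)).mono_set Set.Ioc_subset_Icc_self
    have hp := hf.mul_prod hg
    have := hp.bdd_mul (c := 1)
      (f := fun z : ℝ × ℝ => Complex.exp (Complex.I * z.2 * ((l * (x - z.1) : ℝ) : ℂ)))
      (Continuous.aestronglyMeasurable (by fun_prop))
      (Eventually.of_forall fun z => by
        have : Complex.I * z.2 * ((l * (x - z.1) : ℝ) : ℂ) =
          ((z.2 * (l * (x - z.1)) : ℝ) : ℂ) * Complex.I := by push_cast; ring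
        rw [this, Complex.norm_exp_ofReal_mul_I])
    refine this.congr (Eventually.of_forall fun z => ?_)
    simp only [Function.uncurry]
    ring

theorem integral_mul_fejerKernel_boundary (hθm : Measurable θ) (hK : ∀ u, |θ u| ≤ K)
    (h0 : ∀ u ≤ 0, θ u = 0) (hG : Continuous G)
    (hL : ∀ s : ℂ, 0 < s.re → ∫ u : ℝ, (θ u : ℂ) * Complex.exp (-(s * u)) = G s)
    {l x : ℝ} (hl : 0 < l) :
    ∫ u : ℝ, ((θ u * fejerKernel (l * (x - u)) : ℝ) : ℂ) =
      ∫ t in (-1 : ℝ)..1, ((1 - |t| : ℝ) : ℂ) * Complex.exp (Complex.I * t * (l * x)) *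
        G (Complex.I * (l * t)) := by
  have hR : Tendsto (fun σ : ℝ => ∫ t in (-1 : ℝ)..1, ((1 - |t| : ℝ) : ℂ) *
      Complex.exp (Complex.I * t * (l * x)) * G (σ + Complex.I * (l * t)))
      (nhdsWithin 0 (Set.Ioi 0))
      (nhds (∫ t in (-1 : ℝ)..1, ((1 - |t| : ℝ) : ℂ) * Complex.exp (Complex.I * t * (l * x)) *
        G (Complex.I * (l * t)))) := by
    have hc : Continuous fun σ : ℝ => ∫ t in (-1 : ℝ)..1, ((1 - |t| : ℝ) : ℂ) *
      Complex.exp (Complex.I * t * (l * x)) * G (σ + Complex.I * (l * t)) := by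
      apply intervalIntegral.continuous_parametric_intervalIntegral_of_continuous'
      fun_prop
    have := (hc.tendsto 0).mono_left (nhdsWithin_le_nhds (s := Set.Ioi 0))
    simpa using this
  have hbi : Integrable fun u : ℝ => K * fejerKernel (l * (x - u)) := by
    apply Integrable.const_mul
    have h1 := integrable_fejerKernel.comp_mul_left' hl.ne'
    exact h1.comp_sub_left x
  have hLt : Tendsto (fun σ : ℝ =>
      ∫ u : ℝ, ((θ u * Real.exp (-(σ * u)) * fejerKernel (l * (x - u)) : ℝ) : ℂ))
      (nhdsWithin 0 (Set.Ioi 0))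
      (nhds (∫ u : ℝ, ((θ u * fejerKernel (l * (x - u)) : ℝ) : ℂ))) := by
    have hfm := measurable_fejerKernel
    apply tendsto_integral_filter_of_dominated_convergence _ _ _ hbi
    · refine Eventually.of_forall fun u => ?_
      have : Continuous fun σ : ℝ =>
          ((θ u * Real.exp (-(σ * u)) * fejerKernel (l * (x - u)) : ℝ) : ℂ) := by fun_prop
      have := (this.tendsto 0).mono_left (nhdsWithin_le_nhds (s := Set.Ioi 0))
      simpa using this
    · refine Eventually.of_forall fun σ => ?_
      apply Measurable.aestronglyMeasurable
      fun_prop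
    · filter_upwards [self_mem_nhdsWithin] with σ hσ
      refine Eventually.of_forall fun u => ?_
      rw [Complex.norm_real, norm_mul, Real.norm_of_nonneg (fejerKernel_nonneg _)]
      apply mul_le_mul_of_nonneg_right _ (fejerKernel_nonneg _)
      rw [norm_mul, Real.norm_eq_abs, Real.norm_eq_abs, Real.abs_exp]
      rcases le_or_gt u 0 with hu | hu
      · rw [h0 u hu, abs_zero, zero_mul]; exact (abs_nonneg _).trans (hK 0)
      · have : Real.exp (-(σ * u)) ≤ 1 := by
          rw [Real.exp_le_one_iff]
          have := mul_pos (show 0 < σ from hσ) hu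
          linarith
        calc _ ≤ K * 1 := mul_le_mul (hK u) this (Real.exp_pos _).le ((abs_nonneg _).trans (hK 0))
          _ = K := mul_one K
  refine tendsto_nhds_unique hLt (hR.congr' ?_)
  filter_upwards [self_mem_nhdsWithin] with σ hσ
  exact (integral_mul_fejerKernel_laplace hθm hK h0 hL hl hσ).symm

theorem tendsto_integral_mul_fejerKernel (hθm : Measurable θ) (hK : ∀ u, |θ u| ≤ K)
    (h0 : ∀ u ≤ 0, θ u = 0) (hG : Continuous G)
    (hL : ∀ s : ℂ, 0 < s.re → ∫ u : ℝ, (θ u : ℂ) * Complex.exp (-(s * u)) = G s)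
    {l : ℝ} (hl : 0 < l) :
    Tendsto (fun x : ℝ => ∫ u : ℝ, θ u * fejerKernel (l * (x - u))) atTop (nhds 0) := by
  have hRL := Real.tendsto_integral_exp_smul_cocompact
    (Set.indicator (Set.Ioc (-1 : ℝ) 1) fun t : ℝ => ((1 - |t| : ℝ) : ℂ) * G (Complex.I * (l * t)))
  have hw : Tendsto (fun x : ℝ => -(l / (2 * Real.pi)) * x) atTop (cocompact ℝ) := by
    have : Tendsto (fun x : ℝ => -(l / (2 * Real.pi)) * x) atTop atBot :=
      tendsto_id.const_mul_atTop_of_neg (by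
        have := Real.pi_pos
        have : 0 < l / (2 * Real.pi) := by positivity
        linarith)
    exact this.mono_right atBot_le_cocompact
  have h := hRL.comp hw
  have h2 : Tendsto (fun x : ℝ => ‖∫ u : ℝ, ((θ u * fejerKernel (l * (x - u)) : ℝ) : ℂ)‖) atTop
      (nhds 0) := by
    rw [tendsto_zero_iff_norm_tendsto_zero] at h
    refine h.congr fun x => ?_
    rw [integral_mul_fejerKernel_boundary hθm hK h0 hG hL hl,
      intervalIntegral.integral_of_le (by norm_num), ← integral_indicator measurableSet_Ioc]
    congr 1
    apply integral_congr_ae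
    refine Eventually.of_forall fun t => ?_
    beta_reduce
    by_cases ht : t ∈ Set.Ioc (-1 : ℝ) 1
    · rw [Set.indicator_of_mem ht, Set.indicator_of_mem ht, Circle.smul_def,
        Real.fourierChar_apply, smul_eq_mul]
      have : (2 * Real.pi * -(t * (-(l / (2 * Real.pi)) * x)) : ℝ) = t * (l * x) := by
        have := Real.pi_pos
        field_simp
      rw [this]
      have : ((t * (l * x) : ℝ) : ℂ) * Complex.I = Complex.I * t * (l * x) := by push_cast; ring
      rw [this]; ring
    · rw [Set.indicator_of_notMem ht, Set.indicator_of_notMem ht]; simp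
  rw [tendsto_zero_iff_norm_tendsto_zero]
  refine h2.congr fun x => ?_
  rw [integral_complex_ofReal]
  exact Complex.norm_real _

theorem tendsto_integral_min_fejerKernel (K : ℝ) (hK : 0 ≤ K) :
    Tendsto (fun l : ℝ => ∫ v : ℝ, min (2 * K) (2 * (|v| / l)) * fejerKernel v) atTop (nhds 0) := by
  have hfm := measurable_fejerKernel
  have h : Tendsto (fun l : ℝ => ∫ v : ℝ, min (2 * K) (2 * (|v| / l)) * fejerKernel v) atTop
      (nhds (∫ _ : ℝ, (0 : ℝ))) := by
    apply tendsto_integral_filter_of_dominated_convergence (fun v => 2 * K * fejerKernel v)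
    · refine Eventually.of_forall fun l => ?_
      apply Measurable.aestronglyMeasurable
      fun_prop
    · filter_upwards [eventually_gt_atTop 0] with l hl
      refine Eventually.of_forall fun v => ?_
      rw [norm_mul, Real.norm_of_nonneg (fejerKernel_nonneg v), Real.norm_of_nonneg
        (le_min (by positivity) (by positivity))]
      exact mul_le_mul_of_nonneg_right (min_le_left _ _) (fejerKernel_nonneg v)
    · exact integrable_fejerKernel.const_mul _
    · refine Eventually.of_forall fun v => ?_
      have h1 : Tendsto (fun l : ℝ => |v| / l) atTop (nhds 0) :=
        tendsto_const_nhds.div_atTop tendsto_id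
      have h2 := ((tendsto_const_nhds (x := 2 * K)).min (h1.const_mul 2)).mul_const (fejerKernel v)
      simpa [hK] using h2
  simpa using h

/-- A Wiener–Ikehara type theorem: a bounded Lipschitz function whose Laplace transform extends
continuously to the imaginary axis tends to zero. -/
theorem tendsto_zero_of_laplace_continuous (hlip : ∀ u v, |θ u - θ v| ≤ 2 * |u - v|)
    (hK : ∀ u, |θ u| ≤ K) (h0 : ∀ u ≤ 0, θ u = 0) (hG : Continuous G)
    (hL : ∀ s : ℂ, 0 < s.re → ∫ u : ℝ, (θ u : ℂ) * Complex.exp (-(s * u)) = G s) :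
    Tendsto θ atTop (nhds 0) := by
  have hcont : Continuous θ := by
    have : LipschitzWith 2 θ := LipschitzWith.of_dist_le_mul fun u v => by
      simpa [Real.dist_eq] using hlip u v
    exact this.continuous
  have hθm := hcont.measurable
  have hfm := measurable_fejerKernel
  have hK0 : 0 ≤ K := (abs_nonneg _).trans (hK 0)
  set c := ∫ x, fejerKernel x with hc
  have hcpos : 0 < c := integral_fejerKernel_pos
  have key : ∀ l : ℝ, 0 < l → ∀ x : ℝ, c * |θ x| ≤
      l * |∫ u : ℝ, θ u * fejerKernel (l * (x - u))| +
      ∫ v : ℝ, min (2 * K) (2 * (|v| / l)) * fejerKernel v := by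
    intro l hl x
    have e1 : l * ∫ u : ℝ, θ u * fejerKernel (l * (x - u)) =
        ∫ v : ℝ, θ (x - v / l) * fejerKernel v := by
      have h1 : ∫ u : ℝ, θ u * fejerKernel (l * (x - u)) =
          ∫ u : ℝ, θ (x - u) * fejerKernel (l * u) := by
        rw [← integral_sub_left_eq_self (fun u : ℝ => θ u * fejerKernel (l * (x - u))) volume x]
        simp
      have h2 := Measure.integral_comp_mul_left (fun v : ℝ => θ (x - v / l) * fejerKernel v) l
      rw [h1]
      have h3 : ∀ u : ℝ, θ (x - u) * fejerKernel (l * u) =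
          (fun v : ℝ => θ (x - v / l) * fejerKernel v) (l * u) := by
        intro u; simp only; congr 3; field_simp
      simp_rw [h3]
      rw [h2, abs_of_pos (by positivity), smul_eq_mul, ← mul_assoc, mul_inv_cancel₀ hl.ne', one_mul]
    have i1 : Integrable fun v : ℝ => θ (x - v / l) * fejerKernel v := by
      refine integrable_fejerKernel.bdd_mul (c := K) ?_ (Eventually.of_forall fun v => hK _)
      exact Measurable.aestronglyMeasurable (by fun_prop)
    have i2 : Integrable fun v : ℝ => θ x * fejerKernel v := integrable_fejerKernel.const_mul _
    have i3 : Integrable fun v : ℝ => min (2 * K) (2 * (|v| / l)) * fejerKernel v := by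
      refine integrable_fejerKernel.bdd_mul (c := 2 * K) ?_ (Eventually.of_forall fun v => ?_)
      · exact Measurable.aestronglyMeasurable (by fun_prop)
      · rw [Real.norm_of_nonneg (le_min (by positivity) (by positivity))]
        exact min_le_left _ _
    have e2 : |θ x * c - l * ∫ u : ℝ, θ u * fejerKernel (l * (x - u))| ≤
        ∫ v : ℝ, min (2 * K) (2 * (|v| / l)) * fejerKernel v := by
      rw [e1, hc, ← integral_const_mul, ← integral_sub i2 i1]
      rw [← Real.norm_eq_abs]
      refine norm_integral_le_of_norm_le i3 (Eventually.of_forall fun v => ?_)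
      rw [← sub_mul, norm_mul, Real.norm_of_nonneg (fejerKernel_nonneg v)]
      apply mul_le_mul_of_nonneg_right _ (fejerKernel_nonneg v)
      refine le_min ?_ ?_
      · have a1 := hK x
        have a2 := hK (x - v / l)
        rw [Real.norm_eq_abs]
        rw [abs_le] at *
        constructor <;> linarith [a1.1, a1.2, a2.1, a2.2]
      · have := hlip x (x - v / l)
        rwa [sub_sub_cancel, abs_div, abs_of_pos hl] at this
    have e3 := abs_sub_abs_le_abs_sub (θ x * c) (l * ∫ u : ℝ, θ u * fejerKernel (l * (x - u)))
    rw [abs_mul, abs_mul, abs_of_pos hcpos, abs_of_pos hl] at e3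
    linarith
  rw [Metric.tendsto_atTop']
  intro ε hε
  have hJ := (tendsto_integral_min_fejerKernel K hK0).eventually
    (gt_mem_nhds (show 0 < c * ε / 2 by positivity))
  obtain ⟨l, hl, hl0⟩ := (hJ.and (eventually_gt_atTop 0)).exists
  have hI := ((tendsto_integral_mul_fejerKernel hθm hK h0 hG hL hl0).abs.const_mul l).eventually
    (gt_mem_nhds (show l * |0| < c * ε / 2 by simp; positivity))
  obtain ⟨X, hX⟩ := eventually_atTop.1 hI
  refine ⟨X, fun x hx => ?_⟩
  have := key l hl0 x
  have h5 := hX x hx.le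
  rw [Real.dist_eq, sub_zero]
  have : c * |θ x| < c * ε := by linarith
  exact lt_of_mul_lt_mul_left this hcpos.le

end Tauberian

section Laplace

open MeasureTheory

theorem integrableOn_mul_exp_neg {σ : ℝ} (hσ : 0 < σ) :
    IntegrableOn (fun u : ℝ => u * Real.exp (-(σ * u))) (Set.Ioi 0) := by
  have := integrableOn_rpow_mul_exp_neg_mul_rpow (s := 1) (p := 1) (b := σ) (by norm_num)
    one_pos hσ
  simpa [neg_mul] using this

theorem norm_cexp_neg_mul (s : ℂ) (u : ℝ) :
    ‖Complex.exp (-(s * u))‖ = Real.exp (-(s.re * u)) := by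
  rw [Complex.norm_exp]; simp

theorem integrableOn_mul_cexp_neg {s : ℂ} (hs : 0 < s.re) :
    IntegrableOn (fun u : ℝ => (u : ℂ) * Complex.exp (-(s * u))) (Set.Ioi 0) := by
  refine (integrableOn_mul_exp_neg hs).mono' (Continuous.aestronglyMeasurable (by fun_prop)) ?_
  refine (ae_restrict_iff' measurableSet_Ioi).2 (Eventually.of_forall fun u hu => ?_)
  rw [norm_mul, norm_cexp_neg_mul, Complex.norm_real, Real.norm_of_nonneg (le_of_lt hu)]

theorem hasDerivAt_cexp_neg_mul (s : ℂ) (u : ℝ) :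
    HasDerivAt (fun u : ℝ => Complex.exp (-(s * u))) (-s * Complex.exp (-(s * u))) u := by
  have h := ((Complex.ofRealCLM.hasDerivAt (x := u)).const_mul s).neg.cexp
  simp only [Complex.ofRealCLM_apply, Complex.ofReal_one, mul_one] at h
  rw [mul_comm]; exact h

theorem tendsto_mul_exp_neg {σ : ℝ} (hσ : 0 < σ) :
    Tendsto (fun u : ℝ => u * Real.exp (-(σ * u))) atTop (nhds 0) := by
  have h := (Real.tendsto_pow_mul_exp_neg_atTop_nhds_zero 1).comp (tendsto_id.const_mul_atTop hσ)
  have h2 := h.const_mul σ⁻¹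
  rw [mul_zero] at h2
  refine h2.congr fun u => ?_
  simp only [Function.comp, id, pow_one]
  field_simp

theorem integral_Ioi_mul_cexp_neg {s : ℂ} (hs : 0 < s.re) :
    ∫ u in Set.Ioi (0 : ℝ), (u : ℂ) * Complex.exp (-(s * u)) = 1 / s ^ 2 := by
  have hs0 : s ≠ 0 := fun h => by simp [h] at hs
  have hd : ∀ u ∈ Set.Ici (0 : ℝ), HasDerivAt
      (fun u : ℝ => -((u : ℂ) * Complex.exp (-(s * u)) / s) - Complex.exp (-(s * u)) / s ^ 2)
      ((u : ℂ) * Complex.exp (-(s * u))) u := by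
    intro u _
    have h := ((((Complex.ofRealCLM.hasDerivAt (x := u)).mul
      (hasDerivAt_cexp_neg_mul s u)).div_const s).neg).sub
      ((hasDerivAt_cexp_neg_mul s u).div_const (s ^ 2))
    refine h.congr_deriv ?_
    simp only [Complex.ofRealCLM_apply, Complex.ofReal_one]
    field_simp
    ring
  have ht : Tendsto (fun u : ℝ => -((u : ℂ) * Complex.exp (-(s * u)) / s) -
      Complex.exp (-(s * u)) / s ^ 2) atTop (nhds 0) := by
    have h1 : Tendsto (fun u : ℝ => (u : ℂ) * Complex.exp (-(s * u))) atTop (nhds 0) := by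
      rw [tendsto_zero_iff_norm_tendsto_zero]
      refine (tendsto_mul_exp_neg hs).congr' ?_
      filter_upwards [eventually_ge_atTop 0] with u hu
      rw [norm_mul, norm_cexp_neg_mul, Complex.norm_real, Real.norm_of_nonneg hu]
    have h2 : Tendsto (fun u : ℝ => Complex.exp (-(s * u))) atTop (nhds 0) := by
      rw [tendsto_zero_iff_norm_tendsto_zero]
      refine (Real.tendsto_exp_neg_atTop_nhds_zero.comp (tendsto_id.const_mul_atTop hs)).congr ?_
      intro u; rw [norm_cexp_neg_mul]; rfl
    simpa using ((h1.div_const s).neg).sub (h2.div_const (s ^ 2))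
  rw [integral_Ioi_of_hasDerivAt_of_tendsto' hd (integrableOn_mul_cexp_neg hs) ht]
  simp

theorem max_zero_mul_cexp_eq_indicator (s : ℂ) :
    (fun u : ℝ => ((max u 0 : ℝ) : ℂ) * Complex.exp (-(s * u))) =
      (Set.Ioi 0).indicator fun u : ℝ => (u : ℂ) * Complex.exp (-(s * u)) := by
  ext u
  rcases le_or_gt u 0 with h | h
  · rw [Set.indicator_of_notMem (by simpa using h), max_eq_right h]; simp
  · rw [Set.indicator_of_mem (by exact h), max_eq_left h.le]

theorem integrable_max_sub_mul_cexp {s : ℂ} (hs : 0 < s.re) (a : ℝ) :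
    Integrable fun u : ℝ => ((max (u - a) 0 : ℝ) : ℂ) * Complex.exp (-(s * u)) := by
  have h : Integrable fun u : ℝ => ((max u 0 : ℝ) : ℂ) * Complex.exp (-(s * u)) := by
    rw [max_zero_mul_cexp_eq_indicator, integrable_indicator_iff measurableSet_Ioi]
    exact integrableOn_mul_cexp_neg hs
  refine ((h.comp_sub_right a).mul_const (Complex.exp (-(s * a)))).congr
    (Eventually.of_forall fun u => ?_)
  dsimp only
  rw [mul_assoc, ← Complex.exp_add]
  congr 2; push_cast; ring

theorem integral_max_sub_mul_cexp {s : ℂ} (hs : 0 < s.re) (a : ℝ) :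
    ∫ u : ℝ, ((max (u - a) 0 : ℝ) : ℂ) * Complex.exp (-(s * u)) =
      Complex.exp (-(s * a)) / s ^ 2 := by
  have h : ∫ u : ℝ, ((max u 0 : ℝ) : ℂ) * Complex.exp (-(s * u)) = 1 / s ^ 2 := by
    rw [max_zero_mul_cexp_eq_indicator, integral_indicator measurableSet_Ioi,
      integral_Ioi_mul_cexp_neg hs]
  have h2 := integral_sub_right_eq_self (μ := volume)
    (fun u : ℝ => ((max u 0 : ℝ) : ℂ) * Complex.exp (-(s * u))) a
  rw [h] at h2
  rw [div_eq_mul_one_div, ← h2, ← integral_const_mul]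
  apply integral_congr_ae
  refine Eventually.of_forall fun u => ?_
  dsimp only
  rw [mul_left_comm, ← Complex.exp_add]
  congr 2; push_cast; ring

theorem integral_norm_max_sub_mul_cexp {s : ℂ} (hs : 0 < s.re) (a : ℝ) :
    ∫ u : ℝ, ‖((max (u - a) 0 : ℝ) : ℂ) * Complex.exp (-(s * u))‖ =
      Real.exp (-(s.re * a)) / s.re ^ 2 := by
  have h := integral_max_sub_mul_cexp (s := (s.re : ℂ)) (by simpa using hs) a
  have h3 : ∀ u : ℝ, ((max (u - a) 0 : ℝ) : ℂ) * Complex.exp (-((s.re : ℂ) * u)) =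
      ((‖((max (u - a) 0 : ℝ) : ℂ) * Complex.exp (-(s * u))‖ : ℝ) : ℂ) := by
    intro u
    rw [norm_mul, norm_cexp_neg_mul, Complex.norm_real, Real.norm_of_nonneg (le_max_right _ _)]
    push_cast; rfl
  simp_rw [h3] at h
  rw [integral_complex_ofReal] at h
  exact_mod_cast h

theorem natCast_cexp_eq {d : ℕ} (hd : d ≠ 0) (s : ℂ) :
    (1 / (d : ℂ)) * Complex.exp (-(s * (Real.log d : ℝ))) = 1 / (d : ℂ) ^ (1 + s) := by
  have hdc : (d : ℂ) ≠ 0 := by exact_mod_cast hd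
  rw [Complex.cpow_add _ _ hdc, Complex.cpow_one, Complex.cpow_def_of_ne_zero hdc,
    ← Complex.natCast_log, Complex.exp_neg, mul_comm s]
  field_simp

theorem integral_moebiusLog_exp_mul_cexp {s : ℂ} (hs : 0 < s.re) :
    ∫ u : ℝ, (moebiusLog (Real.exp u) : ℂ) * Complex.exp (-(s * u)) =
      1 / (s ^ 2 * riemannZeta (1 + s)) := by
  let f : ℕ → ℝ → ℂ := fun d u => ((ArithmeticFunction.moebius d : ℂ) / d) *
    (((max (u - Real.log d) 0 : ℝ) : ℂ) * Complex.exp (-(s * u)))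
  have hs1 : 1 < (1 + s).re := by simpa using hs
  have hfi : ∀ d, Integrable (f d) := fun d => (integrable_max_sub_mul_cexp hs _).const_mul _
  have hterm : ∀ d, ((ArithmeticFunction.moebius d : ℂ) / d) *
      (Complex.exp (-(s * (Real.log d : ℝ))) / s ^ 2) =
      LSeries.term (fun n => (ArithmeticFunction.moebius n : ℂ)) (1 + s) d * (1 / s ^ 2) := by
    intro d
    rcases eq_or_ne d 0 with rfl | hd
    · simp
    rw [LSeries.term_of_ne_zero hd, div_eq_mul_one_div (_ : ℂ) ((d : ℂ) ^ (1 + s)),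
      ← natCast_cexp_eq hd]
    ring
  have hsum := (ArithmeticFunction.LSeriesSummable_moebius_iff (s := 1 + s)).2 hs1
  have hnorm : ∀ d, ∫ u, ‖f d u‖ =
      ‖LSeries.term (fun n => (ArithmeticFunction.moebius n : ℂ)) (1 + s) d‖ * (1 / s.re ^ 2) := by
    intro d
    simp only [f, norm_mul]
    simp_rw [← norm_mul (((max (_ - _) 0 : ℝ) : ℂ))]
    rw [integral_const_mul, integral_norm_max_sub_mul_cexp hs]
    rcases eq_or_ne d 0 with rfl | hd
    · simp
    rw [LSeries.term_of_ne_zero hd, div_eq_mul_one_div (_ : ℂ) ((d : ℂ) ^ (1 + s)),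
      ← natCast_cexp_eq hd]
    rw [norm_mul, norm_mul, norm_cexp_neg_mul, norm_div, norm_div, norm_one]
    ring
  have hns : Summable fun d => ∫ u, ‖f d u‖ := by
    simp_rw [hnorm]
    exact (hsum.norm).mul_right _
  have hpt : ∀ u : ℝ, ∑' d, f d u = (moebiusLog (Real.exp u) : ℂ) * Complex.exp (-(s * u)) := by
    intro u
    obtain ⟨M, hM⟩ := exists_nat_ge (Real.exp u)
    rw [tsum_eq_sum (s := Ioc 0 M)]
    · rw [moebiusLog_exp_eq hM]
      push_cast
      rw [Finset.sum_mul]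
      exact Finset.sum_congr rfl fun d _ => by simp only [f]; ring
    · intro d hd
      rcases eq_or_ne d 0 with rfl | hd0
      · simp [f]
      have hdM : M < d := by
        by_contra h
        exact hd (Finset.mem_Ioc.2 ⟨Nat.pos_of_ne_zero hd0, not_lt.1 h⟩)
      have h1 : u ≤ Real.log d := by
        rw [Real.le_log_iff_exp_le (by exact_mod_cast Nat.pos_of_ne_zero hd0)]
        exact hM.trans (by exact_mod_cast hdM.le)
      simp only [f]
      rw [max_eq_right (by linarith)]; simp
  have hH := hasSum_integral_of_summable_integral_norm hfi hns
  simp_rw [hpt] at hH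
  rw [← hH.tsum_eq]
  have : ∀ d, ∫ u, f d u =
      LSeries.term (fun n => (ArithmeticFunction.moebius n : ℂ)) (1 + s) d * (1 / s ^ 2) := by
    intro d
    rw [← hterm]
    simp only [f]
    rw [integral_const_mul, integral_max_sub_mul_cexp hs]
  simp_rw [this]
  rw [tsum_mul_right]
  have h1 := LSeries_one_mul_Lseries_moebius hs1
  rw [LSeries_one_eq_riemannZeta hs1] at h1
  have hz : riemannZeta (1 + s) ≠ 0 := fun h => by simp [h] at h1
  change LSeries _ _ * _ = _
  have hs0 : s ≠ 0 := fun h => by simp [h] at hs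
  rw [eq_div_iff (by positivity)]
  field_simp
  linear_combination h1

theorem integrable_mul_cexp_of_bounded {f : ℝ → ℝ} {K : ℝ} (hf : Continuous f)
    (hK : ∀ u, |f u| ≤ K) (h0 : ∀ u ≤ 0, f u = 0) {s : ℂ} (hs : 0 < s.re) :
    Integrable fun u : ℝ => (f u : ℂ) * Complex.exp (-(s * u)) := by
  have h1 : Integrable (Set.indicator (Set.Ioi 0) fun u : ℝ => K * Real.exp (-(s.re * u))) := by
    rw [integrable_indicator_iff measurableSet_Ioi]
    apply Integrable.const_mul
    have := exp_neg_integrableOn_Ioi 0 hs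
    show IntegrableOn _ _ _
    simpa [neg_mul] using this
  refine h1.mono' (Continuous.aestronglyMeasurable (by fun_prop)) (Eventually.of_forall fun u => ?_)
  by_cases hu : 0 < u
  · rw [Set.indicator_of_mem (by exact hu), norm_mul, norm_cexp_neg_mul, Complex.norm_real]
    exact mul_le_mul_of_nonneg_right (hK u) (Real.exp_pos _).le
  · rw [h0 u (not_lt.1 hu)]; simp [Set.indicator, hu]

theorem integral_one_sub_exp_mul_cexp {s : ℂ} (hs : 0 < s.re) :
    ∫ u : ℝ, ((1 - Real.exp (-(max u 0)) : ℝ) : ℂ) * Complex.exp (-(s * u)) =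
      1 / s - 1 / (s + 1) := by
  have hs1 : 0 < (s + 1).re := by simp; linarith
  have h1 : ∀ z : ℂ, 0 < z.re →
      IntegrableOn (fun u : ℝ => Complex.exp (-(z * u))) (Set.Ioi 0) ∧
      ∫ u in Set.Ioi (0 : ℝ), Complex.exp (-(z * u)) = 1 / z := by
    intro z hz
    have hz' : (-z).re < 0 := by simpa using hz
    have := integral_exp_mul_complex_Ioi hz' 0
    have h2 := integrableOn_exp_mul_complex_Ioi hz' 0
    simp only [neg_mul] at this h2
    refine ⟨h2, ?_⟩
    rw [this]; simp [neg_div_neg_eq]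
  have h3 : (fun u : ℝ => ((1 - Real.exp (-(max u 0)) : ℝ) : ℂ) * Complex.exp (-(s * u))) =
      (Set.Ioi 0).indicator fun u : ℝ => Complex.exp (-(s * u)) - Complex.exp (-((s + 1) * u)) := by
    ext u
    rcases le_or_gt u 0 with h | h
    · rw [Set.indicator_of_notMem (by simpa using h), max_eq_right h]; simp
    · rw [Set.indicator_of_mem (by exact h), max_eq_left h.le]
      push_cast
      rw [sub_mul, one_mul, ← Complex.exp_add]
      congr 2; ring
  rw [h3, integral_indicator measurableSet_Ioi, integral_sub (h1 s hs).1 (h1 _ hs1).1,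
    (h1 s hs).2, (h1 _ hs1).2]

/-- `s ζ(1 + s)`, extended by `1` at `0`. -/
def shiftedZeta (s : ℂ) : ℂ := DirichletCharacter.LFunctionTrivChar₁ 1 (1 + s)

theorem shiftedZeta_of_ne_zero {s : ℂ} (hs : s ≠ 0) :
    shiftedZeta s = s * riemannZeta (1 + s) := by
  unfold shiftedZeta DirichletCharacter.LFunctionTrivChar₁
  rw [Function.update_of_ne (by simpa using hs)]
  simp [DirichletCharacter.LFunctionTrivChar, DirichletCharacter.LFunction_modOne_eq]

theorem shiftedZeta_zero : shiftedZeta 0 = 1 := by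
  unfold shiftedZeta DirichletCharacter.LFunctionTrivChar₁
  simp

theorem differentiable_shiftedZeta : Differentiable ℂ shiftedZeta := by
  unfold shiftedZeta
  exact (DirichletCharacter.differentiable_LFunctionTrivChar₁ 1).comp
    (differentiable_id.const_add 1)

theorem shiftedZeta_ne_zero {s : ℂ} (hs : 0 ≤ s.re) : shiftedZeta s ≠ 0 := by
  rcases eq_or_ne s 0 with rfl | h
  · simp [shiftedZeta_zero]
  · rw [shiftedZeta_of_ne_zero h]
    exact mul_ne_zero h (riemannZeta_ne_zero_of_one_le_re (by simpa using hs))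

theorem tendsto_moebiusLog_exp : Tendsto (fun u => moebiusLog (Real.exp u)) atTop (nhds 1) := by
  let e : ℝ → ℝ := fun u => 1 - Real.exp (-(max u 0))
  let θ : ℝ → ℝ := fun u => moebiusLog (Real.exp u) - e u
  let clip : ℂ → ℂ := fun s => (max s.re 0 : ℝ) + s.im * Complex.I
  let g : ℂ → ℂ := fun s => (shiftedZeta s)⁻¹
  let G : ℂ → ℂ := fun s => dslope g 0 (clip s) + 1 / (clip s + 1)
  have hFlip : ∀ u v, |moebiusLog (Real.exp u) - moebiusLog (Real.exp v)| ≤ |u - v| := by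
    intro u v
    rcases le_total u v with h | h
    · rw [abs_sub_comm u v, abs_of_nonneg (sub_nonneg.2 h), abs_sub_comm]
      exact abs_moebiusLog_exp_sub_le h
    · rw [abs_of_nonneg (sub_nonneg.2 h)]
      exact abs_moebiusLog_exp_sub_le h
  have hF0 : ∀ u ≤ (0 : ℝ), moebiusLog (Real.exp u) = 0 := by
    intro u hu
    rcases hu.lt_or_eq with h | rfl
    · exact moebiusLog_of_lt_one (Real.exp_lt_one_iff.2 h)
    · simp [moebiusLog]
  have he0 : ∀ u ≤ (0 : ℝ), e u = 0 := by
    intro u hu; simp only [e]; rw [max_eq_right hu]; simp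
  have he1 : ∀ u, |e u| ≤ 1 := by
    intro u
    have h1 := Real.exp_pos (-(max u 0))
    have h2 : Real.exp (-(max u 0)) ≤ 1 := by
      rw [Real.exp_le_one_iff]; linarith [le_max_right u 0]
    rw [abs_le]; constructor <;> simp only [e] <;> linarith
  have helip' : ∀ u v : ℝ, u ≤ v → |e u - e v| ≤ v - u := by
    intro u v huv
    have hm : max u 0 ≤ max v 0 := max_le_max_right 0 huv
    have hm2 : max v 0 - max u 0 ≤ v - u := by
      rcases le_total v 0 with h | h
      · rw [max_eq_right h, max_eq_right (huv.trans h)]; linarith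
      · rw [max_eq_left h]; linarith [le_max_left u 0]
    have h1 : Real.exp (-(max v 0)) ≤ Real.exp (-(max u 0)) := Real.exp_le_exp.2 (by linarith)
    have h2 : Real.exp (-(max u 0)) * (1 - (max v 0 - max u 0)) ≤ Real.exp (-(max v 0)) := by
      have : -(max v 0) = -(max u 0) + (-(max v 0 - max u 0)) := by ring
      rw [this, Real.exp_add]
      apply mul_le_mul_of_nonneg_left _ (Real.exp_pos _).le
      linarith [Real.add_one_le_exp (-(max v 0 - max u 0))]
    have h3 : Real.exp (-(max u 0)) ≤ 1 := by
      rw [Real.exp_le_one_iff]; linarith [le_max_right u 0]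
    have h4 := Real.exp_pos (-(max u 0))
    rw [abs_le]; constructor <;> simp only [e] <;> nlinarith
  have helip : ∀ u v : ℝ, |e u - e v| ≤ |u - v| := by
    intro u v
    rcases le_total u v with h | h
    · rw [abs_sub_comm u v, abs_of_nonneg (sub_nonneg.2 h)]; exact helip' u v h
    · rw [abs_of_nonneg (sub_nonneg.2 h), abs_sub_comm]; exact helip' v u h
  have hcl : ∀ f : ℝ → ℝ, (∀ u v, |f u - f v| ≤ |u - v|) → Continuous f := by
    intro f hf
    have : LipschitzWith 1 f := LipschitzWith.of_dist_le_mul fun u v => by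
      simpa [Real.dist_eq] using hf u v
    exact this.continuous
  have hclip : Continuous clip := by simp only [clip]; fun_prop
  have hclip0 : ∀ s, 0 ≤ (clip s).re := fun s => by simp [clip]
  have hgd : ∀ s, shiftedZeta s ≠ 0 → DifferentiableAt ℂ g s := fun s hs =>
    (differentiable_shiftedZeta s).inv hs
  have hGc : Continuous G := by
    have hopen : IsOpen {s | shiftedZeta s ≠ 0} :=
      isOpen_ne_fun differentiable_shiftedZeta.continuous continuous_const
    have h0mem : (0 : ℂ) ∈ {s | shiftedZeta s ≠ 0} := by simp [shiftedZeta_zero]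
    have hds : ContinuousOn (dslope g 0) {s | shiftedZeta s ≠ 0} :=
      (continuousOn_dslope (hopen.mem_nhds h0mem)).2
        ⟨fun s hs => (hgd s hs).continuousAt.continuousWithinAt, hgd 0 h0mem⟩
    refine Continuous.add ?_ ?_
    · exact hds.comp_continuous hclip fun s => shiftedZeta_ne_zero (hclip0 s)
    · refine continuous_const.div (by fun_prop) fun s h => ?_
      have := congrArg Complex.re h
      simp only [Complex.add_re, Complex.one_re, Complex.zero_re] at this
      linarith [hclip0 s]
  have hθ : Tendsto θ atTop (nhds 0) := by
    refine tendsto_zero_of_laplace_continuous (K := 5) (G := G) ?_ ?_ ?_ hGc ?_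
    · intro u v
      have h1 := hFlip u v
      have h2 := helip u v
      simp only [θ]
      rw [abs_le] at *
      constructor <;> linarith [h1.1, h1.2, h2.1, h2.2]
    · intro u
      have h1 := abs_moebiusLog_le (Real.exp u)
      have h2 := he1 u
      simp only [θ]
      rw [abs_le] at *
      constructor <;> linarith [h1.1, h1.2, h2.1, h2.2]
    · intro u hu; simp only [θ]; rw [hF0 u hu, he0 u hu, sub_zero]
    · intro s hs
      have hs0 : s ≠ 0 := fun h => by simp [h] at hs
      have hclips : clip s = s := by
        simp only [clip]; rw [max_eq_left hs.le, Complex.re_add_im]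
      have i1 := integrable_mul_cexp_of_bounded (hcl _ hFlip) (fun u => abs_moebiusLog_le _) hF0 hs
      have i2 := integrable_mul_cexp_of_bounded (hcl _ helip) he1 he0 hs
      have : ∀ u : ℝ, (θ u : ℂ) * Complex.exp (-(s * u)) =
          (moebiusLog (Real.exp u) : ℂ) * Complex.exp (-(s * u)) -
          (e u : ℂ) * Complex.exp (-(s * u)) := by
        intro u; simp only [θ]; push_cast; ring
      simp_rw [this]
      rw [integral_sub i1 i2, integral_moebiusLog_exp_mul_cexp hs, integral_one_sub_exp_mul_cexp hs]
      simp only [G, hclips]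
      rw [dslope_of_ne _ hs0, slope_def_field]
      simp only [g, shiftedZeta_zero, inv_one, sub_zero]
      rw [shiftedZeta_of_ne_zero hs0]
      have hz := riemannZeta_ne_zero_of_one_le_re (s := 1 + s) (by simpa using hs.le)
      field_simp
      ring
  have he : Tendsto e atTop (nhds 1) := by
    have h := (Real.tendsto_exp_neg_atTop_nhds_zero).const_sub 1
    rw [sub_zero] at h
    refine h.congr' ?_
    filter_upwards [eventually_ge_atTop 0] with u hu
    simp only [e]; rw [max_eq_left hu]
  have := hθ.add he
  rw [zero_add] at this
  refine this.congr fun u => ?_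
  simp only [θ]; ring

end Laplace

theorem exists_abs_moebiusLog_le {ε : ℝ} (hε : 0 < ε) :
    ∃ K : ℝ, 0 ≤ K ∧ ∀ x : ℝ, 0 < x → |moebiusLog x| ≤ 1 + ε + K * x ^ (-(1 / 2 : ℝ)) := by
  have h := tendsto_moebiusLog_exp.eventually (Metric.ball_mem_nhds 1 hε)
  obtain ⟨U, hU⟩ := eventually_atTop.1 h
  refine ⟨4 * Real.exp (U / 2), by positivity, fun x hx => ?_⟩
  have hx0 : 0 ≤ x ^ (-(1 / 2 : ℝ)) := by positivity
  rcases le_or_gt U (Real.log x) with h1 | h1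
  · have h2 := hU _ h1
    rw [Real.exp_log hx, Real.dist_eq, abs_lt] at h2
    have : 0 ≤ 4 * Real.exp (U / 2) * x ^ (-(1 / 2 : ℝ)) := by positivity
    rw [abs_le]; constructor <;> linarith [h2.1, h2.2]
  · have h2 : 1 ≤ Real.exp (U / 2) * x ^ (-(1 / 2 : ℝ)) := by
      rw [Real.rpow_def_of_pos hx, ← Real.exp_add, Real.one_le_exp_iff]
      linarith
    have := abs_moebiusLog_le x
    linarith

/-- `∑ (-1)^|s| / ∏ s * log⁺ (x / ∏ s)`, the sum being over the subsets `s` of `P`. -/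
def sieveLog (P : Finset ℕ) (x : ℝ) : ℝ :=
  ∑ s ∈ P.powerset, (-1) ^ #s / ((∏ p ∈ s, p : ℕ) : ℝ) * Real.posLog (x / ((∏ p ∈ s, p : ℕ) : ℝ))

theorem sieveLog_insert {P : Finset ℕ} {p : ℕ} (hp : p ∉ P) (x : ℝ) :
    sieveLog (insert p P) x = sieveLog P x - (1 / p) * sieveLog P (x / p) := by
  unfold sieveLog
  rw [Finset.sum_powerset_insert hp, sub_eq_add_neg, Finset.mul_sum, ← Finset.sum_neg_distrib]
  congr 1
  refine Finset.sum_congr rfl fun s hs => ?_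
  have hps : p ∉ s := fun h => hp (Finset.mem_powerset.1 hs h)
  rw [Finset.prod_insert hps, Finset.card_insert_of_notMem hps]
  push_cast
  rw [div_div]
  ring

theorem one_le_prod_of_prime {s : Finset ℕ} (hs : ∀ p ∈ s, p.Prime) : 1 ≤ ∏ p ∈ s, p :=
  Nat.one_le_iff_ne_zero.2 (Finset.prod_ne_zero_iff.2 fun p hp => (hs p hp).ne_zero)

theorem posLog_div_eq_zero {x : ℝ} {n : ℕ} (hx : 0 ≤ x) (hn : 1 ≤ n) (h : x ≤ n) :
    Real.posLog (x / n) = 0 := by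
  have hn' : (1 : ℝ) ≤ n := by exact_mod_cast hn
  rw [Real.posLog_eq_zero_iff, abs_of_nonneg (by positivity)]
  exact div_le_one_of_le₀ h (by positivity)

theorem sieveLog_of_le_one {P : Finset ℕ} (hP : ∀ p ∈ P, p.Prime) {x : ℝ} (hx0 : 0 ≤ x)
    (hx : x ≤ 1) : sieveLog P x = 0 := by
  refine Finset.sum_eq_zero fun s hs => ?_
  have h1 := one_le_prod_of_prime fun p hp => hP p (Finset.mem_powerset.1 hs hp)
  have h2 : (1 : ℝ) ≤ (∏ p ∈ s, p : ℕ) := by exact_mod_cast h1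
  rw [posLog_div_eq_zero hx0 h1 (hx.trans h2), mul_zero]

theorem prod_injOn_primes {P : Finset ℕ} (hP : ∀ p ∈ P, p.Prime) :
    Set.InjOn (fun s : Finset ℕ => ∏ p ∈ s, p) (P.powerset : Set (Finset ℕ)) := by
  intro s hs t ht h
  rw [Finset.mem_coe, Finset.mem_powerset] at hs ht
  rw [← Nat.primeFactors_prod fun p hp => hP p (hs hp),
    ← Nat.primeFactors_prod fun p hp => hP p (ht hp)]
  exact congrArg Nat.primeFactors h

theorem squarefree_prod_of_prime {s : Finset ℕ} (hs : ∀ p ∈ s, p.Prime) :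
    Squarefree (∏ p ∈ s, p) := by
  refine Finset.squarefree_prod_of_pairwise_isCoprime ?_ fun p hp => (hs p hp).squarefree
  intro p hp q hq hpq
  exact Nat.coprime_iff_isRelPrime.1 ((Nat.coprime_primes (hs p hp) (hs q hq)).2 hpq)

theorem moebius_prod_of_prime {s : Finset ℕ} (hs : ∀ p ∈ s, p.Prime) :
    ArithmeticFunction.moebius (∏ p ∈ s, p) = (-1) ^ #s := by
  have h := squarefree_prod_of_prime hs
  rw [ArithmeticFunction.moebius_apply_of_squarefree h,
    ← ArithmeticFunction.cardDistinctFactors_eq_cardFactors_iff_squarefree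
      (Nat.one_le_iff_ne_zero.1 (one_le_prod_of_prime hs)) |>.2 h,
    ArithmeticFunction.cardDistinctFactors_apply, ← List.card_toFinset]
  change (-1) ^ #(Nat.primeFactors _) = _
  rw [Nat.primeFactors_prod hs]

/-- A sum of `μ(d) g(d)` over a set of integers containing all squarefree `d` composed of the
primes in `P` for which `g d ≠ 0`, written as a sum over subsets of `P`. -/
theorem sum_moebius_mul_eq_sum_powerset {P D : Finset ℕ} (hP : ∀ p ∈ P, p.Prime) (g : ℕ → ℝ)
    (h1 : ∀ s ⊆ P, g (∏ p ∈ s, p) ≠ 0 → ∏ p ∈ s, p ∈ D)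
    (h2 : ∀ d ∈ D, g d ≠ 0 → d ≠ 0 ∧ d.primeFactors ⊆ P) :
    ∑ d ∈ D, (ArithmeticFunction.moebius d : ℝ) * g d =
      ∑ s ∈ P.powerset, (-1) ^ #s * g (∏ p ∈ s, p) := by
  symm
  refine Finset.sum_bij_ne_zero (fun s _ _ => ∏ p ∈ s, p) ?_ ?_ ?_ ?_
  · intro s hs hne
    exact h1 s (Finset.mem_powerset.1 hs) (right_ne_zero_of_mul hne)
  · intro s hs _ t ht _ h
    exact prod_injOn_primes hP hs ht h
  · intro d hd hne
    obtain ⟨hd0, hdP⟩ := h2 d hd (right_ne_zero_of_mul hne)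
    have hsq : Squarefree d := by
      have := left_ne_zero_of_mul hne
      rw [← ArithmeticFunction.moebius_ne_zero_iff_squarefree]
      exact_mod_cast this
    have hprod := Nat.prod_primeFactors_of_squarefree hsq
    refine ⟨d.primeFactors, Finset.mem_powerset.2 hdP, ?_, hprod⟩
    have := moebius_prod_of_prime fun p (hp : p ∈ d.primeFactors) =>
      Nat.prime_of_mem_primeFactors hp
    rw [hprod] at this ⊢
    rw [this] at hne
    exact_mod_cast hne
  · intro s hs _
    rw [moebius_prod_of_prime fun p hp => hP p (Finset.mem_powerset.1 hs hp)]
    push_cast; ring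

/-- The primes up to `n`. -/
def primesUpTo (n : ℕ) : Finset ℕ := (range (n + 1)).filter Nat.Prime

theorem mem_primesUpTo {n p : ℕ} : p ∈ primesUpTo n ↔ p ≤ n ∧ p.Prime := by
  simp [primesUpTo]

theorem sieveLog_primesUpTo {n : ℕ} {x : ℝ} (hx0 : 0 ≤ x) (hx : x ≤ n) :
    sieveLog (primesUpTo n) x = moebiusLog x := by
  have h := sum_moebius_mul_eq_sum_powerset (P := primesUpTo n) (D := Ioc 0 ⌊x⌋₊)
    (fun p hp => (mem_primesUpTo.1 hp).2) (fun d => 1 / (d : ℝ) * Real.posLog (x / d)) ?_ ?_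
  · unfold sieveLog moebiusLog
    calc _ = _ := Finset.sum_congr rfl fun s _ => by ring
      _ = _ := h.symm
      _ = _ := Finset.sum_congr rfl fun d hd => ?_
    have hd1 : (1 : ℝ) ≤ d := by exact_mod_cast (Finset.mem_Ioc.1 hd).1
    have hdx : (d : ℝ) ≤ x := (Nat.le_floor_iff hx0).1 (Finset.mem_Ioc.1 hd).2
    rw [Real.posLog_eq_log]
    · ring
    · rw [abs_of_nonneg (by positivity), one_le_div (by linarith)]; exact hdx
  · intro s hs hne
    have h1 := one_le_prod_of_prime fun p hp => (mem_primesUpTo.1 (hs hp)).2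
    rw [Finset.mem_Ioc]
    refine ⟨h1, Nat.le_floor ?_⟩
    by_contra hlt
    exact right_ne_zero_of_mul hne (posLog_div_eq_zero hx0 h1 (not_le.1 hlt).le)
  · intro d hd _
    have hd' := Finset.mem_Ioc.1 hd
    refine ⟨hd'.1.ne', fun p hp => mem_primesUpTo.2 ⟨?_, Nat.prime_of_mem_primeFactors hp⟩⟩
    have h3 := Nat.le_of_dvd hd'.1 (Nat.dvd_of_mem_primeFactors hp)
    exact h3.trans (hd'.2.trans (Nat.floor_le_of_le hx))

theorem abs_sieveLog_le_of_insert {P : Finset ℕ} {p : ℕ} (hP : ∀ q ∈ P, q.Prime) (hp : p.Prime)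
    (hpP : p ∉ P) {A C R : ℝ} (hA : 0 ≤ A) (hC : 0 ≤ C)
    (h : ∀ x, 0 < x → x ≤ R → |sieveLog (insert p P) x| ≤ A + C * x ^ (-(1 / 2 : ℝ)))
    {x : ℝ} (hx0 : 0 < x) (hxR : x ≤ R) :
    |sieveLog P x| ≤ A * (1 - (p : ℝ)⁻¹)⁻¹ +
      C * (1 - (p : ℝ) ^ (-(1 / 2 : ℝ)))⁻¹ * x ^ (-(1 / 2 : ℝ)) := by
  have hp2 : (2 : ℝ) ≤ p := by exact_mod_cast hp.two_le
  have hp0 : (0 : ℝ) < p := by linarith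
  set q := (p : ℝ) ^ (-(1 / 2 : ℝ)) with hq
  have hq1 : q < 1 := Real.rpow_lt_one_of_one_lt_of_neg (by linarith) (by norm_num)
  have hq0 : 0 < q := by positivity
  have hqq : q * q = (p : ℝ)⁻¹ := by
    rw [hq, ← Real.rpow_add hp0]; norm_num [Real.rpow_neg_one]
  have hr1 : (p : ℝ)⁻¹ < 1 := inv_lt_one_of_one_lt₀ (by linarith)
  have h1r : 0 < 1 - (p : ℝ)⁻¹ := by linarith
  have h1q : 0 < 1 - q := by linarith
  obtain ⟨k, hk⟩ := pow_unbounded_of_one_lt x (show (1 : ℝ) < p by linarith)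
  replace hk := hk.le
  induction k generalizing x with
  | zero =>
    rw [pow_zero] at hk
    rw [sieveLog_of_le_one hP hx0.le hk, abs_zero]
    positivity
  | succ k ih =>
    have e := sieveLog_insert hpP x
    have hxp : x / p ≤ x := div_le_self hx0.le (by linarith)
    have h2 := ih (x := x / p) (by positivity) (hxp.trans hxR)
      (by rw [div_le_iff₀ hp0, ← pow_succ]; exact hk)
    have h3 := h x hx0 hxR
    have h4 : (x / p) ^ (-(1 / 2 : ℝ)) = x ^ (-(1 / 2 : ℝ)) * q⁻¹ := by
      rw [Real.div_rpow hx0.le hp0.le, div_eq_mul_inv]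
    rw [h4] at h2
    set y := x ^ (-(1 / 2 : ℝ)) with hy
    have h5 : sieveLog P x = sieveLog (insert p P) x + (p : ℝ)⁻¹ * sieveLog P (x / p) := by
      rw [e]; ring
    have h6 : |sieveLog P x| ≤ (A + C * y) + (p : ℝ)⁻¹ *
        (A * (1 - (p : ℝ)⁻¹)⁻¹ + C * (1 - q)⁻¹ * (y * q⁻¹)) := by
      rw [h5]
      refine (abs_add_le _ _).trans (add_le_add h3 ?_)
      rw [abs_mul, abs_of_nonneg (by positivity : (0 : ℝ) ≤ (p : ℝ)⁻¹)]
      exact mul_le_mul_of_nonneg_left h2 (by positivity)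
    refine h6.trans (le_of_eq ?_)
    have e1 : A + (p : ℝ)⁻¹ * (A * (1 - (p : ℝ)⁻¹)⁻¹) = A * (1 - (p : ℝ)⁻¹)⁻¹ := by
      have := mul_inv_cancel₀ h1r.ne'
      linear_combination -A * this
    have e2 : C * y + (p : ℝ)⁻¹ * (C * (1 - q)⁻¹ * (y * q⁻¹)) = C * (1 - q)⁻¹ * y := by
      rw [← hqq]
      field_simp
      ring
    linear_combination e1 + e2

theorem abs_sieveLog_le_of_union {P A : Finset ℕ} (hP : ∀ q ∈ P, q.Prime) (hA : ∀ q ∈ A, q.Prime)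
    (hPA : Disjoint P A) {a C R : ℝ} (ha : 0 ≤ a) (hC : 0 ≤ C)
    (h : ∀ x, 0 < x → x ≤ R → |sieveLog (P ∪ A) x| ≤ a + C * x ^ (-(1 / 2 : ℝ)))
    {x : ℝ} (hx0 : 0 < x) (hxR : x ≤ R) :
    |sieveLog P x| ≤ a * ∏ p ∈ A, (1 - (p : ℝ)⁻¹)⁻¹ +
      C * (∏ p ∈ A, (1 - (p : ℝ) ^ (-(1 / 2 : ℝ)))⁻¹) * x ^ (-(1 / 2 : ℝ)) := by
  induction A using Finset.induction_on generalizing a C x with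
  | empty => simpa using h x hx0 hxR
  | insert p A hpA ih =>
    have hpP : p ∉ P := fun hp => Finset.disjoint_left.1 hPA hp (Finset.mem_insert_self _ _)
    have hpp := hA p (Finset.mem_insert_self _ _)
    have hA' : ∀ q ∈ A, q.Prime := fun q hq => hA q (Finset.mem_insert_of_mem hq)
    have hp2 : (2 : ℝ) ≤ p := by exact_mod_cast hpp.two_le
    have h1 : (0 : ℝ) ≤ (1 - (p : ℝ)⁻¹)⁻¹ := by
      have : (p : ℝ)⁻¹ ≤ 1 := inv_le_one_of_one_le₀ (by linarith)
      exact inv_nonneg.2 (by linarith)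
    have h2 : (0 : ℝ) ≤ (1 - (p : ℝ) ^ (-(1 / 2 : ℝ)))⁻¹ := by
      have : (p : ℝ) ^ (-(1 / 2 : ℝ)) ≤ 1 :=
        Real.rpow_le_one_of_one_le_of_nonpos (by linarith) (by norm_num)
      exact inv_nonneg.2 (by linarith)
    rw [Finset.prod_insert hpA, Finset.prod_insert hpA, ← mul_assoc, ← mul_assoc]
    refine ih hA' (hPA.mono_right (Finset.subset_insert _ _)) (mul_nonneg ha h1)
      (mul_nonneg hC h2) ?_ hx0 hxR
    intro y hy0 hyR
    refine abs_sieveLog_le_of_insert ?_ hpp ?_ ha hC ?_ hy0 hyR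
    · intro q hq
      rcases Finset.mem_union.1 hq with h | h
      exacts [hP q h, hA' q h]
    · simp [hpP, hpA]
    · intro z hz0 hzR
      rw [← Finset.union_insert]
      exact h z hz0 hzR

/-- The sum of `1 / n` over the positive integers `n ≤ x` without prime factor in `P`. -/
def siftedHarmonic (P : Finset ℕ) (x : ℝ) : ℝ :=
  ∑ n ∈ (Ioc 0 ⌊x⌋₊).filter (fun n => ∀ p ∈ P, ¬ p ∣ n), 1 / (n : ℝ)

theorem siftedHarmonic_insert {P : Finset ℕ} {p : ℕ} (hP : ∀ q ∈ P, q.Prime) (hp : p.Prime)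
    (hpP : p ∉ P) {x : ℝ} (hx : 0 ≤ x) :
    siftedHarmonic (insert p P) x = siftedHarmonic P x - (1 / p) * siftedHarmonic P (x / p) := by
  have hp0 : (0 : ℝ) < p := by exact_mod_cast hp.pos
  have h1 := Finset.sum_filter_add_sum_filter_not
    ((Ioc 0 ⌊x⌋₊).filter (fun n => ∀ p ∈ P, ¬ p ∣ n)) (fun n => ¬ p ∣ n) (fun n => 1 / (n : ℝ))
  have h2 : ((Ioc 0 ⌊x⌋₊).filter (fun n => ∀ p ∈ P, ¬ p ∣ n)).filter (fun n => ¬ p ∣ n) =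
      (Ioc 0 ⌊x⌋₊).filter (fun n => ∀ q ∈ insert p P, ¬ q ∣ n) := by
    ext n; simp [and_assoc, and_comm, and_left_comm]
  have h3 : ∑ n ∈ ((Ioc 0 ⌊x⌋₊).filter (fun n => ∀ p ∈ P, ¬ p ∣ n)).filter (fun n => ¬ ¬ p ∣ n),
      1 / (n : ℝ) = (1 / p) * siftedHarmonic P (x / p) := by
    unfold siftedHarmonic
    rw [Finset.mul_sum]
    symm
    refine Finset.sum_bij (fun k _ => p * k) ?_ ?_ ?_ ?_
    · intro k hk
      simp only [Finset.mem_filter, Finset.mem_Ioc, not_not] at hk ⊢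
      refine ⟨⟨⟨Nat.mul_pos hp.pos hk.1.1, ?_⟩, ?_⟩, dvd_mul_right _ _⟩
      · have := (Nat.le_floor_iff (by positivity)).1 hk.1.2
        apply Nat.le_floor
        rw [le_div_iff₀ hp0] at this
        push_cast; linarith
      · intro q hq hqd
        rcases (hP q hq).dvd_mul.1 hqd with h | h
        · rw [(Nat.prime_dvd_prime_iff_eq (hP q hq) hp).1 h] at hq; exact hpP hq
        · exact hk.2 q hq h
    · intro a _ b _ hab; exact Nat.eq_of_mul_eq_mul_left hp.pos hab
    · intro n hn
      simp only [Finset.mem_filter, Finset.mem_Ioc, not_not] at hn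
      obtain ⟨k, rfl⟩ := hn.2
      refine ⟨k, ?_, rfl⟩
      simp only [Finset.mem_filter, Finset.mem_Ioc]
      refine ⟨⟨Nat.pos_of_mul_pos_left hn.1.1.1, ?_⟩,
        fun q hq hqk => hn.1.2 q hq (hqk.mul_left _)⟩
      have := (Nat.le_floor_iff hx).1 hn.1.1.2
      apply Nat.le_floor
      rw [le_div_iff₀ hp0]
      push_cast at this; linarith
    · intro k _; push_cast; rw [one_div_mul_one_div]
  rw [h2, h3] at h1
  unfold siftedHarmonic at h1 ⊢
  linarith

theorem posLog_sub_posLog_div_le {p : ℕ} (hp : 1 ≤ p) {x : ℝ} (hx : 0 < x) :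
    0 ≤ Real.posLog x - Real.posLog (x / p) ∧ Real.posLog x - Real.posLog (x / p) ≤ Real.log p := by
  have hp1 : (1 : ℝ) ≤ p := by exact_mod_cast hp
  have hl := Real.log_nonneg hp1
  have hdef : ∀ z, Real.posLog z = max 0 (Real.log z) := fun _ => rfl
  rw [hdef, hdef]
  rw [Real.log_div hx.ne' (by linarith)]
  constructor
  · have : max 0 (Real.log x - Real.log p) ≤ max 0 (Real.log x) := max_le_max_left 0 (by linarith)
    linarith
  · have : max 0 (Real.log x) ≤ max 0 (Real.log x - Real.log p) + Real.log p := by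
      apply max_le
      · linarith [le_max_left 0 (Real.log x - Real.log p)]
      · linarith [le_max_right 0 (Real.log x - Real.log p)]
    linarith

theorem abs_siftedHarmonic_sub_le {P : Finset ℕ} (hP : ∀ q ∈ P, q.Prime) {x : ℝ} (hx : 0 < x) :
    |siftedHarmonic P x - (∏ p ∈ P, (1 - (p : ℝ)⁻¹)) * Real.posLog x| ≤ 2 ^ #P := by
  induction P using Finset.induction_on generalizing x with
  | empty =>
    have h0 : siftedHarmonic ∅ x = (harmonic ⌊x⌋₊ : ℝ) := by
      unfold siftedHarmonic
      rw [harmonic_eq_sum_Icc]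
      push_cast
      simp only [Finset.notMem_empty, false_imp_iff, implies_true, Finset.filter_true, one_div]
      rfl
    rw [h0, Finset.prod_empty, one_mul, Finset.card_empty, pow_zero]
    rcases le_or_gt 1 x with h | h
    · rw [Real.posLog_eq_log (by rwa [abs_of_pos hx])]
      have h1 := log_le_harmonic_floor x hx.le
      have h2 := harmonic_floor_le_one_add_log x h
      rw [abs_le]; constructor <;> linarith
    · rw [Nat.floor_eq_zero.2 h, (Real.posLog_eq_zero_iff x).2 (by rw [abs_of_pos hx]; exact h.le)]
      simp
  | insert p P hpP ih =>
    have hpp := hP p (Finset.mem_insert_self _ _)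
    have hP' : ∀ q ∈ P, q.Prime := fun q hq => hP q (Finset.mem_insert_of_mem hq)
    have hp0 : (0 : ℝ) < p := by exact_mod_cast hpp.pos
    rw [siftedHarmonic_insert hP' hpp hpP hx.le, Finset.prod_insert hpP,
      Finset.card_insert_of_notMem hpP]
    have i1 := ih hP' hx
    have i2 := ih hP' (x := x / p) (by positivity)
    obtain ⟨j0, j1⟩ := posLog_sub_posLog_div_le hpp.one_le hx
    have j2 : Real.log p ≤ p - 1 := by
      have := Real.log_le_sub_one_of_pos hp0; linarith
    set v := ∏ p ∈ P, (1 - (p : ℝ)⁻¹) with hv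
    have hv0 : 0 ≤ v := Finset.prod_nonneg fun q hq => by
      have : (q : ℝ)⁻¹ ≤ 1 := inv_le_one_of_one_le₀ (by exact_mod_cast (hP' q hq).one_le)
      linarith
    have hv1 : v ≤ 1 := Finset.prod_le_one (fun q hq => by
      have : (q : ℝ)⁻¹ ≤ 1 := inv_le_one_of_one_le₀ (by exact_mod_cast (hP' q hq).one_le)
      linarith) (fun q hq => by
      have : (0 : ℝ) ≤ (q : ℝ)⁻¹ := by positivity
      linarith)
    set E : ℝ := 2 ^ #P with hE
    have hE1 : 1 ≤ E := one_le_pow₀ (by norm_num)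
    have hr1 : (p : ℝ)⁻¹ ≤ 1 := inv_le_one_of_one_le₀ (by exact_mod_cast hpp.one_le)
    have hr0 : 0 ≤ (p : ℝ)⁻¹ := by positivity
    have hd : (p : ℝ)⁻¹ * (Real.posLog x - Real.posLog (x / p)) ≤ 1 - (p : ℝ)⁻¹ := by
      have := mul_le_mul_of_nonneg_left (j1.trans j2) hr0
      rwa [mul_sub (p : ℝ)⁻¹ (p : ℝ), mul_one, inv_mul_cancel₀ hp0.ne'] at this
    have hd0 : 0 ≤ (p : ℝ)⁻¹ * (Real.posLog x - Real.posLog (x / p)) := mul_nonneg hr0 j0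
    have hvd : v * ((p : ℝ)⁻¹ * (Real.posLog x - Real.posLog (x / p))) ≤ 1 - (p : ℝ)⁻¹ :=
      (mul_le_of_le_one_left hd0 hv1).trans hd
    have hvd0 := mul_nonneg hv0 hd0
    have e : siftedHarmonic P x - 1 / p * siftedHarmonic P (x / p) -
        (1 - (p : ℝ)⁻¹) * v * Real.posLog x =
        (siftedHarmonic P x - v * Real.posLog x) -
        (p : ℝ)⁻¹ * (siftedHarmonic P (x / p) - v * Real.posLog (x / p)) +
        v * ((p : ℝ)⁻¹ * (Real.posLog x - Real.posLog (x / p))) := by ring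
    rw [e, pow_succ, ← hE]
    have k1 := mul_le_mul_of_nonneg_left (abs_le.1 i2).2 hr0
    have k2 := mul_le_mul_of_nonneg_left (abs_le.1 i2).1 hr0
    have k3 : (1 - (p : ℝ)⁻¹) * 1 ≤ (1 - (p : ℝ)⁻¹) * E :=
      mul_le_mul_of_nonneg_left hE1 (by linarith)
    rw [abs_le] at i1 ⊢
    constructor <;> nlinarith [i1.1, i1.2]

theorem sum_filter_powerset_prod_le {P Q : Finset ℕ} (hP : ∀ p ∈ P, p.Prime)
    (hQ : ∀ p ∈ Q, p.Prime) (hPQ : Disjoint P Q) {g : ℕ → ℝ} (hg : ∀ n, 0 ≤ g n) (x : ℝ) :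
    ∑ s ∈ Q.powerset.filter (fun s => ((∏ p ∈ s, p : ℕ) : ℝ) ≤ x), g (∏ p ∈ s, p) ≤
      ∑ n ∈ (Ioc 0 ⌊x⌋₊).filter (fun n => ∀ p ∈ P, ¬ p ∣ n), g n := by
  rw [← Finset.sum_image (f := g) (g := fun s : Finset ℕ => ∏ p ∈ s, p)]
  · refine Finset.sum_le_sum_of_subset_of_nonneg ?_ fun n _ _ => hg n
    intro n hn
    obtain ⟨s, hs, rfl⟩ := Finset.mem_image.1 hn
    obtain ⟨hs1, hs2⟩ := Finset.mem_filter.1 hs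
    have hsQ := Finset.mem_powerset.1 hs1
    refine Finset.mem_filter.2 ⟨Finset.mem_Ioc.2 ⟨one_le_prod_of_prime fun p hp => hQ p (hsQ hp),
      Nat.le_floor hs2⟩, ?_⟩
    intro p hp hpd
    obtain ⟨q, hq, hpq⟩ := (hP p hp).prime.exists_mem_finset_dvd hpd
    have := (Nat.prime_dvd_prime_iff_eq (hP p hp) (hQ q (hsQ hq))).1 hpq
    subst this
    exact Finset.disjoint_left.1 hPQ hp (hsQ hq)
  · exact (prod_injOn_primes hQ).mono fun s hs => (Finset.mem_filter.1 hs).1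

/-- The diagonal form attached to the sieve weights supported on `P`. -/
def sieveForm (P : Finset ℕ) (x y : ℝ) : ℝ :=
  ∑ s ∈ P.powerset, 1 / ((∏ p ∈ s, p : ℕ) : ℝ) *
    (sieveLog P (x / ((∏ p ∈ s, p : ℕ) : ℝ)) * sieveLog P (y / ((∏ p ∈ s, p : ℕ) : ℝ)))

theorem abs_sieveForm_le {Q : Finset ℕ} (hQ : ∀ p ∈ Q, p.Prime) {R x y : ℝ}
    (hx0 : 0 ≤ x) (hx : x ≤ R) {G : ℕ → ℝ}
    (hG : ∀ s ⊆ Q, ((∏ p ∈ s, p : ℕ) : ℝ) ≤ R →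
      |sieveLog Q (x / ((∏ p ∈ s, p : ℕ) : ℝ))| * |sieveLog Q (y / ((∏ p ∈ s, p : ℕ) : ℝ))| ≤
        G (∏ p ∈ s, p)) :
    |sieveForm Q x y| ≤ ∑ s ∈ Q.powerset.filter (fun s => ((∏ p ∈ s, p : ℕ) : ℝ) ≤ R),
      1 / ((∏ p ∈ s, p : ℕ) : ℝ) * G (∏ p ∈ s, p) := by
  unfold sieveForm
  refine (Finset.abs_sum_le_sum_abs _ _).trans ?_
  rw [Finset.sum_filter]
  refine Finset.sum_le_sum fun s hs => ?_
  have hsQ := Finset.mem_powerset.1 hs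
  have h1 := one_le_prod_of_prime fun p hp => hQ p (hsQ hp)
  have h1' : (1 : ℝ) ≤ (∏ p ∈ s, p : ℕ) := by exact_mod_cast h1
  split_ifs with h
  · rw [abs_mul, abs_mul, abs_of_nonneg (by positivity : (0 : ℝ) ≤ 1 / ((∏ p ∈ s, p : ℕ) : ℝ))]
    exact mul_le_mul_of_nonneg_left (hG s hsQ h) (by positivity)
  · rw [sieveLog_of_le_one hQ (by positivity)]
    · simp
    · exact div_le_one_of_le₀ (by linarith) (by linarith)

theorem sum_inv_prod_le {P Q : Finset ℕ} (hP : ∀ p ∈ P, p.Prime)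
    (hQ : ∀ p ∈ Q, p.Prime) (hPQ : Disjoint P Q) {R : ℝ} (hR : 1 ≤ R) :
    ∑ s ∈ Q.powerset.filter (fun s => ((∏ p ∈ s, p : ℕ) : ℝ) ≤ R),
      1 / ((∏ p ∈ s, p : ℕ) : ℝ) ≤
      (∏ p ∈ P, (1 - (p : ℝ)⁻¹)⁻¹)⁻¹ * Real.log R + 2 ^ #P := by
  have h1 := sum_filter_powerset_prod_le hP hQ hPQ (g := fun n => 1 / (n : ℝ))
    (fun n => by positivity) R
  have h2 := (abs_le.1 (abs_siftedHarmonic_sub_le hP (x := R) (by linarith))).2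
  rw [Real.posLog_eq_log (by rwa [abs_of_nonneg (by linarith)])] at h2
  rw [← Finset.prod_inv_distrib]
  simp only [inv_inv]
  unfold siftedHarmonic at h2
  linarith

theorem card_filter_prod_le {Q : Finset ℕ} (hQ : ∀ p ∈ Q, p.Prime) {R : ℝ} (hR : 0 ≤ R) :
    (#(Q.powerset.filter (fun s => ((∏ p ∈ s, p : ℕ) : ℝ) ≤ R)) : ℝ) ≤ R := by
  have h1 := sum_filter_powerset_prod_le (P := ∅) (by simp) hQ (by simp) (g := fun n => 1)
    (fun n => by positivity) R
  simp only [Finset.notMem_empty, false_imp_iff, implies_true, Finset.filter_true,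
    Finset.sum_const, nsmul_eq_mul, mul_one, Nat.card_Ioc, tsub_zero] at h1
  exact h1.trans (Nat.floor_le hR)

/-- The Euler product `∏_{p ≤ w} (1 - 1/p)⁻¹`. -/
def mertensProd (w : ℕ) : ℝ := ∏ p ∈ primesUpTo w, (1 - (p : ℝ)⁻¹)⁻¹

theorem one_le_inv_one_sub_inv {p : ℕ} (hp : p.Prime) :
    (1 : ℝ) ≤ (1 - (p : ℝ)⁻¹)⁻¹ ∧ (1 - (p : ℝ)⁻¹)⁻¹ ≤ 2 := by
  have hp2 : (2 : ℝ) ≤ p := by exact_mod_cast hp.two_le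
  have h1 : (p : ℝ)⁻¹ ≤ 2⁻¹ := inv_anti₀ (by norm_num) hp2
  have h0 : (0 : ℝ) < (p : ℝ)⁻¹ := by positivity
  constructor
  · exact (one_le_inv₀ (by linarith)).2 (by linarith)
  · rw [inv_le_comm₀ (by linarith) (by norm_num)]; linarith

theorem one_le_mertensProd (w : ℕ) : 1 ≤ mertensProd w :=
  Finset.one_le_prod fun _ hp => (one_le_inv_one_sub_inv (mem_primesUpTo.1 hp).2).1

theorem card_primesUpTo_le (w : ℕ) : #(primesUpTo w) ≤ w := by
  have : primesUpTo w ⊆ Ioc 0 w := fun p hp => by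
    have := mem_primesUpTo.1 hp
    exact Finset.mem_Ioc.2 ⟨this.2.pos, this.1⟩
  simpa using Finset.card_le_card this

theorem prod_inv_one_sub_inv_le {A : Finset ℕ} (hA : ∀ p ∈ A, p.Prime) :
    ∏ p ∈ A, (1 - (p : ℝ)⁻¹)⁻¹ ≤ 2 ^ #A := by
  rw [← Finset.prod_const]
  exact Finset.prod_le_prod (fun p hp => by linarith [(one_le_inv_one_sub_inv (hA p hp)).1])
    fun p hp => (one_le_inv_one_sub_inv (hA p hp)).2

theorem mertensProd_le (w : ℕ) : mertensProd w ≤ 2 ^ w :=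
  (prod_inv_one_sub_inv_le fun _ hp => (mem_primesUpTo.1 hp).2).trans
    (pow_le_pow_right₀ (by norm_num) (card_primesUpTo_le w))

/-- The primes in `(w, n]`. -/
def primesBetween (w n : ℕ) : Finset ℕ := primesUpTo n \ primesUpTo w

theorem mem_primesBetween {w n p : ℕ} : p ∈ primesBetween w n ↔ w < p ∧ p ≤ n ∧ p.Prime := by
  simp only [primesBetween, Finset.mem_sdiff, mem_primesUpTo]
  constructor
  · rintro ⟨⟨h1, h2⟩, h3⟩
    exact ⟨not_le.1 fun h => h3 ⟨h, h2⟩, h1, h2⟩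
  · rintro ⟨h1, h2, h3⟩
    exact ⟨⟨h2, h3⟩, fun h => absurd h.1 (not_le.2 h1)⟩

theorem abs_sieveForm_sdiff_le {w n : ℕ} (hwn : w ≤ n) {R : ℝ} (hR : 1 ≤ R) (hRn : R ≤ n)
    (hL : mertensProd w * 2 ^ w ≤ Real.log R) {A : Finset ℕ} (hA : A ⊆ primesBetween w n)
    {x y : ℝ} (hx0 : 0 ≤ x) (hy0 : 0 ≤ y) (hx : x ≤ R) (hy : y ≤ R) :
    |sieveForm (primesBetween w n \ A) x y| ≤ 32 * (mertensProd w * Real.log R) * 4 ^ #A := by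
  set V := mertensProd w with hV
  have hV1 : 1 ≤ V := one_le_mertensProd w
  have hP : ∀ p ∈ primesUpTo w, p.Prime := fun p hp => (mem_primesUpTo.1 hp).2
  have hAp : ∀ p ∈ A, p.Prime := fun p hp => (mem_primesBetween.1 (hA hp)).2.2
  have hQ : ∀ p ∈ primesBetween w n \ A, p.Prime := fun p hp =>
    (mem_primesBetween.1 (Finset.mem_sdiff.1 hp).1).2.2
  have hPA : Disjoint (primesUpTo w) A := Finset.disjoint_left.2 fun p hp hpA =>
    absurd (mem_primesUpTo.1 hp).1 (not_le.2 (mem_primesBetween.1 (hA hpA)).1)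
  have hPQ : Disjoint (primesUpTo w) (primesBetween w n \ A) :=
    Finset.disjoint_left.2 fun p hp hpA => absurd (mem_primesUpTo.1 hp).1
      (not_le.2 (mem_primesBetween.1 (Finset.mem_sdiff.1 hpA).1).1)
  have hunion : (primesBetween w n \ A) ∪ (primesUpTo w ∪ A) = primesUpTo n := by
    ext p
    simp only [Finset.mem_union, Finset.mem_sdiff, primesBetween]
    have h1 : p ∈ primesUpTo w → p ∈ primesUpTo n := fun h =>
      mem_primesUpTo.2 ⟨(mem_primesUpTo.1 h).1.trans hwn, (mem_primesUpTo.1 h).2⟩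
    have h2 : p ∈ A → p ∈ primesUpTo n := fun h => (Finset.mem_sdiff.1 (hA h)).1
    tauto
  have hbound : ∀ z, 0 < z → z ≤ R → |sieveLog (primesBetween w n \ A) z| ≤ 4 * V * 2 ^ #A := by
    intro z hz0 hzR
    have h := abs_sieveLog_le_of_union (A := primesUpTo w ∪ A) (a := 4) (C := 0) (R := R) hQ
      (fun q hq => (Finset.mem_union.1 hq).elim (hP q) (hAp q))
      (Finset.disjoint_union_right.2 ⟨hPQ.symm, Finset.sdiff_disjoint⟩) (by norm_num) le_rfl
      (fun u hu0 huR => by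
        rw [hunion, sieveLog_primesUpTo hu0.le (huR.trans hRn)]
        simpa using abs_moebiusLog_le u) hz0 hzR
    rw [Finset.prod_union hPA] at h
    have h2 := prod_inv_one_sub_inv_le hAp
    have h3 : 4 * V * ∏ p ∈ A, (1 - (p : ℝ)⁻¹)⁻¹ ≤ 4 * V * 2 ^ #A :=
      mul_le_mul_of_nonneg_left h2 (by positivity)
    have h4 : |sieveLog (primesBetween w n \ A) z| ≤ 4 * V * ∏ p ∈ A, (1 - (p : ℝ)⁻¹)⁻¹ := by
      rw [hV, mertensProd]
      linarith
    exact h4.trans h3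
  have hbound' : ∀ z, 0 ≤ z → z ≤ R → |sieveLog (primesBetween w n \ A) z| ≤ 4 * V * 2 ^ #A := by
    intro z hz0 hzR
    rcases hz0.eq_or_lt with rfl | h
    · rw [sieveLog_of_le_one hQ le_rfl zero_le_one, abs_zero]; positivity
    · exact hbound z h hzR
  have h1 := abs_sieveForm_le hQ hx0 hx (y := y) (G := fun _ => (4 * V * 2 ^ #A) ^ 2) (by
    intro s hs _
    have h1 := one_le_prod_of_prime fun p hp => hQ p (hs hp)
    have h1' : (1 : ℝ) ≤ (∏ p ∈ s, p : ℕ) := by exact_mod_cast h1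
    rw [sq]
    exact mul_le_mul (hbound' _ (by positivity) ((div_le_self hx0 h1').trans hx))
      (hbound' _ (by positivity) ((div_le_self hy0 h1').trans hy)) (abs_nonneg _) (by positivity))
  rw [← Finset.sum_mul] at h1
  have h2 := sum_inv_prod_le hP hQ hPQ hR
  have h3 : (2 : ℝ) ^ #(primesUpTo w) ≤ V⁻¹ * Real.log R := by
    rw [le_inv_mul_iff₀ (by linarith)]
    refine le_trans ?_ hL
    exact mul_le_mul_of_nonneg_left
      (pow_le_pow_right₀ (by norm_num) (card_primesUpTo_le w)) (by linarith)
  refine h1.trans ((mul_le_mul_of_nonneg_right (h2.trans (add_le_add le_rfl h3))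
    (by positivity)).trans (le_of_eq ?_))
  change (V⁻¹ * Real.log R + V⁻¹ * Real.log R) * _ = _
  have h4 : (4 : ℝ) ^ #A = 2 ^ #A * 2 ^ #A := by rw [← mul_pow]; norm_num
  rw [h4]
  field_simp
  ring

theorem sieveForm_primesBetween_le {w n : ℕ} (hwn : w ≤ n) {R : ℝ} (hR : 1 ≤ R) (hRn : R ≤ n)
    {ε K : ℝ} (hε : 0 < ε) (hK : 0 ≤ K)
    (hM : ∀ x : ℝ, 0 < x → |moebiusLog x| ≤ 1 + ε + K * x ^ (-(1 / 2 : ℝ))) :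
    sieveForm (primesBetween w n) R R ≤
      (1 + ε) ^ 3 * (mertensProd w * Real.log R + mertensProd w ^ 2 * 2 ^ w) +
      (1 + ε⁻¹) * (K * ∏ p ∈ primesUpTo w, (1 - (p : ℝ) ^ (-(1 / 2 : ℝ)))⁻¹) ^ 2 := by
  set V := mertensProd w with hV
  have hV1 : 1 ≤ V := one_le_mertensProd w
  set C := K * ∏ p ∈ primesUpTo w, (1 - (p : ℝ) ^ (-(1 / 2 : ℝ)))⁻¹ with hC
  have hP : ∀ p ∈ primesUpTo w, p.Prime := fun p hp => (mem_primesUpTo.1 hp).2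
  have hQ : ∀ p ∈ primesBetween w n, p.Prime := fun p hp => (mem_primesBetween.1 hp).2.2
  have hPQ : Disjoint (primesUpTo w) (primesBetween w n) := Finset.disjoint_sdiff
  have hunion : primesBetween w n ∪ primesUpTo w = primesUpTo n :=
    Finset.sdiff_union_of_subset fun p h =>
      mem_primesUpTo.2 ⟨(mem_primesUpTo.1 h).1.trans hwn, (mem_primesUpTo.1 h).2⟩
  have hbound : ∀ z, 0 < z → z ≤ R →
      |sieveLog (primesBetween w n) z| ≤ (1 + ε) * V + C * z ^ (-(1 / 2 : ℝ)) := by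
    intro z hz0 hzR
    exact abs_sieveLog_le_of_union (A := primesUpTo w) (a := 1 + ε) (C := K) (R := R) hQ hP
      hPQ.symm (by linarith) hK
      (fun u hu0 huR => by
        rw [hunion, sieveLog_primesUpTo hu0.le (huR.trans hRn)]
        exact hM u hu0) hz0 hzR
  have h1 := abs_sieveForm_le hQ (by linarith : (0 : ℝ) ≤ R) le_rfl (y := R)
    (G := fun r => (1 + ε) * ((1 + ε) * V) ^ 2 + (1 + ε⁻¹) * C ^ 2 * (r / R)) (by
    intro s hs hsR
    have h1 := one_le_prod_of_prime fun p hp => hQ p (hs hp)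
    have h1' : (1 : ℝ) ≤ (∏ p ∈ s, p : ℕ) := by exact_mod_cast h1
    set r : ℝ := ((∏ p ∈ s, p : ℕ) : ℝ) with hr
    have hb := hbound (R / r) (by positivity) (div_le_self (by linarith) h1')
    have hy : ((R / r) ^ (-(1 / 2 : ℝ))) ^ 2 = r / R := by
      rw [← Real.rpow_natCast, ← Real.rpow_mul (by positivity)]
      norm_num [Real.rpow_neg_one]
    set y := (R / r) ^ (-(1 / 2 : ℝ)) with hydef
    rw [← sq]
    refine (pow_le_pow_left₀ (abs_nonneg _) hb 2).trans ?_
    rw [← hy]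
    have h5 : 0 ≤ (ε * ((1 + ε) * V) - C * y) ^ 2 * ε⁻¹ := by positivity
    have h6 : (ε * ((1 + ε) * V) - C * y) ^ 2 * ε⁻¹ =
      ε * ((1 + ε) * V) ^ 2 - 2 * ((1 + ε) * V) * (C * y) + ε⁻¹ * (C * y) ^ 2 := by
      field_simp
      ring
    nlinarith)
  refine (le_abs_self _).trans (h1.trans ?_)
  have h2 := sum_inv_prod_le hP hQ hPQ hR
  have h3 : (2 : ℝ) ^ #(primesUpTo w) ≤ 2 ^ w :=
    pow_le_pow_right₀ (by norm_num) (card_primesUpTo_le w)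
  have h4 := card_filter_prod_le hQ (by linarith : (0 : ℝ) ≤ R)
  simp only [mul_add, Finset.sum_add_distrib]
  rw [← Finset.sum_mul]
  refine add_le_add ?_ ?_
  · change _ ≤ V⁻¹ * Real.log R + _ at h2
    refine (mul_le_mul_of_nonneg_right (h2.trans (add_le_add le_rfl h3))
      (by positivity)).trans (le_of_eq ?_)
    field_simp
  · have h5 : ∀ s ∈ (primesBetween w n).powerset.filter
        (fun s => ((∏ p ∈ s, p : ℕ) : ℝ) ≤ R), 1 / ((∏ p ∈ s, p : ℕ) : ℝ) *
        ((1 + ε⁻¹) * C ^ 2 * (((∏ p ∈ s, p : ℕ) : ℝ) / R)) = (1 + ε⁻¹) * C ^ 2 / R := by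
      intro s hs
      have h1 := one_le_prod_of_prime fun p hp =>
        hQ p (Finset.mem_powerset.1 (Finset.mem_filter.1 hs).1 hp)
      have h1' : ((∏ p ∈ s, p : ℕ) : ℝ) ≠ 0 := by exact_mod_cast Nat.one_le_iff_ne_zero.1 h1
      field_simp
    rw [Finset.sum_congr rfl h5, Finset.sum_const, nsmul_eq_mul]
    refine (mul_le_mul_of_nonneg_right h4 (by positivity)).trans (le_of_eq ?_)
    field_simp

theorem primeFactors_prod_primesUpTo (w : ℕ) :
    (∏ p ∈ primesUpTo w, p).primeFactors = primesUpTo w :=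
  Nat.primeFactors_prod fun _ hp => (mem_primesUpTo.1 hp).2

theorem mertensProd_eq (w : ℕ) :
    mertensProd w = ((∏ p ∈ primesUpTo w, p : ℕ) : ℝ) / Nat.totient (∏ p ∈ primesUpTo w, p) := by
  have h := Nat.totient_eq_mul_prod_factors (∏ p ∈ primesUpTo w, p)
  rw [primeFactors_prod_primesUpTo] at h
  have h' : (Nat.totient (∏ p ∈ primesUpTo w, p) : ℝ) =
      (∏ p ∈ primesUpTo w, p : ℕ) * ∏ p ∈ primesUpTo w, (1 - (p : ℝ)⁻¹) := by
    have := congrArg (Rat.cast : ℚ → ℝ) h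
    push_cast at this ⊢
    exact this
  have h0 : ((∏ p ∈ primesUpTo w, p : ℕ) : ℝ) ≠ 0 := by
    have := one_le_prod_of_prime fun p (hp : p ∈ primesUpTo w) => (mem_primesUpTo.1 hp).2
    exact_mod_cast Nat.one_le_iff_ne_zero.1 this
  rw [h', mertensProd, Finset.prod_inv_distrib, div_mul_cancel_left₀ h0]

theorem inv_one_sub_rpow_le {p : ℕ} (hp : p.Prime) :
    0 ≤ (1 - (p : ℝ) ^ (-(1 / 2 : ℝ)))⁻¹ ∧
      (1 - (p : ℝ) ^ (-(1 / 2 : ℝ)))⁻¹ ≤ (if p < 4 then 4 else 1) * 2 := by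
  have hp2 : (2 : ℝ) ≤ p := by exact_mod_cast hp.two_le
  have hp0 : (0 : ℝ) < p := by linarith
  set q := (p : ℝ) ^ (-(1 / 2 : ℝ)) with hq
  have hq0 : 0 < q := by positivity
  have hqq : q * q * p = 1 := by
    have : q * q = (p : ℝ)⁻¹ := by
      rw [hq, ← Real.rpow_add hp0]; norm_num [Real.rpow_neg_one]
    rw [this]; field_simp
  have hq1 : q < 3 / 4 := by
    by_contra h
    nlinarith [not_lt.1 h, mul_le_mul (not_lt.1 h) (not_lt.1 h) (by norm_num) hq0.le]
  refine ⟨inv_nonneg.2 (by linarith), ?_⟩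
  rw [inv_le_comm₀ (by linarith) (by split_ifs <;> norm_num)]
  split_ifs with h
  · norm_num; linarith
  · have hp4 : (4 : ℝ) ≤ p := by exact_mod_cast not_lt.1 h
    have : q ≤ 1 / 2 := by
      by_contra h
      nlinarith [not_le.1 h, mul_lt_mul'' (not_le.1 h) (not_le.1 h) (by norm_num) (by norm_num)]
    norm_num; linarith

theorem prod_inv_one_sub_rpow_le (w : ℕ) :
    0 ≤ ∏ p ∈ primesUpTo w, (1 - (p : ℝ) ^ (-(1 / 2 : ℝ)))⁻¹ ∧
    ∏ p ∈ primesUpTo w, (1 - (p : ℝ) ^ (-(1 / 2 : ℝ)))⁻¹ ≤ 4 ^ 4 * 2 ^ w := by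
  refine ⟨Finset.prod_nonneg fun p hp => (inv_one_sub_rpow_le (mem_primesUpTo.1 hp).2).1, ?_⟩
  refine (Finset.prod_le_prod
    (fun p hp => (inv_one_sub_rpow_le (mem_primesUpTo.1 hp).2).1)
    (fun p hp => (inv_one_sub_rpow_le (mem_primesUpTo.1 hp).2).2)).trans ?_
  rw [Finset.prod_mul_distrib, Finset.prod_const, ← Finset.prod_filter, Finset.prod_const]
  refine mul_le_mul (pow_le_pow_right₀ (by norm_num) ?_)
    (pow_le_pow_right₀ (by norm_num) (card_primesUpTo_le w)) (by positivity) (by positivity)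
  have : (primesUpTo w).filter (· < 4) ⊆ range 4 := fun p hp => by
    simpa using (Finset.mem_filter.1 hp).2
  simpa using Finset.card_le_card this

theorem eventually_pow_le_log {γ : ℝ} (hγ : 0 < γ) {w : ℕ → ℕ} (hw : Tendsto w atTop atTop)
    (hwl : ∀ᶠ N : ℕ in atTop, (w N : ℝ) ≤ Real.log (Real.log N) / 2) {η : ℝ} (hη : 0 < η) :
    ∀ᶠ N : ℕ in atTop, (4 : ℝ) ^ w N ≤ η * Real.log ((N : ℝ) ^ γ) := by
  have h1 : Tendsto (fun t : ℕ => (4 / Real.exp 2) ^ t) atTop (nhds 0) := by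
    refine tendsto_pow_atTop_nhds_zero_of_lt_one (by positivity) ?_
    rw [div_lt_one (by positivity)]
    have : Real.exp 2 = Real.exp 1 * Real.exp 1 := by rw [← Real.exp_add]; norm_num
    nlinarith [Real.exp_one_gt_d9]
  have h2 := (h1.comp hw).eventually_le_const (show 0 < η * γ by positivity)
  filter_upwards [h2, hwl, eventually_ge_atTop 3] with N h2 h3 hN
  have hN3 : (3 : ℝ) ≤ N := by exact_mod_cast hN
  have hlog : 0 < Real.log N := Real.log_pos (by linarith)
  rw [Real.log_rpow (by linarith)]
  have h4 : Real.exp 2 ^ w N ≤ Real.log N := by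
    rw [← Real.exp_nat_mul, ← Real.le_log_iff_exp_le hlog]; linarith
  simp only [Function.comp, div_pow] at h2
  rw [div_le_iff₀ (by positivity)] at h2
  calc _ ≤ _ := h2
    _ ≤ η * γ * Real.log N := by gcongr
    _ = _ := by ring

theorem eventually_sieveForm_le {γ : ℝ} (hγ : 0 < γ) {w : ℕ → ℕ} (hw : Tendsto w atTop atTop)
    (hwl : ∀ᶠ N : ℕ in atTop, (w N : ℝ) ≤ Real.log (Real.log N) / 2) {ε : ℝ} (hε : 0 < ε) :
    ∀ᶠ N : ℕ in atTop, 1 ≤ (N : ℝ) ^ γ ∧ w N ≤ ⌈(N : ℝ) ^ γ⌉₊ ∧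
      mertensProd (w N) * 2 ^ w N ≤ Real.log ((N : ℝ) ^ γ) ∧
      sieveForm (primesBetween (w N) ⌈(N : ℝ) ^ γ⌉₊) ((N : ℝ) ^ γ) ((N : ℝ) ^ γ) ≤
        (1 + ε) * (mertensProd (w N) * Real.log ((N : ℝ) ^ γ)) := by
  set ε₁ := min 1 ε / 16 with hε₁
  have hε₁0 : 0 < ε₁ := by positivity
  have hε₁1 : ε₁ ≤ 1 := by
    have := min_le_left 1 ε
    linarith
  have hε₁ε : 16 * ε₁ ≤ ε := by
    have := min_le_right 1 ε
    linarith
  obtain ⟨K, hK, hM⟩ := exists_abs_moebiusLog_le hε₁0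
  set η := min ε₁ (ε₁ / ((1 + ε₁⁻¹) * K ^ 2 * 4 ^ 8 + 1)) with hη
  have hη0 : 0 < η := by positivity
  filter_upwards [eventually_pow_le_log hγ hw hwl hη0, eventually_ge_atTop 1] with N h1 hN
  set R := (N : ℝ) ^ γ with hR
  set t := w N
  have hR1 : 1 ≤ R := Real.one_le_rpow (by exact_mod_cast hN) hγ.le
  have hL0 : 0 ≤ Real.log R := Real.log_nonneg hR1
  have hηε : η ≤ ε₁ := min_le_left _ _
  have h4L : (4 : ℝ) ^ t ≤ Real.log R :=
    h1.trans (by nlinarith)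
  have htR : t ≤ ⌈R⌉₊ := by
    have h5 : (t : ℝ) ≤ R := by
      have h6 : t < 4 ^ t := Nat.lt_pow_self (by norm_num)
      have h7 : (t : ℝ) ≤ 4 ^ t := by exact_mod_cast h6.le
      have := Real.log_le_sub_one_of_pos (by linarith : 0 < R)
      linarith
    exact_mod_cast h5.trans (Nat.le_ceil R)
  have hV1 := one_le_mertensProd t
  have hV2 := mertensProd_le t
  set V := mertensProd t
  have hV4 : V * 2 ^ t ≤ 4 ^ t := by
    calc V * 2 ^ t ≤ 2 ^ t * 2 ^ t := by gcongr
      _ = 4 ^ t := by rw [← mul_pow]; norm_num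
  refine ⟨hR1, htR, hV4.trans h4L, ?_⟩
  refine (sieveForm_primesBetween_le htR hR1 (Nat.le_ceil R) hε₁0 hK hM).trans ?_
  obtain ⟨hH0, hH⟩ := prod_inv_one_sub_rpow_le t
  set H := ∏ p ∈ primesUpTo t, (1 - (p : ℝ) ^ (-(1 / 2 : ℝ)))⁻¹
  change (1 + ε₁) ^ 3 * (V * Real.log R + V ^ 2 * 2 ^ t) + _ ≤ _
  have h5 : V ^ 2 * 2 ^ t ≤ ε₁ * (V * Real.log R) := by
    calc V ^ 2 * 2 ^ t = V * (V * 2 ^ t) := by ring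
      _ ≤ V * (ε₁ * Real.log R) := by
        refine mul_le_mul_of_nonneg_left (hV4.trans (h1.trans ?_)) (by linarith)
        exact mul_le_mul_of_nonneg_right hηε hL0
      _ = _ := by ring
  have h6 : (1 + ε₁⁻¹) * (K * H) ^ 2 ≤ ε₁ * (V * Real.log R) := by
    have hb : 0 < (1 + ε₁⁻¹) * K ^ 2 * 4 ^ 8 + 1 := by positivity
    calc (1 + ε₁⁻¹) * (K * H) ^ 2 ≤ (1 + ε₁⁻¹) * (K * (4 ^ 4 * 2 ^ t)) ^ 2 := by gcongr
      _ = (1 + ε₁⁻¹) * K ^ 2 * 4 ^ 8 * 4 ^ t := by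
        have : (4 : ℝ) ^ t = 2 ^ t * 2 ^ t := by rw [← mul_pow]; norm_num
        rw [this]; ring
      _ ≤ ((1 + ε₁⁻¹) * K ^ 2 * 4 ^ 8 + 1) *
          ((ε₁ / ((1 + ε₁⁻¹) * K ^ 2 * 4 ^ 8 + 1)) * Real.log R) := by
        refine mul_le_mul (by linarith) (h1.trans ?_) (by positivity) hb.le
        gcongr
        exact min_le_right _ _
      _ = ε₁ * (1 * Real.log R) := by field_simp
      _ ≤ _ := by gcongr
  have hX : 0 ≤ V * Real.log R := by positivity
  set X := V * Real.log R
  calc _ ≤ (1 + ε₁) ^ 3 * (X + ε₁ * X) + ε₁ * X := by gcongr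
    _ = ((1 + ε₁) ^ 4 + ε₁) * X := by ring
    _ ≤ (1 + ε) * X := by
      refine mul_le_mul_of_nonneg_right ?_ hX
      have h2 : ε₁ ^ 2 ≤ ε₁ := pow_le_of_le_one hε₁0.le hε₁1 (by norm_num)
      have h3 : ε₁ ^ 3 ≤ ε₁ := pow_le_of_le_one hε₁0.le hε₁1 (by norm_num)
      have h4 : ε₁ ^ 4 ≤ ε₁ := pow_le_of_le_one hε₁0.le hε₁1 (by norm_num)
      nlinarith

/-- The linear functional on a monoid algebra determined by its values on monomials. -/
def monomialEval {G : Type*} (Φ : G → ℝ) : MonoidAlgebra ℝ G →ₗ[ℝ] ℝ :=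
  Finsupp.linearCombination ℝ Φ ∘ₗ (MonoidAlgebra.coeffLinearEquiv ℝ).toLinearMap

@[simp]
theorem monomialEval_of {G : Type*} [Monoid G] (Φ : G → ℝ) (a : G) :
    monomialEval Φ (MonoidAlgebra.of ℝ G a) = Φ a := by
  simp [monomialEval, MonoidAlgebra.of_apply]

/-- Every linear functional bounded by `B` on monomials is bounded by `c * B` at `P`; that is,
the `ℓ¹` norm of the coefficients of `P` is at most `c`. -/
def CoeffBound {G : Type*} [Monoid G] (P : MonoidAlgebra ℝ G) (c : ℝ) : Prop :=
  ∀ (Ψ : MonoidAlgebra ℝ G →ₗ[ℝ] ℝ) (B : ℝ), (∀ a, |Ψ (MonoidAlgebra.of ℝ G a)| ≤ B) →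
    |Ψ P| ≤ c * B

namespace CoeffBound

variable {G : Type*} [CommMonoid G] {P Q : MonoidAlgebra ℝ G} {c d : ℝ}

theorem of (a : G) : CoeffBound (MonoidAlgebra.of ℝ G a) 1 := fun Ψ B h => by
  simpa using h a

theorem one : CoeffBound (1 : MonoidAlgebra ℝ G) 1 := by
  rw [← map_one (MonoidAlgebra.of ℝ G)]
  exact CoeffBound.of 1

theorem zero : CoeffBound (0 : MonoidAlgebra ℝ G) 0 := fun Ψ B h => by simp

theorem add (hP : CoeffBound P c) (hQ : CoeffBound Q d) : CoeffBound (P + Q) (c + d) :=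
  fun Ψ B h => by
    rw [map_add, add_mul]
    exact (abs_add_le _ _).trans (add_le_add (hP Ψ B h) (hQ Ψ B h))

theorem neg (hP : CoeffBound P c) : CoeffBound (-P) c := fun Ψ B h => by
  rw [map_neg, abs_neg]; exact hP Ψ B h

theorem sub (hP : CoeffBound P c) (hQ : CoeffBound Q d) : CoeffBound (P - Q) (c + d) := by
  rw [sub_eq_add_neg]; exact hP.add hQ.neg

theorem mono (hP : CoeffBound P c) (h : c ≤ d) : CoeffBound P d := fun Ψ B hB =>
  (hP Ψ B hB).trans (mul_le_mul_of_nonneg_right h ((abs_nonneg _).trans (hB 1)))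

theorem smul (hP : CoeffBound P c) {r : ℝ} (hr : 0 ≤ r) : CoeffBound (r • P) (r * c) :=
  fun Ψ B h => by
    rw [map_smul, smul_eq_mul, abs_mul, abs_of_nonneg hr, mul_assoc]
    exact mul_le_mul_of_nonneg_left (hP Ψ B h) hr

theorem mul (hP : CoeffBound P c) (hQ : CoeffBound Q d) : CoeffBound (P * Q) (c * d) :=
  fun Ψ B h => by
    rw [mul_assoc]
    refine hP (Ψ ∘ₗ (LinearMap.mul ℝ _).flip Q) (d * B) fun a => ?_
    refine hQ (Ψ ∘ₗ LinearMap.mulLeft ℝ (MonoidAlgebra.of ℝ G a)) B fun b => ?_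
    simp only [LinearMap.comp_apply, LinearMap.mulLeft_apply]
    rw [← map_mul]
    exact h _

theorem sum {ι : Type*} {s : Finset ι} {P : ι → MonoidAlgebra ℝ G} {c : ι → ℝ}
    (h : ∀ i ∈ s, CoeffBound (P i) (c i)) : CoeffBound (∑ i ∈ s, P i) (∑ i ∈ s, c i) := by
  induction s using Finset.induction_on with
  | empty => simpa using CoeffBound.zero
  | insert i s hi ih =>
    rw [Finset.sum_insert hi, Finset.sum_insert hi]
    exact (h i (Finset.mem_insert_self i s)).add
      (ih fun j hj => h j (Finset.mem_insert_of_mem hj))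

theorem prod {ι : Type*} {s : Finset ι} {P : ι → MonoidAlgebra ℝ G} {c : ι → ℝ}
    (h : ∀ i ∈ s, CoeffBound (P i) (c i)) : CoeffBound (∏ i ∈ s, P i) (∏ i ∈ s, c i) := by
  induction s using Finset.induction_on with
  | empty => simpa using CoeffBound.one
  | insert i s hi ih =>
    rw [Finset.prod_insert hi, Finset.prod_insert hi]
    exact (h i (Finset.mem_insert_self i s)).mul
      (ih fun j hj => h j (Finset.mem_insert_of_mem hj))

/-- First and second order approximation of `∏ (1 + uᵢ)`. -/
theorem prod_one_add_sub {ι : Type*} (s : Finset ι) {u : ι → MonoidAlgebra ℝ G} {t : ℝ}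
    (ht0 : 0 ≤ t) (ht1 : t ≤ 1) (h : ∀ i ∈ s, CoeffBound (u i) (7 * t)) :
    CoeffBound (∏ i ∈ s, (1 + u i)) (8 ^ #s) ∧ CoeffBound (∏ i ∈ s, (1 + u i) - 1) (8 ^ #s * t) ∧
      CoeffBound (∏ i ∈ s, (1 + u i) - 1 - ∑ i ∈ s, u i) (8 ^ #s * t ^ 2) := by
  induction s using Finset.induction_on with
  | empty =>
    refine ⟨by simpa using CoeffBound.one, ?_, ?_⟩
    · simpa using CoeffBound.zero.mono ht0
    · simpa using CoeffBound.zero.mono (sq_nonneg t)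
  | insert i s hi ih =>
    obtain ⟨h1, h2, h3⟩ := ih fun j hj => h j (Finset.mem_insert_of_mem hj)
    have hu := h i (Finset.mem_insert_self i s)
    have h8 : (0 : ℝ) ≤ 8 ^ #s := by positivity
    rw [Finset.prod_insert hi, Finset.sum_insert hi, Finset.card_insert_of_notMem hi]
    refine ⟨((CoeffBound.one.add hu).mul h1).mono ?_, ?_, ?_⟩
    · rw [pow_succ]; nlinarith
    · have : (1 + u i) * ∏ j ∈ s, (1 + u j) - 1 = (∏ j ∈ s, (1 + u j) - 1) +
        u i * ∏ j ∈ s, (1 + u j) := by ring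
      rw [this]
      refine (h2.add (hu.mul h1)).mono (le_of_eq ?_)
      ring
    · have : (1 + u i) * ∏ j ∈ s, (1 + u j) - 1 - (u i + ∑ j ∈ s, u j) =
        (∏ j ∈ s, (1 + u j) - 1 - ∑ j ∈ s, u j) + u i * (∏ j ∈ s, (1 + u j) - 1) := by ring
      rw [this]
      refine (h3.add (hu.mul h2)).mono (le_of_eq ?_)
      ring

end CoeffBound

/-- Evaluation of a functional of product type on a product of polynomials in separate
variables. -/
theorem monomialEval_of_mul_prod {ι G κ : Type*} [Fintype ι] [CommMonoid G]
    (φ : G → ℝ) (a : ι → G) (K : ι → Finset κ) (c : ι → κ → ℝ) (b : ι → κ → G) :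
    monomialEval (fun g : ι → G => ∏ i, φ (g i)) (MonoidAlgebra.of ℝ (ι → G) a *
      ∏ i, ∑ k ∈ K i, c i k • MonoidAlgebra.of ℝ (ι → G) (Pi.mulSingle i (b i k))) =
      ∏ i, ∑ k ∈ K i, c i k * φ (a i * b i k) := by
  rw [Finset.prod_univ_sum, Finset.prod_univ_sum, Finset.mul_sum, map_sum]
  refine Finset.sum_congr rfl fun k _ => ?_
  have h : ∏ i, c i (k i) • MonoidAlgebra.of ℝ (ι → G) (Pi.mulSingle i (b i (k i))) =
      (∏ i, c i (k i)) • MonoidAlgebra.of ℝ (ι → G) (fun i => b i (k i)) := by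
    rw [Finset.prod_smul, ← map_prod, Finset.univ_prod_mulSingle]
  rw [h, mul_smul_comm, ← map_mul, map_smul, monomialEval_of, smul_eq_mul,
    Finset.prod_mul_distrib]
  rfl

/-- The first of the two variables attached to `i`, raised to the multiplicative power `n`. -/
def varFst {ι : Type*} (n : ℕ) (i : ι) : MonoidAlgebra ℝ (ι → ℕ × ℕ) :=
  MonoidAlgebra.of ℝ (ι → ℕ × ℕ) (Pi.mulSingle i (n, 1))

/-- The second of the two variables attached to `i`, raised to the multiplicative power `n`. -/
def varSnd {ι : Type*} (n : ℕ) (i : ι) : MonoidAlgebra ℝ (ι → ℕ × ℕ) :=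
  MonoidAlgebra.of ℝ (ι → ℕ × ℕ) (Pi.mulSingle i (1, n))

/-- The local factor of the sieve forms at `p`. -/
def formFactor {ι : Type*} (p : ℕ) (i : ι) : MonoidAlgebra ℝ (ι → ℕ × ℕ) :=
  (1 + (p : ℝ)⁻¹ • (varFst p i * varSnd p i)) *
    ((1 - (p : ℝ)⁻¹ • varFst p i) * (1 - (p : ℝ)⁻¹ • varSnd p i))

/-- The local factor at `p` of the correlation sum, for the events `E i` that the `i`-th linear
form is divisible by `p`. -/
def eventFactor {ι : Type*} [Fintype ι] (p : ℕ) (E : ι → Prop) : MonoidAlgebra ℝ (ι → ℕ × ℕ) :=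
  ∏ i, if E i then (1 - varFst p i) * (1 - varSnd p i) else 1

section
variable {ι : Type*}

theorem coeffBound_varFst (p : ℕ) (i : ι) : CoeffBound (varFst p i) 1 := CoeffBound.of _

theorem coeffBound_varSnd (p : ℕ) (i : ι) : CoeffBound (varSnd p i) 1 := CoeffBound.of _

theorem coeffBound_formFactor_sub {p : ℕ} (hp : 1 ≤ p) (i : ι) :
    CoeffBound (formFactor p i - 1) (7 * (p : ℝ)⁻¹) ∧
    CoeffBound (formFactor p i - 1 -
      (p : ℝ)⁻¹ • ((1 - varFst p i) * (1 - varSnd p i) - 1)) (4 * ((p : ℝ)⁻¹) ^ 2) := by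
  have hp1 : (1 : ℝ) ≤ p := by exact_mod_cast hp
  have hq1 : (p : ℝ)⁻¹ ≤ 1 := inv_le_one_of_one_le₀ hp1
  have hq0 : 0 ≤ (p : ℝ)⁻¹ := by positivity
  have hT := coeffBound_varFst p i
  have hT' := coeffBound_varSnd p i
  unfold formFactor
  set q := (p : ℝ)⁻¹
  set T := varFst p i
  set T' := varSnd p i
  have hTT := hT.mul hT'
  have hY : CoeffBound (T * T' - T * (T * T') - T' * (T * T') + q • ((T * T') * (T * T'))) 4 :=
    (((hTT.sub (hT.mul hTT)).sub (hT'.mul hTT)).add ((hTT.mul hTT).smul hq0)).mono (by linarith)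
  have hX : CoeffBound ((1 - T) * (1 - T') - 1) 3 := by
    have : (1 - T) * (1 - T') - 1 = T * T' - T - T' := by ring
    rw [this]
    exact ((hTT.sub hT).sub hT').mono (by norm_num)
  have key : (1 + q • (T * T')) * ((1 - q • T) * (1 - q • T')) - 1 =
      q • ((1 - T) * (1 - T') - 1) +
      (q ^ 2) • (T * T' - T * (T * T') - T' * (T * T') + q • ((T * T') * (T * T'))) := by
    simp only [Algebra.smul_def, map_pow]
    ring
  rw [key]
  refine ⟨((hX.smul hq0).add (hY.smul (sq_nonneg q))).mono (by nlinarith), ?_⟩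
  rw [add_sub_cancel_left]
  exact (hY.smul (sq_nonneg q)).mono (by linarith)

variable [Fintype ι]

theorem coeffBound_prod_formFactor {p : ℕ} (hp : 1 ≤ p) :
    CoeffBound (∏ i : ι, formFactor p i - 1) (8 ^ Fintype.card ι * (p : ℝ)⁻¹) ∧
    CoeffBound (∏ i : ι, formFactor p i - 1 - ∑ i : ι, (formFactor p i - 1))
      (8 ^ Fintype.card ι * (p : ℝ)⁻¹ ^ 2) := by
  have hp1 : (1 : ℝ) ≤ p := by exact_mod_cast hp
  have h := CoeffBound.prod_one_add_sub (univ : Finset ι) (u := fun i => formFactor p i - 1)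
    (by positivity) (inv_le_one_of_one_le₀ hp1) fun i _ => (coeffBound_formFactor_sub hp i).1
  simp only [add_sub_cancel, Finset.card_univ] at h
  exact h.2

theorem coeffBound_eventFactor (p : ℕ) (E : ι → Prop) :
    CoeffBound (eventFactor p E) (4 ^ Fintype.card ι) := by
  have h := CoeffBound.prod (s := (univ : Finset ι)) (c := fun _ => (4 : ℝ))
    (P := fun i => if E i then (1 - varFst p i) * (1 - varSnd p i) else 1) fun i _ => by
      split_ifs
      · exact ((CoeffBound.one.sub (coeffBound_varFst p i)).mul
          (CoeffBound.one.sub (coeffBound_varSnd p i))).mono (by norm_num)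
      · exact CoeffBound.one.mono (by norm_num)
  simpa [eventFactor] using h

/-- The `ℓ¹` constant in the comparison of the averaged local factors with the main factors. -/
def localConst (n : ℕ) : ℝ := n * (4 ^ n + 1) + 4 * n + 8 ^ n

theorem coeffBound_avg_sub {p : ℕ} (hp : 1 ≤ p) {E : ι → ℕ → Prop}
    (hE : ∀ i, #((range p).filter (E i)) = 1) :
    CoeffBound ((p : ℝ)⁻¹ • ∑ y ∈ range p, eventFactor p (fun i => E i y) -
      ∏ i, formFactor p i) (localConst (Fintype.card ι) * (p : ℝ)⁻¹) := by
  have hp0 : (p : ℝ) ≠ 0 := by exact_mod_cast Nat.one_le_iff_ne_zero.1 hp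
  have hq0 : 0 ≤ (p : ℝ)⁻¹ := by positivity
  have h1 : ∀ y ∈ range p, CoeffBound (eventFactor p (fun i => E i y) - 1)
      ((4 ^ Fintype.card ι + 1) * ∑ i, if E i y then 1 else 0) := by
    intro y _
    by_cases h : ∃ i, E i y
    · obtain ⟨i, hi⟩ := h
      refine ((coeffBound_eventFactor p _).sub CoeffBound.one).mono ?_
      refine le_mul_of_one_le_right (by positivity) ?_
      have := Finset.single_le_sum (f := fun i => if E i y then (1 : ℝ) else 0) (s := univ)
        (fun i _ => by positivity) (Finset.mem_univ i)
      simpa [hi] using this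
    · push Not at h
      simpa [eventFactor, h] using CoeffBound.zero (G := ι → ℕ × ℕ)
  have h2 := (CoeffBound.sum h1).smul hq0
  have h3 : ∑ y ∈ range p, ((4 : ℝ) ^ Fintype.card ι + 1) * ∑ i, (if E i y then (1 : ℝ) else 0) =
      (4 ^ Fintype.card ι + 1) * Fintype.card ι := by
    rw [← Finset.mul_sum, Finset.sum_comm]
    congr 1
    simp [Finset.sum_boole, hE]
  rw [h3] at h2
  have h4 : (p : ℝ)⁻¹ • ∑ y ∈ range p, eventFactor p (fun i => E i y) - ∏ i, formFactor p i =
      (p : ℝ)⁻¹ • ∑ y ∈ range p, (eventFactor p (fun i => E i y) - 1) -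
        (∏ i, formFactor p i - 1) := by
    rw [Finset.sum_sub_distrib, smul_sub, Finset.sum_const, Finset.card_range,
      ← Nat.cast_smul_eq_nsmul ℝ, smul_smul, inv_mul_cancel₀ hp0, one_smul]
    ring
  rw [h4]
  refine (h2.sub (coeffBound_prod_formFactor hp).1).mono ?_
  unfold localConst
  have : (0 : ℝ) ≤ Fintype.card ι * (p : ℝ)⁻¹ := by positivity
  nlinarith

theorem coeffBound_avg_sub_of_distinct {p : ℕ} (hp : 1 ≤ p) {E : ι → ℕ → Prop}
    (hE : ∀ i, #((range p).filter (E i)) = 1)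
    (hd : ∀ y ∈ range p, ∀ i j, E i y → E j y → i = j) :
    CoeffBound ((p : ℝ)⁻¹ • ∑ y ∈ range p, eventFactor p (fun i => E i y) -
      ∏ i, formFactor p i) (localConst (Fintype.card ι) * (p : ℝ)⁻¹ ^ 2) := by
  have hp0 : (p : ℝ) ≠ 0 := by exact_mod_cast Nat.one_le_iff_ne_zero.1 hp
  have h1 : ∀ y ∈ range p, eventFactor p (fun i => E i y) =
      1 + ∑ i, if E i y then (1 - varFst p i) * (1 - varSnd p i) - 1 else 0 := by
    intro y hy
    unfold eventFactor
    by_cases h : ∃ i, E i y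
    · obtain ⟨i, hi⟩ := h
      rw [Finset.prod_eq_single i, Finset.sum_eq_single i]
      · simp [hi]
      · intro j _ hj
        rw [if_neg fun h => hj (hd y hy _ _ h hi)]
      · simp
      · intro j _ hj
        rw [if_neg fun h => hj (hd y hy _ _ h hi)]
      · simp
    · push Not at h
      simp [h]
  have h2 : (p : ℝ)⁻¹ • ∑ y ∈ range p, eventFactor p (fun i => E i y) =
      1 + (p : ℝ)⁻¹ • ∑ i : ι, ((1 - varFst p i) * (1 - varSnd p i) - 1) := by
    rw [Finset.sum_congr rfl h1, Finset.sum_add_distrib, Finset.sum_comm, smul_add,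
      Finset.sum_const, Finset.card_range,
      ← Nat.cast_smul_eq_nsmul ℝ, smul_smul, inv_mul_cancel₀ hp0, one_smul]
    congr 2
    refine Finset.sum_congr rfl fun i _ => ?_
    rw [← Finset.sum_filter, Finset.sum_const, hE i, one_smul]
  have h3 : (p : ℝ)⁻¹ • ∑ y ∈ range p, eventFactor p (fun i => E i y) - ∏ i, formFactor p i =
      -(∑ i : ι, (formFactor p i - 1 -
        (p : ℝ)⁻¹ • ((1 - varFst p i) * (1 - varSnd p i) - 1))) -
      (∏ i : ι, formFactor p i - 1 - ∑ i : ι, (formFactor p i - 1)) := by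
    rw [h2, Finset.smul_sum, Finset.sum_sub_distrib]
    ring
  rw [h3]
  refine ((CoeffBound.sum fun i _ => (coeffBound_formFactor_sub hp i).2).neg.sub
    (coeffBound_prod_formFactor hp).2).mono ?_
  unfold localConst
  have : (0 : ℝ) ≤ Fintype.card ι * (4 ^ Fintype.card ι + 1) * (p : ℝ)⁻¹ ^ 2 := by positivity
  simp only [Finset.sum_const, Finset.card_univ, nsmul_eq_mul]
  nlinarith

end

/-- The truncated logarithm weight of a pair of divisors. -/
def pairWeight (R : ℝ) (g : ℕ × ℕ) : ℝ := Real.posLog (R / g.1) * Real.posLog (R / g.2)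

/-- The functional replacing each monomial by its truncated logarithm weight. -/
def sieveEval {ι : Type*} [Fintype ι] (R : ℝ) : MonoidAlgebra ℝ (ι → ℕ × ℕ) →ₗ[ℝ] ℝ :=
  monomialEval fun g : ι → ℕ × ℕ => ∏ i, pairWeight R (g i)

section
variable {ι : Type*}

theorem finset_prod_mk {α : Type*} (s : Finset α) (f g : α → ℕ) :
    ∏ p ∈ s, (f p, g p) = (∏ p ∈ s, f p, ∏ p ∈ s, g p) :=
  Prod.ext Prod.fst_prod Prod.snd_prod

theorem finset_prod_one_mk (s : Finset ℕ) :
    ∏ p ∈ s, ((1, p) : ℕ × ℕ) = (1, ∏ p ∈ s, p) := by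
  rw [finset_prod_mk s (fun _ => 1), Finset.prod_const_one]

theorem prod_one_add_smul_of (P : Finset ℕ) (f : ℕ → ℝ) (g : ℕ → ℕ × ℕ) (i : ι) :
    ∏ p ∈ P, (1 + f p • MonoidAlgebra.of ℝ (ι → ℕ × ℕ) (Pi.mulSingle i (g p))) =
      ∑ s ∈ P.powerset, (∏ p ∈ s, f p) •
        MonoidAlgebra.of ℝ (ι → ℕ × ℕ) (Pi.mulSingle i (∏ p ∈ s, g p)) := by
  rw [Finset.prod_one_add]
  refine Finset.sum_congr rfl fun s _ => ?_
  rw [Finset.prod_smul, ← map_prod]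
  congr 2
  exact (map_prod (MonoidHom.mulSingle (fun _ : ι => ℕ × ℕ) i) g s).symm

theorem prod_formFactor (P : Finset ℕ) (i : ι) :
    ∏ p ∈ P, formFactor p i = ∑ k ∈ P.powerset ×ˢ P.powerset ×ˢ P.powerset,
      ((((∏ p ∈ k.1, p : ℕ) : ℝ)⁻¹) * (((-1) ^ #k.2.1 / ((∏ p ∈ k.2.1, p : ℕ) : ℝ)) *
        ((-1) ^ #k.2.2 / ((∏ p ∈ k.2.2, p : ℕ) : ℝ)))) •
      MonoidAlgebra.of ℝ (ι → ℕ × ℕ) (Pi.mulSingle i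
        ((∏ p ∈ k.1, p) * (∏ p ∈ k.2.1, p), (∏ p ∈ k.1, p) * (∏ p ∈ k.2.2, p))) := by
  have h1 := prod_one_add_smul_of P (fun p => (p : ℝ)⁻¹) (fun p => (p, p)) i
  have h2 := prod_one_add_smul_of P (fun p => -(p : ℝ)⁻¹) (fun p => (p, 1)) i
  have h3 := prod_one_add_smul_of P (fun p => -(p : ℝ)⁻¹) (fun p => (1, p)) i
  have hneg : ∀ s : Finset ℕ, ∏ p ∈ s, -(p : ℝ)⁻¹ = (-1) ^ #s / ((∏ p ∈ s, p : ℕ) : ℝ) := by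
    intro s
    rw [Finset.prod_neg, Finset.prod_inv_distrib, Nat.cast_prod, div_eq_mul_inv]
  have hinv : ∀ s : Finset ℕ, ∏ p ∈ s, (p : ℝ)⁻¹ = ((∏ p ∈ s, p : ℕ) : ℝ)⁻¹ := by
    intro s
    rw [Finset.prod_inv_distrib, Nat.cast_prod]
  simp only [hneg, hinv, finset_prod_mk, finset_prod_one_mk, Finset.prod_const_one] at h1 h2 h3
  have h0 : ∀ p ∈ P, formFactor p i =
      (1 + (p : ℝ)⁻¹ • MonoidAlgebra.of ℝ (ι → ℕ × ℕ) (Pi.mulSingle i (p, p))) *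
      ((1 + -(p : ℝ)⁻¹ • MonoidAlgebra.of ℝ (ι → ℕ × ℕ) (Pi.mulSingle i (p, 1))) *
      (1 + -(p : ℝ)⁻¹ • MonoidAlgebra.of ℝ (ι → ℕ × ℕ) (Pi.mulSingle i (1, p)))) := by
    intro p _
    rw [formFactor, varFst, varSnd, ← map_mul, ← Pi.mulSingle_mul, neg_smul, neg_smul,
      ← sub_eq_add_neg, ← sub_eq_add_neg]
    simp
  rw [Finset.prod_congr rfl h0, Finset.prod_mul_distrib, Finset.prod_mul_distrib, h1, h2, h3,
    Finset.sum_mul_sum, ← Finset.sum_product', Finset.sum_mul_sum, ← Finset.sum_product']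
  refine Finset.sum_congr rfl fun k _ => ?_
  rw [smul_mul_smul_comm, smul_mul_smul_comm, ← map_mul, ← map_mul, ← Pi.mulSingle_mul,
    ← Pi.mulSingle_mul]
  simp

variable [Fintype ι]

theorem sieveEval_of_mul_prod_formFactor (R : ℝ) (P : Finset ℕ) (a : ι → ℕ × ℕ) :
    sieveEval R (MonoidAlgebra.of ℝ (ι → ℕ × ℕ) a * ∏ p ∈ P, ∏ i, formFactor p i) =
      ∏ i, sieveForm P (R / (a i).1) (R / (a i).2) := by
  rw [Finset.prod_comm, Finset.prod_congr rfl fun i _ => prod_formFactor P i, sieveEval,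
    monomialEval_of_mul_prod]
  refine Finset.prod_congr rfl fun i _ => ?_
  rw [Finset.sum_product, sieveForm]
  refine Finset.sum_congr rfl fun s _ => ?_
  rw [Finset.sum_product, sieveLog, sieveLog, Finset.sum_mul_sum, Finset.mul_sum]
  refine Finset.sum_congr rfl fun t _ => ?_
  rw [Finset.mul_sum]
  refine Finset.sum_congr rfl fun u _ => ?_
  simp only [pairWeight, Prod.fst_mul, Prod.snd_mul, Nat.cast_mul, div_div]
  rw [mul_assoc ((a i).1 : ℝ), mul_assoc ((a i).2 : ℝ)]
  ring

/-- The coefficient of the divisor `∏ p ∈ s, p` in the truncated divisor sum. -/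
def divisorCoeff (R : ℝ) (s : Finset ℕ) : ℝ :=
  (-1) ^ #s * Real.posLog (R / ((∏ p ∈ s, p : ℕ) : ℝ))

theorem sieveEval_prod_eventFactor (R : ℝ) {Q : Finset ℕ} {S : ι → Finset ℕ}
    (hS : ∀ i, S i ⊆ Q) :
    sieveEval R (∏ p ∈ Q, eventFactor p fun i => p ∈ S i) =
      ∏ i, (∑ s ∈ (S i).powerset, divisorCoeff R s) ^ 2 := by
  have h : ∏ p ∈ Q, eventFactor p (fun i => p ∈ S i) = MonoidAlgebra.of ℝ (ι → ℕ × ℕ) 1 *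
      ∏ i, ∑ k ∈ (S i).powerset ×ˢ (S i).powerset, ((-1 : ℝ) ^ #k.1 * (-1) ^ #k.2) •
        MonoidAlgebra.of ℝ (ι → ℕ × ℕ) (Pi.mulSingle i (∏ p ∈ k.1, p, ∏ p ∈ k.2, p)) := by
    unfold eventFactor
    rw [map_one, one_mul, Finset.prod_comm]
    refine Finset.prod_congr rfl fun i _ => ?_
    refine (Finset.prod_subset (hS i) fun p _ hp => if_neg hp).symm.trans
      ((Finset.prod_congr rfl fun p hp => if_pos hp).trans ?_)
    rw [Finset.prod_mul_distrib]
    have h2 := prod_one_add_smul_of (S i) (fun p => -1) (fun p => (p, 1)) i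
    have h3 := prod_one_add_smul_of (S i) (fun p => -1) (fun p => (1, p)) i
    simp only [finset_prod_mk, finset_prod_one_mk, Finset.prod_const_one, Finset.prod_const,
      neg_smul, ← sub_eq_add_neg, one_smul] at h2 h3
    unfold varFst varSnd
    rw [h2, h3, Finset.sum_mul_sum, ← Finset.sum_product']
    refine Finset.sum_congr rfl fun k _ => ?_
    rw [smul_mul_smul_comm, ← map_mul, ← Pi.mulSingle_mul]
    simp
  rw [h, sieveEval, monomialEval_of_mul_prod]
  refine Finset.prod_congr rfl fun i _ => ?_
  rw [sq, Finset.sum_mul_sum, ← Finset.sum_product']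
  refine Finset.sum_congr rfl fun k _ => ?_
  simp only [pairWeight, Pi.one_apply, one_mul, divisorCoeff]
  ring

end

theorem div_natCast_mem_Icc {R : ℝ} (hR : 0 ≤ R) (a : ℕ) : 0 ≤ R / a ∧ R / a ≤ R := by
  refine ⟨by positivity, ?_⟩
  rcases Nat.eq_zero_or_pos a with rfl | ha
  · simpa using hR
  · exact div_le_self hR (by exact_mod_cast ha)

theorem one_add_mul_prod_sub_le {α : Type*} (s : Finset α) {c : α → ℝ} (hc : ∀ a ∈ s, 0 ≤ c a)
    {K : ℝ} (hK : 1 ≤ K) :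
    1 + K * (∏ a ∈ s, (1 + c a) - 1) ≤ ∏ a ∈ s, (1 + K * c a) := by
  induction s using Finset.induction_on with
  | empty => simp
  | insert i s hi ih =>
    have ih := ih fun a ha => hc a (Finset.mem_insert_of_mem ha)
    have hi0 := hc i (Finset.mem_insert_self i s)
    have h1 : 1 ≤ ∏ a ∈ s, (1 + c a) := Finset.one_le_prod fun a ha => by
      linarith [hc a (Finset.mem_insert_of_mem ha)]
    have h2 : ∏ a ∈ s, (1 + c a) ≤ ∏ a ∈ s, (1 + K * c a) :=
      Finset.prod_le_prod (fun a ha => by linarith [hc a (Finset.mem_insert_of_mem ha)])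
        fun a ha => by nlinarith [hc a (Finset.mem_insert_of_mem ha)]
    rw [Finset.prod_insert hi, Finset.prod_insert hi]
    nlinarith [mul_le_mul_of_nonneg_left h2 (show 0 ≤ K * c i by positivity)]

theorem sieveEval_prod_avg_le {ι : Type*} [Fintype ι] {w n : ℕ} (hwn : w ≤ n) {R : ℝ}
    (hR : 1 ≤ R) (hRn : R ≤ n) (hL : mertensProd w * 2 ^ w ≤ Real.log R)
    (E : ℕ → ι → ℕ → Prop) {c : ℕ → ℝ}
    (hc : ∀ p ∈ primesBetween w n, CoeffBound ((p : ℝ)⁻¹ • ∑ y ∈ range p,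
      eventFactor p (fun i => E p i y) - ∏ i : ι, formFactor p i) (c p)) :
    sieveEval R (∏ p ∈ primesBetween w n,
      ((p : ℝ)⁻¹ • ∑ y ∈ range p, eventFactor p (fun i => E p i y))) ≤
      sieveForm (primesBetween w n) R R ^ Fintype.card ι +
      (32 * (mertensProd w * Real.log R)) ^ Fintype.card ι *
        (∏ p ∈ primesBetween w n, (1 + 4 ^ Fintype.card ι * c p) - 1) := by
  set Q := primesBetween w n
  set X := 32 * (mertensProd w * Real.log R) with hX
  set D : ℕ → MonoidAlgebra ℝ (ι → ℕ × ℕ) := fun p => (p : ℝ)⁻¹ • ∑ y ∈ range p,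
      eventFactor p (fun i => E p i y) - ∏ i : ι, formFactor p i with hD
  have hR0 : 0 ≤ R := by linarith
  have hV := one_le_mertensProd w
  have hX0 : 0 ≤ X := by
    have := Real.log_nonneg hR
    positivity
  have h1 : ∏ p ∈ Q, ((p : ℝ)⁻¹ • ∑ y ∈ range p, eventFactor p (fun i => E p i y)) =
      ∑ A ∈ Q.powerset, (∏ p ∈ A, D p) * ∏ p ∈ Q \ A, ∏ i : ι, formFactor p i := by
    rw [← Finset.prod_add]
    exact Finset.prod_congr rfl fun p _ => by simp [hD]
  have h2 : ∀ A ∈ Q.powerset, |sieveEval R ((∏ p ∈ A, D p) *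
      ∏ p ∈ Q \ A, ∏ i : ι, formFactor p i)| ≤
      X ^ Fintype.card ι * ∏ p ∈ A, (4 ^ Fintype.card ι * c p) := by
    intro A hA
    have hAQ := Finset.mem_powerset.1 hA
    have h3 := CoeffBound.prod fun p hp => hc p (hAQ hp)
    have h4 := h3 (sieveEval R ∘ₗ (LinearMap.mul ℝ _).flip
      (∏ p ∈ Q \ A, ∏ i : ι, formFactor p i)) ((X * 4 ^ #A) ^ Fintype.card ι) fun a => by
        simp only [LinearMap.comp_apply, LinearMap.flip_apply, LinearMap.mul_apply']
        rw [sieveEval_of_mul_prod_formFactor, Finset.abs_prod, ← Finset.card_univ,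
          ← Finset.prod_const]
        refine Finset.prod_le_prod (fun i _ => abs_nonneg _) fun i _ => ?_
        obtain ⟨ha, ha'⟩ := div_natCast_mem_Icc hR0 (a i).1
        obtain ⟨hb, hb'⟩ := div_natCast_mem_Icc hR0 (a i).2
        exact abs_sieveForm_sdiff_le hwn hR hRn hL hAQ ha hb ha' hb'
    refine h4.trans (le_of_eq ?_)
    rw [Finset.prod_mul_distrib, Finset.prod_const, mul_pow, ← pow_mul, ← pow_mul,
      mul_comm (#A)]
    ring
  have h0 : sieveEval R ((∏ p ∈ (∅ : Finset ℕ), D p) *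
      ∏ p ∈ Q \ ∅, ∏ i : ι, formFactor p i) = sieveForm Q R R ^ Fintype.card ι := by
    have := sieveEval_of_mul_prod_formFactor R Q (1 : ι → ℕ × ℕ)
    rw [map_one, one_mul] at this
    simpa using this
  rw [h1, map_sum, ← Finset.add_sum_erase _ _ (Finset.empty_mem_powerset Q), h0]
  refine add_le_add le_rfl ?_
  refine (Finset.sum_le_sum fun A hA =>
    (le_abs_self _).trans (h2 A (Finset.mem_of_mem_erase hA))).trans (le_of_eq ?_)
  rw [← Finset.mul_sum, Finset.prod_one_add,
    ← Finset.add_sum_erase _ _ (Finset.empty_mem_powerset Q), Finset.prod_empty,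
    add_sub_cancel_left]

theorem sum_primesBetween_inv_sq_le {w n : ℕ} (hw : w ≠ 0) (hwn : w ≤ n) :
    ∑ p ∈ primesBetween w n, (p : ℝ)⁻¹ ^ 2 ≤ (w : ℝ)⁻¹ := by
  have hsub : primesBetween w n ⊆ Ioc w n := fun p hp => by
    have := mem_primesBetween.1 hp
    exact Finset.mem_Ioc.2 ⟨this.1, this.2.1⟩
  calc _ ≤ ∑ p ∈ Ioc w n, (p : ℝ)⁻¹ ^ 2 :=
        Finset.sum_le_sum_of_subset_of_nonneg hsub fun _ _ _ => by positivity
    _ = ∑ p ∈ Ioc w n, ((p : ℝ) ^ 2)⁻¹ := by simp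
    _ ≤ (w : ℝ)⁻¹ - (n : ℝ)⁻¹ := sum_Ioc_inv_sq_le_sub hw hwn
    _ ≤ _ := by
      have : 0 ≤ (n : ℝ)⁻¹ := by positivity
      linarith

theorem prod_one_add_ite_le {w n : ℕ} (hw : w ≠ 0) (hwn : w ≤ n) (bad : Finset ℕ) {C : ℝ}
    (hC : 0 ≤ C) (hbad : ∀ p ∈ bad, 1 ≤ p) :
    ∏ p ∈ primesBetween w n, (1 + C * (if p ∈ bad then (p : ℝ)⁻¹ else (p : ℝ)⁻¹ ^ 2)) ≤
      Real.exp (C * (w : ℝ)⁻¹) * ∏ p ∈ bad, (1 + C * (p : ℝ) ^ (-(1 / 2 : ℝ))) := by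
  set Q := primesBetween w n
  have h1 : ∀ p ∈ Q, 1 + C * (if p ∈ bad then (p : ℝ)⁻¹ else (p : ℝ)⁻¹ ^ 2) ≤
      Real.exp (C * (p : ℝ)⁻¹ ^ 2) *
        (if p ∈ bad then (1 + C * (p : ℝ) ^ (-(1 / 2 : ℝ))) else 1) := by
    intro p _
    have h2 : 1 + C * (p : ℝ)⁻¹ ^ 2 ≤ Real.exp (C * (p : ℝ)⁻¹ ^ 2) := by
      rw [add_comm]; exact Real.add_one_le_exp _
    split_ifs with h
    · have hp : (1 : ℝ) ≤ p := by exact_mod_cast hbad p h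
      have h3 : (p : ℝ)⁻¹ ≤ (p : ℝ) ^ (-(1 / 2 : ℝ)) := by
        rw [← Real.rpow_neg_one]
        exact Real.rpow_le_rpow_of_exponent_le hp (by norm_num)
      have h4 : 1 ≤ Real.exp (C * (p : ℝ)⁻¹ ^ 2) := Real.one_le_exp (by positivity)
      have h5 : 0 ≤ (p : ℝ)⁻¹ := by positivity
      calc 1 + C * (p : ℝ)⁻¹ ≤ 1 * (1 + C * (p : ℝ) ^ (-(1 / 2 : ℝ))) := by nlinarith
        _ ≤ _ := by gcongr
    · simpa using h2
  refine (Finset.prod_le_prod (fun p _ => by positivity) h1).trans ?_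
  rw [Finset.prod_mul_distrib, ← Real.exp_sum, ← Finset.mul_sum]
  refine mul_le_mul ?_ ?_ (Finset.prod_nonneg fun p _ => by split_ifs <;> positivity)
    (by positivity)
  · exact Real.exp_le_exp.2
      (mul_le_mul_of_nonneg_left (sum_primesBetween_inv_sq_le hw hwn) hC)
  · rw [Finset.prod_ite_mem]
    exact Finset.prod_le_prod_of_subset_of_one_le Finset.inter_subset_right
      (fun p _ => by positivity) fun p _ _ => by
        have : 0 ≤ C * (p : ℝ) ^ (-(1 / 2 : ℝ)) := by positivity
        linarith

theorem sum_range_mul_mod {A : Type*} [CommSemiring A] {q M : ℕ} (hq : 0 < q) (hM : 0 < M)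
    (h : q.Coprime M) (f g : ℕ → A) :
    ∑ x ∈ range (q * M), f (x % q) * g (x % M) = (∑ x ∈ range q, f x) * ∑ x ∈ range M, g x := by
  rw [Finset.sum_mul_sum, ← Finset.sum_product']
  refine Finset.sum_nbij' (fun x => (x % q, x % M))
    (fun k => (Nat.chineseRemainder h k.1 k.2 : ℕ)) ?_ ?_ ?_ ?_ ?_
  · intro x _
    simp [Nat.mod_lt _ hq, Nat.mod_lt _ hM]
  · intro k _
    exact Finset.mem_range.2 (Nat.chineseRemainder_lt_mul h _ _ hq.ne' hM.ne')
  · intro x hx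
    have h1 := Nat.chineseRemainder_modEq_unique h (a := x % q) (b := x % M) (z := x)
      (Nat.mod_modEq x q).symm (Nat.mod_modEq x M).symm
    exact (Nat.ModEq.eq_of_lt_of_lt h1 (Finset.mem_range.1 hx)
      (Nat.chineseRemainder_lt_mul h _ _ hq.ne' hM.ne')).symm
  · rintro ⟨a, b⟩ hk
    obtain ⟨ha, hb⟩ := Finset.mem_product.1 hk
    have h1 := (Nat.chineseRemainder h a b).2
    ext
    · exact Eq.trans h1.1 (Nat.mod_eq_of_lt (Finset.mem_range.1 ha))
    · exact Eq.trans h1.2 (Nat.mod_eq_of_lt (Finset.mem_range.1 hb))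
  · intro x _
    rfl

/-- The Chinese remainder theorem as a factorisation of sums over a full period. -/
theorem sum_range_prod_mod {A : Type*} [CommSemiring A] {Q : Finset ℕ} (hQ : ∀ p ∈ Q, p.Prime)
    (f : ℕ → ℕ → A) :
    ∑ x ∈ range (∏ p ∈ Q, p), ∏ p ∈ Q, f p (x % p) = ∏ p ∈ Q, ∑ y ∈ range p, f p y := by
  induction Q using Finset.induction_on with
  | empty => simp
  | insert q Q hq ih =>
    have hQ' : ∀ p ∈ Q, p.Prime := fun p hp => hQ p (Finset.mem_insert_of_mem hp)
    have hqp := hQ q (Finset.mem_insert_self q Q)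
    have hcop : q.Coprime (∏ p ∈ Q, p) := Nat.Coprime.prod_right fun p hp =>
      (Nat.coprime_primes hqp (hQ' p hp)).2 fun h => hq (h ▸ hp)
    rw [Finset.prod_insert hq, Finset.prod_insert hq, ← ih hQ',
      ← sum_range_mul_mod hqp.pos (one_le_prod_of_prime hQ') hcop]
    refine Finset.sum_congr rfl fun x _ => ?_
    rw [Finset.prod_insert hq]
    congr 1
    refine Finset.prod_congr rfl fun p hp => ?_
    rw [Nat.mod_mod_of_dvd _ (Finset.dvd_prod_of_mem _ hp)]

theorem abs_card_filter_modEq_sub_le {q M : ℕ} (hq : 0 < q) (hM : 0 < M) (hqM : q ∣ M)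
    {a c : ℤ} (hac : a ≤ c + 1) (v : ℤ) :
    |(#((Icc a c).filter (· ≡ v [ZMOD q])) : ℝ) - ((c - a + 1 : ℤ) : ℝ) / M *
      #((range M).filter fun x : ℕ => (x : ℤ) ≡ v [ZMOD q])| ≤ 1 := by
  have hq0 : (0 : ℤ) < q := by exact_mod_cast hq
  have hqQ : (0 : ℚ) < q := by exact_mod_cast hq
  have h1 := Int.Ico_filter_modEq_card a (c + 1) hq0 v
  obtain ⟨k, rfl⟩ := hqM
  have h2 : #((range (q * k)).filter fun x : ℕ => (x : ℤ) ≡ v [ZMOD q]) = k := by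
    have h3 := Int.Ico_filter_modEq_card 0 ((q * k : ℕ) : ℤ) hq0 v
    have h4 : ((((q * k : ℕ) : ℤ) : ℚ) - v) / ((q : ℤ) : ℚ) =
        ((0 : ℤ) - v) / ((q : ℤ) : ℚ) + k := by
      push_cast
      field_simp
      ring
    rw [h4, Int.ceil_add_natCast, add_sub_cancel_left, max_eq_left (by positivity)] at h3
    have h5 : #((range (q * k)).filter fun x : ℕ => (x : ℤ) ≡ v [ZMOD q]) =
        #((Ico (0 : ℤ) ((q * k : ℕ) : ℤ)).filter (· ≡ v [ZMOD q])) := by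
      refine Finset.card_nbij' (fun x : ℕ => (x : ℤ)) Int.toNat ?_ ?_ ?_ ?_
      · intro x hx
        simp only [Finset.coe_filter, Finset.mem_range, Set.mem_ofPred_eq, Finset.mem_Ico] at hx ⊢
        exact ⟨⟨by positivity, by exact_mod_cast hx.1⟩, hx.2⟩
      · intro x hx
        simp only [Finset.coe_filter, Finset.mem_range, Set.mem_ofPred_eq, Finset.mem_Ico] at hx ⊢
        rw [Int.toNat_of_nonneg hx.1.1]
        exact ⟨by have := hx.1; omega, hx.2⟩
      · intro x _
        simp
      · intro x hx
        simp only [Finset.coe_filter, Set.mem_ofPred_eq, Finset.mem_Ico] at hx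
        exact Int.toNat_of_nonneg hx.1.1
    exact_mod_cast h5 ▸ h3
  rw [h2]
  have hk : 0 < k := Nat.pos_of_mul_pos_left hM
  have h3 : Icc a c = Ico a (c + 1) := by ext; simp
  have h4 : ⌈((a : ℚ) - v) / ((q : ℤ) : ℚ)⌉ ≤ ⌈(((c + 1 : ℤ) : ℚ) - v) / ((q : ℤ) : ℚ)⌉ := by
    apply Int.ceil_mono
    have : (a : ℚ) ≤ ((c + 1 : ℤ) : ℚ) := by exact_mod_cast hac
    push_cast at this ⊢
    gcongr
  rw [max_eq_left (by linarith)] at h1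
  have h5 : |((⌈(((c + 1 : ℤ) : ℚ) - v) / ((q : ℤ) : ℚ)⌉ -
      ⌈((a : ℚ) - v) / ((q : ℤ) : ℚ)⌉ : ℤ) : ℚ) -
      (c - a + 1 : ℤ) / (q : ℚ)| ≤ 1 := by
    have e : ((c - a + 1 : ℤ) : ℚ) / (q : ℚ) = (((c + 1 : ℤ) : ℚ) - v) / ((q : ℤ) : ℚ) -
        ((a : ℚ) - v) / ((q : ℤ) : ℚ) := by
      push_cast
      field_simp
      ring
    rw [e]
    set x := (((c + 1 : ℤ) : ℚ) - v) / ((q : ℤ) : ℚ)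
    set y := ((a : ℚ) - v) / ((q : ℤ) : ℚ)
    push_cast
    have := Int.le_ceil x
    have := Int.ceil_lt_add_one x
    have := Int.le_ceil y
    have := Int.ceil_lt_add_one y
    rw [abs_le]
    constructor <;> linarith
  rw [← h1, ← h3] at h5
  have h6 : ((c - a + 1 : ℤ) : ℝ) / ((q * k : ℕ) : ℝ) * k = ((c - a + 1 : ℤ) : ℝ) / q := by
    push_cast
    field_simp
  rw [h6]
  exact_mod_cast h5

/-- Comparison of a sum over an interval with the corresponding sum over a full period, for a
combination of indicator functions of residue classes. -/
theorem abs_sum_Icc_sub_le {κ : Type*} {K : Finset κ} {M : ℕ} (hM : 0 < M) {a c : ℤ}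
    (hac : a ≤ c + 1) (C : κ → ℝ) (P : κ → ℤ → Prop)
    (hP : ∀ k ∈ K, (∃ x, P k x) → ∃ v : ℤ, ∃ q : ℕ, 0 < q ∧ q ∣ M ∧
      ∀ x, P k x ↔ x ≡ v [ZMOD q]) :
    |∑ x ∈ Icc a c, ∑ k ∈ K, (if P k x then C k else 0) - ((c - a + 1 : ℤ) : ℝ) / M *
      ∑ x ∈ range M, ∑ k ∈ K, (if P k (x : ℤ) then C k else 0)| ≤ ∑ k ∈ K, |C k| := by
  rw [Finset.sum_comm, Finset.sum_comm (s := range M), Finset.mul_sum, ← Finset.sum_sub_distrib]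
  refine (Finset.abs_sum_le_sum_abs _ _).trans (Finset.sum_le_sum fun k hk => ?_)
  by_cases h : ∃ x, P k x
  · obtain ⟨v, q, hq, hqM, hv⟩ := hP k hk h
    have h1 := abs_card_filter_modEq_sub_le hq hM hqM hac v
    simp only [hv]
    rw [← Finset.sum_filter, ← Finset.sum_filter, Finset.sum_const, Finset.sum_const,
      nsmul_eq_mul, nsmul_eq_mul, ← mul_assoc, ← sub_mul, abs_mul]
    refine mul_le_of_le_one_left (abs_nonneg _) ?_
    convert h1
  · push Not at h
    simp [h]

theorem LambdaR_eq_sum_powerset {w n k : ℕ} {R : ℝ} (hR : 0 ≤ R) (hRn : R ≤ n) (hk : k ≠ 0)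
    (hcop : ∀ p, p.Prime → p ≤ w → ¬ p ∣ k) :
    LambdaR R k = ∑ s ∈ ((primesBetween w n).filter (· ∣ k)).powerset, divisorCoeff R s := by
  have hP : ∀ p ∈ (primesBetween w n).filter (· ∣ k), p.Prime := fun p hp =>
    (mem_primesBetween.1 (Finset.mem_filter.1 hp).1).2.2
  refine Eq.trans ?_ (sum_moebius_mul_eq_sum_powerset hP
    (D := k.divisors.filter fun d : ℕ => (d : ℝ) ≤ R) (fun d => Real.posLog (R / d)) ?_ ?_)
  · refine Finset.sum_congr rfl fun d hd => ?_
    obtain ⟨hd1, hd2⟩ := Finset.mem_filter.1 hd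
    have hd0 : (0 : ℝ) < d := by exact_mod_cast Nat.pos_of_mem_divisors hd1
    rw [Real.posLog_eq_log]
    rw [abs_of_nonneg (by positivity)]
    exact (one_le_div hd0).2 hd2
  · intro s hs hne
    have hs' : ∀ p ∈ s, p.Prime := fun p hp => hP p (hs hp)
    refine Finset.mem_filter.2 ⟨Nat.mem_divisors.2 ⟨?_, hk⟩, ?_⟩
    · exact Finset.prod_primes_dvd k (fun p hp => (hs' p hp).prime)
        fun p hp => (Finset.mem_filter.1 (hs hp)).2
    · by_contra hlt
      exact hne (posLog_div_eq_zero hR (one_le_prod_of_prime hs') (not_le.1 hlt).le)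
  · intro d hd _
    obtain ⟨hd1, hd2⟩ := Finset.mem_filter.1 hd
    have hdk := Nat.dvd_of_mem_divisors hd1
    have hd0 := Nat.pos_of_mem_divisors hd1
    refine ⟨hd0.ne', fun p hp => ?_⟩
    have hpp := Nat.prime_of_mem_primeFactors hp
    have hpd := Nat.dvd_of_mem_primeFactors hp
    refine Finset.mem_filter.2 ⟨mem_primesBetween.2 ⟨?_, ?_, hpp⟩, hpd.trans hdk⟩
    · exact not_le.1 fun h => hcop p hpp h (hpd.trans hdk)
    · have h1 : (p : ℝ) ≤ d := by exact_mod_cast Nat.le_of_dvd hd0 hpd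
      exact_mod_cast h1.trans (hd2.trans hRn)

theorem sum_abs_divisorCoeff_le {Q : Finset ℕ} (hQ : ∀ p ∈ Q, p.Prime) {R : ℝ} (hR : 1 ≤ R) :
    ∑ s ∈ Q.powerset, |divisorCoeff R s| ≤ R * Real.log R := by
  have hR0 : 0 ≤ R := by linarith
  have habs : ∀ s, |divisorCoeff R s| = Real.posLog (R / (∏ p ∈ s, p : ℕ)) := by
    intro s
    rw [divisorCoeff, abs_mul, abs_pow, abs_neg, abs_one, one_pow, one_mul,
      abs_of_nonneg Real.posLog_nonneg]
  rw [← Finset.sum_filter_of_ne (p := fun s : Finset ℕ => ((∏ p ∈ s, p : ℕ) : ℝ) ≤ R)]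
  · calc _ ≤ ∑ s ∈ Q.powerset.filter (fun s : Finset ℕ => ((∏ p ∈ s, p : ℕ) : ℝ) ≤ R),
          Real.log R := by
          refine Finset.sum_le_sum fun s hs => ?_
          have h1 : (1 : ℝ) ≤ (∏ p ∈ s, p : ℕ) := by
            exact_mod_cast one_le_prod_of_prime fun p hp =>
              hQ p (Finset.mem_powerset.1 (Finset.mem_filter.1 hs).1 hp)
          rw [habs, ← Real.posLog_eq_log (x := R) (by rwa [abs_of_nonneg hR0])]
          exact Real.posLog_le_posLog (by positivity) (div_le_self hR0 h1)
      _ ≤ _ := by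
          rw [Finset.sum_const, nsmul_eq_mul]
          exact mul_le_mul_of_nonneg_right (card_filter_prod_le hQ hR0) (Real.log_nonneg hR)
  · intro s hs hne
    by_contra hlt
    refine hne ?_
    rw [habs]
    exact posLog_div_eq_zero hR0 (one_le_prod_of_prime fun p hp =>
      hQ p (Finset.mem_powerset.1 hs hp)) (not_le.1 hlt).le

section
variable {ι : Type*} [Fintype ι]

/-- A product of squared divisor sums, expanded into indicator functions. -/
theorem prod_sum_sq_eq_sum_ite {Q : Finset ℕ} (g : Finset ℕ → ℝ) {S : ι → Finset ℕ}
    (hS : ∀ i, S i ⊆ Q) :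
    ∏ i, (∑ s ∈ (S i).powerset, g s) ^ 2 =
      ∑ k ∈ Fintype.piFinset fun _ : ι => Q.powerset ×ˢ Q.powerset,
        if ∀ i, (k i).1 ⊆ S i ∧ (k i).2 ⊆ S i then ∏ i, (g (k i).1 * g (k i).2) else 0 := by
  have h1 : ∀ i, (∑ s ∈ (S i).powerset, g s) ^ 2 = ∑ k ∈ Q.powerset ×ˢ Q.powerset,
      if k.1 ⊆ S i ∧ k.2 ⊆ S i then g k.1 * g k.2 else 0 := by
    intro i
    rw [pow_two, Finset.sum_mul_sum, ← Finset.sum_product', ← Finset.sum_filter]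
    refine Finset.sum_congr ?_ fun _ _ => rfl
    ext k
    simp only [Finset.mem_product, Finset.mem_powerset, Finset.mem_filter]
    exact ⟨fun h => ⟨⟨h.1.trans (hS i), h.2.trans (hS i)⟩, h⟩, fun h => h.2⟩
  simp only [h1]
  rw [Finset.prod_univ_sum]
  refine Finset.sum_congr rfl fun k _ => ?_
  rw [Finset.prod_ite_zero]
  simp

theorem sum_abs_prod_divisorCoeff_le {Q : Finset ℕ} (hQ : ∀ p ∈ Q, p.Prime) {R : ℝ}
    (hR : 1 ≤ R) :
    ∑ k ∈ Fintype.piFinset fun _ : ι => Q.powerset ×ˢ Q.powerset,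
      |∏ i, (divisorCoeff R (k i).1 * divisorCoeff R (k i).2)| ≤
        (R * Real.log R) ^ (2 * Fintype.card ι) := by
  have h1 : ∀ k : ι → Finset ℕ × Finset ℕ,
      |∏ i, (divisorCoeff R (k i).1 * divisorCoeff R (k i).2)| =
        ∏ i, (|divisorCoeff R (k i).1| * |divisorCoeff R (k i).2|) := by
    intro k
    simp only [Finset.abs_prod, abs_mul]
  simp only [h1]
  rw [← Finset.prod_univ_sum (fun _ : ι => Q.powerset ×ˢ Q.powerset)
    (fun _ k => |divisorCoeff R k.1| * |divisorCoeff R k.2|), Finset.prod_const, Finset.card_univ,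
    Finset.sum_product' Q.powerset Q.powerset
      (fun s t => |divisorCoeff R s| * |divisorCoeff R t|), ← Finset.sum_mul_sum, ← pow_two,
    ← pow_mul]
  exact pow_le_pow_left₀ (Finset.sum_nonneg fun _ _ => abs_nonneg _)
    (sum_abs_divisorCoeff_le hQ hR) _

/-- The simultaneous conditions imposed by a tuple of sets of primes define a residue class. -/
theorem exists_modEq_of_subset_filter {Q : Finset ℕ} (hQ : ∀ p ∈ Q, p.Prime)
    {E : ℕ → ι → ℤ → Prop}
    (hE : ∀ p ∈ Q, ∀ i x y, E p i x → (E p i y ↔ y ≡ x [ZMOD p]))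
    {k : ι → Finset ℕ × Finset ℕ} {v : ℤ}
    (hv : ∀ i, (k i).1 ⊆ Q.filter (E · i v) ∧ (k i).2 ⊆ Q.filter (E · i v)) :
    ∃ q : ℕ, 0 < q ∧ q ∣ ∏ p ∈ Q, p ∧ ∀ x,
      (∀ i, (k i).1 ⊆ Q.filter (E · i x) ∧ (k i).2 ⊆ Q.filter (E · i x)) ↔ x ≡ v [ZMOD q] := by
  have hv' : ∀ i, ∀ p ∈ (k i).1 ∪ (k i).2, p ∈ Q ∧ E p i v := fun i p hp =>
    Finset.mem_filter.1 ((Finset.union_subset (hv i).1 (hv i).2) hp)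
  set U := Finset.univ.biUnion fun i => (k i).1 ∪ (k i).2 with hU
  have hUQ : U ⊆ Q := Finset.biUnion_subset.2 fun i _ p hp => (hv' i p hp).1
  have hUp : ∀ p ∈ U, p.Prime := fun p hp => hQ p (hUQ hp)
  refine ⟨∏ p ∈ U, p, one_le_prod_of_prime hUp, Finset.prod_dvd_prod_of_subset _ _ _ hUQ,
    fun x => ⟨fun hx => ?_, fun hx i => ?_⟩⟩
  · rw [Int.modEq_comm, Int.modEq_iff_dvd, Nat.cast_prod]
    refine Finset.prod_dvd_of_coprime (fun p hp q hq hpq => ?_) fun p hp => ?_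
    · exact Nat.isCoprime_iff_coprime.2 ((Nat.coprime_primes (hUp p hp) (hUp q hq)).2 hpq)
    · obtain ⟨i, _, hi⟩ := Finset.mem_biUnion.1 hp
      obtain ⟨hpQ, hpv⟩ := hv' i p hi
      have hpx := (Finset.mem_filter.1 ((Finset.union_subset (hx i).1 (hx i).2) hi)).2
      exact Int.modEq_iff_dvd.1 ((hE p hpQ i v x hpv).1 hpx).symm
  · refine Finset.union_subset_iff.1 fun p hp => ?_
    obtain ⟨hpQ, hpv⟩ := hv' i p hp
    refine Finset.mem_filter.2 ⟨hpQ, (hE p hpQ i v x hpv).2 ?_⟩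
    have hpU : p ∈ U := Finset.mem_biUnion.2 ⟨i, Finset.mem_univ i, hp⟩
    exact hx.of_dvd (by exact_mod_cast Finset.dvd_prod_of_mem (fun p => p) hpU)

theorem sum_range_prod_sq_eq {Q : Finset ℕ} (hQ : ∀ p ∈ Q, p.Prime) (R : ℝ)
    {E : ℕ → ι → ℤ → Prop}
    (hE : ∀ p ∈ Q, ∀ i x y, E p i x → (E p i y ↔ y ≡ x [ZMOD p])) :
    ((∏ p ∈ Q, p : ℕ) : ℝ)⁻¹ * ∑ x ∈ range (∏ p ∈ Q, p),
        ∏ i, (∑ s ∈ (Q.filter (E · i (x : ℤ))).powerset, divisorCoeff R s) ^ 2 =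
      sieveEval R (∏ p ∈ Q, ((p : ℝ)⁻¹ • ∑ y ∈ range p, eventFactor p fun i => E p i (y : ℤ))) := by
  rw [Finset.prod_smul, map_smul, smul_eq_mul, Nat.cast_prod, Finset.prod_inv_distrib,
    ← sum_range_prod_mod hQ (fun p y => eventFactor p fun i => E p i (y : ℤ)), map_sum]
  congr 1
  refine Finset.sum_congr rfl fun x _ => ?_
  rw [← sieveEval_prod_eventFactor R (S := fun i => Q.filter (E · i (x : ℤ)))
    fun i => Finset.filter_subset _ _]
  congr 1
  refine Finset.prod_congr rfl fun p hp => ?_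
  congr 1
  funext i
  have h1 : ((x % p : ℕ) : ℤ) ≡ x [ZMOD p] := by
    rw [Int.natCast_mod]; exact Int.mod_modEq _ _
  rw [Finset.mem_filter, eq_iff_iff]
  exact ⟨fun h => (hE p hp i _ _ h.2).2 h1, fun h => ⟨hp, (hE p hp i _ _ h).2 h1.symm⟩⟩

/-- The average over an interval of a product of squared divisor sums, compared with its average
over a full period. -/
theorem sum_Icc_prod_sq_le {Q : Finset ℕ} (hQ : ∀ p ∈ Q, p.Prime) {R : ℝ} (hR : 1 ≤ R)
    {E : ℕ → ι → ℤ → Prop}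
    (hE : ∀ p ∈ Q, ∀ i x y, E p i x → (E p i y ↔ y ≡ x [ZMOD p])) {a c : ℤ} (hac : a ≤ c + 1) :
    ∑ x ∈ Icc a c, ∏ i, (∑ s ∈ (Q.filter (E · i x)).powerset, divisorCoeff R s) ^ 2 ≤
      ((c - a + 1 : ℤ) : ℝ) * sieveEval R (∏ p ∈ Q, ((p : ℝ)⁻¹ • ∑ y ∈ range p,
        eventFactor p fun i => E p i (y : ℤ))) + (R * Real.log R) ^ (2 * Fintype.card ι) := by
  have h1 := abs_sum_Icc_sub_le (K := Fintype.piFinset fun _ : ι => Q.powerset ×ˢ Q.powerset)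
    (one_le_prod_of_prime hQ) hac
    (fun k => ∏ i, (divisorCoeff R (k i).1 * divisorCoeff R (k i).2))
    (fun k x => ∀ i, (k i).1 ⊆ Q.filter (E · i x) ∧ (k i).2 ⊆ Q.filter (E · i x))
    (by
      rintro k - ⟨v, hv⟩
      exact ⟨v, exists_modEq_of_subset_filter hQ hE hv⟩)
  have h2 : ∀ x : ℤ, ∏ i, (∑ s ∈ (Q.filter (E · i x)).powerset, divisorCoeff R s) ^ 2 = _ :=
    fun x => prod_sum_sq_eq_sum_ite (Q := Q) (divisorCoeff R) fun i => Finset.filter_subset _ _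
  have h3 := (abs_le.1 (h1.trans (sum_abs_prod_divisorCoeff_le hQ hR))).2
  rw [← sum_range_prod_sq_eq hQ R hE, ← mul_assoc, ← div_eq_mul_inv]
  simp only [h2]
  refine sub_le_iff_le_add'.1 ((le_of_eq ?_).trans h3)
  congr!

end

theorem natCast_dvd_linear_iff {p : ℕ} (hp : p.Prime) {W : ℕ} (hW : ¬ p ∣ W) (h : ℤ) {x y : ℤ}
    (hx : (p : ℤ) ∣ W * (x + h) + 1) : (p : ℤ) ∣ W * (y + h) + 1 ↔ y ≡ x [ZMOD p] := by
  have hcop : IsCoprime (p : ℤ) W := Nat.isCoprime_iff_coprime.2 (hp.coprime_iff_not_dvd.2 hW)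
  rw [Int.modEq_comm, Int.modEq_iff_dvd]
  have e : (W * (y + h) + 1 : ℤ) = W * (y - x) + (W * (x + h) + 1) := by ring
  rw [e, dvd_add_left hx]
  exact ⟨hcop.dvd_of_dvd_mul_left, fun h => h.mul_left _⟩

theorem card_filter_dvd_linear {p : ℕ} (hp : p.Prime) {W : ℕ} (hW : ¬ p ∣ W) (h : ℤ) :
    #((range p).filter fun y : ℕ => (p : ℤ) ∣ W * ((y : ℤ) + h) + 1) = 1 := by
  have hcop : IsCoprime (W : ℤ) p :=
    (Nat.isCoprime_iff_coprime.2 (hp.coprime_iff_not_dvd.2 hW)).symm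
  obtain ⟨u, v, huv⟩ := hcop
  have hp0 : (0 : ℤ) < p := by exact_mod_cast hp.pos
  have hr0 := Int.emod_nonneg (-u - h) hp0.ne'
  have hr1 := Int.emod_lt_of_pos (-u - h) hp0
  have hr : (p : ℤ) ∣ W * ((-u - h) + h) + 1 := ⟨v, by linear_combination -huv⟩
  rw [Finset.card_eq_one]
  refine ⟨((-u - h) % p).toNat, ?_⟩
  ext y
  rw [Finset.mem_filter, Finset.mem_range, Finset.mem_singleton, natCast_dvd_linear_iff hp hW h hr]
  constructor
  · rintro ⟨hy, hm⟩
    rw [← hm.eq, Int.emod_eq_of_lt (by positivity) (by exact_mod_cast hy), Int.toNat_natCast]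
  · rintro rfl
    rw [Int.toNat_of_nonneg hr0]
    exact ⟨by omega, Int.mod_modEq _ _⟩

theorem sieveForm_self_nonneg (P : Finset ℕ) (x : ℝ) : 0 ≤ sieveForm P x x :=
  Finset.sum_nonneg fun _ _ => mul_nonneg (by positivity) (mul_self_nonneg _)

theorem LambdaR_linear_eq {w n : ℕ} {R : ℝ} (hR : 0 ≤ R) (hRn : R ≤ n) {z : ℤ} (hz : 0 ≤ z) :
    LambdaR R (((∏ p ∈ primesUpTo w, p : ℕ) : ℤ) * z + 1).toNat =
      ∑ s ∈ ((primesBetween w n).filter fun p : ℕ =>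
        (p : ℤ) ∣ ((∏ p ∈ primesUpTo w, p : ℕ) : ℤ) * z + 1).powerset, divisorCoeff R s := by
  set W := ∏ p ∈ primesUpTo w, p with hW
  have hpos : (0 : ℤ) < W * z + 1 := by positivity
  have hdvd : ∀ p : ℕ, p ∣ ((W : ℤ) * z + 1).toNat ↔ (p : ℤ) ∣ W * z + 1 := by
    intro p
    rw [← Int.natCast_dvd_natCast, Int.toNat_of_nonneg hpos.le]
  rw [LambdaR_eq_sum_powerset hR hRn (w := w) (by omega)]
  · simp only [hdvd]
  · intro p hp hpw hpk
    have h1 : (p : ℤ) ∣ W := by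
      exact_mod_cast Finset.dvd_prod_of_mem (fun p => p) (mem_primesUpTo.2 ⟨hpw, hp⟩)
    have h2 : (p : ℤ) ∣ 1 := (dvd_add_right (h1.mul_right z)).1 ((hdvd p).1 hpk)
    exact hp.one_lt.ne' (Nat.dvd_one.1 (by exact_mod_cast h2))

theorem prod_abs_sub_ne_zero {m : ℕ} {h : Fin m → ℤ} (hh : Function.Injective h) :
    (∏ i : Fin m, ∏ j : Fin m, if i < j then |h i - h j| else 1) ≠ 0 := by
  refine Finset.prod_ne_zero_iff.2 fun i _ => Finset.prod_ne_zero_iff.2 fun j _ => ?_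
  split_ifs with hij
  · exact abs_ne_zero.2 (sub_ne_zero.2 fun e => hij.ne (hh e))
  · exact one_ne_zero

theorem mem_primeFactors_prod_abs_sub {m : ℕ} {h : Fin m → ℤ} (hh : Function.Injective h)
    {p : ℕ} (hp : p.Prime) {i j : Fin m} (hij : i ≠ j) (hd : (p : ℤ) ∣ h i - h j) :
    p ∈ (∏ i : Fin m, ∏ j : Fin m,
      if i < j then |h i - h j| else 1).natAbs.primeFactors := by
  wlog hlt : i < j generalizing i j
  · exact this hij.symm (by rwa [← dvd_neg, neg_sub]) (lt_of_le_of_ne (not_lt.1 hlt) hij.symm)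
  refine Nat.mem_primeFactors.2 ⟨hp, Int.natCast_dvd.1 ?_,
    Int.natAbs_ne_zero.2 (prod_abs_sub_ne_zero hh)⟩
  have h1 : (p : ℤ) ∣ if i < j then |h i - h j| else 1 := by
    rw [if_pos hlt]; exact (dvd_abs _ _).2 hd
  exact (h1.trans (Finset.dvd_prod_of_mem (fun j => if i < j then |h i - h j| else 1)
    (Finset.mem_univ j))).trans (Finset.dvd_prod_of_mem
      (fun i => ∏ j : Fin m, if i < j then |h i - h j| else 1) (Finset.mem_univ i))

theorem coeffBound_avg_linear_sub {m w n : ℕ} {h : Fin m → ℤ} (hh : Function.Injective h)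
    {p : ℕ} (hp : p ∈ primesBetween w n) :
    CoeffBound ((p : ℝ)⁻¹ • ∑ y ∈ range p, eventFactor p (fun i : Fin m =>
        (p : ℤ) ∣ ((∏ p ∈ primesUpTo w, p : ℕ) : ℤ) * ((y : ℤ) + h i) + 1) -
        ∏ i : Fin m, formFactor p i)
      (localConst m * (if p ∈ (∏ i : Fin m, ∏ j : Fin m,
        if i < j then |h i - h j| else 1).natAbs.primeFactors
        then (p : ℝ)⁻¹ else (p : ℝ)⁻¹ ^ 2)) := by
  obtain ⟨hwp, -, hpp⟩ := mem_primesBetween.1 hp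
  have hW : ¬ p ∣ ∏ q ∈ primesUpTo w, q := by
    rw [hpp.prime.dvd_finsetProd_iff]
    rintro ⟨q, hq, hpq⟩
    obtain ⟨hqw, hqp⟩ := mem_primesUpTo.1 hq
    have := Nat.le_of_dvd hqp.pos hpq
    omega
  let E : Fin m → ℕ → Prop := fun i y =>
    (p : ℤ) ∣ ((∏ p ∈ primesUpTo w, p : ℕ) : ℤ) * ((y : ℤ) + h i) + 1
  split_ifs with hbad
  · have h1 := coeffBound_avg_sub hpp.one_le (E := E)
      fun i => by convert card_filter_dvd_linear hpp hW (h i)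
    rwa [Fintype.card_fin] at h1
  · have h1 := coeffBound_avg_sub_of_distinct hpp.one_le (E := E)
      (fun i => by convert card_filter_dvd_linear hpp hW (h i)) (by
      intro y _ i j hi hj
      by_contra hij
      refine hbad (mem_primeFactors_prod_abs_sub hh hpp hij ?_)
      have hd := dvd_sub hi hj
      have hcop : IsCoprime (p : ℤ) (∏ p ∈ primesUpTo w, p : ℕ) :=
        Nat.isCoprime_iff_coprime.2 (hpp.coprime_iff_not_dvd.2 hW)
      refine hcop.dvd_of_dvd_mul_left ?_
      convert hd using 1
      ring)
    rwa [Fintype.card_fin] at h1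

/-- The correlation bound with explicit error terms. -/
theorem avg_prod_LambdaR_sq_le {m w n : ℕ} (hm : 1 ≤ m) (hw : w ≠ 0) (hwn : w ≤ n) {R : ℝ}
    (hR : 1 ≤ R) (hRn : R ≤ n) (hL : mertensProd w * 2 ^ w ≤ Real.log R) {ε : ℝ} (hε : 0 ≤ ε)
    (hform : sieveForm (primesBetween w n) R R ≤ (1 + ε) * (mertensProd w * Real.log R))
    {a c : ℤ} (hac : R ^ (10 * m) ≤ ((c - a + 1 : ℤ) : ℝ)) {h : Fin m → ℤ}
    (hh : Function.Injective h) (hpos : ∀ i, ∀ x ∈ Icc a c, 0 ≤ x + h i) :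
    (∑ x ∈ Icc a c, ∏ i : Fin m,
      (LambdaR R ((((∏ p ∈ primesUpTo w, p : ℕ) : ℤ) * (x + h i) + 1).toNat)) ^ 2) /
        ((c - a + 1 : ℤ) : ℝ) ≤
      ((1 + ε) ^ m * Real.exp (32 ^ m * 4 ^ m * localConst m * (w : ℝ)⁻¹) + R⁻¹) *
        (mertensProd w * Real.log R) ^ m *
        ∏ p ∈ (∏ i : Fin m, ∏ j : Fin m,
          if i < j then |h i - h j| else 1).natAbs.primeFactors,
          (1 + 32 ^ m * 4 ^ m * localConst m * (p : ℝ) ^ (-(1 / 2 : ℝ))) := by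
  set W := ∏ p ∈ primesUpTo w, p with hWdef
  set Q := primesBetween w n with hQdef
  set bad := (∏ i : Fin m, ∏ j : Fin m,
    if i < j then |h i - h j| else 1).natAbs.primeFactors with hbad
  set C : ℝ := 32 ^ m * 4 ^ m * localConst m with hCdef
  set X := mertensProd w * Real.log R with hX
  set V := ((c - a + 1 : ℤ) : ℝ) with hV
  have hQ : ∀ p ∈ Q, p.Prime := fun p hp => (mem_primesBetween.1 hp).2.2
  have hloc : 0 ≤ localConst m := by unfold localConst; positivity
  have hC : 0 ≤ C := by positivity
  have hR0 : 0 < R := by linarith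
  have hM1 := one_le_mertensProd w
  have hlog1 : 1 ≤ Real.log R :=
    (one_le_mul_of_one_le_of_one_le hM1 (one_le_pow₀ one_le_two)).trans hL
  have hX1 : 1 ≤ X := one_le_mul_of_one_le_of_one_le hM1 hlog1
  have hV1 : 1 ≤ V := (one_le_pow₀ hR).trans hac
  have hac' : a ≤ c + 1 := by
    have : (1 : ℤ) ≤ c - a + 1 := by
      rw [← Int.cast_le (R := ℝ), Int.cast_one]
      exact hV1
    omega
  set P := ∏ p ∈ bad, (1 + C * (p : ℝ) ^ (-(1 / 2 : ℝ))) with hP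
  have hP1 : 1 ≤ P := Finset.one_le_prod fun p _ => by
    have : 0 ≤ C * (p : ℝ) ^ (-(1 / 2 : ℝ)) := by positivity
    linarith
  have hE : ∀ p ∈ Q, ∀ (i : Fin m) (x y : ℤ), (p : ℤ) ∣ W * (x + h i) + 1 →
      ((p : ℤ) ∣ W * (y + h i) + 1 ↔ y ≡ x [ZMOD p]) := by
    intro p hp i x y hx
    obtain ⟨hwp, -, hpp⟩ := mem_primesBetween.1 hp
    refine natCast_dvd_linear_iff hpp ?_ (h i) hx
    rw [hWdef, hpp.prime.dvd_finsetProd_iff]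
    rintro ⟨q, hq, hpq⟩
    obtain ⟨hqw, hqp⟩ := mem_primesUpTo.1 hq
    have := Nat.le_of_dvd hqp.pos hpq
    omega
  have h1 := sum_Icc_prod_sq_le hQ hR
    (E := fun p (i : Fin m) x => (p : ℤ) ∣ (W : ℤ) * (x + h i) + 1) hE hac'
  have h2 := sieveEval_prod_avg_le hwn hR hRn hL
    (fun p (i : Fin m) (y : ℕ) => (p : ℤ) ∣ (W : ℤ) * ((y : ℤ) + h i) + 1)
    fun p hp => coeffBound_avg_linear_sub hh hp
  rw [Fintype.card_fin] at h1 h2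
  set ev := sieveEval R (∏ p ∈ Q, ((p : ℝ)⁻¹ • ∑ y ∈ range p,
    eventFactor p fun i : Fin m => (p : ℤ) ∣ (W : ℤ) * ((y : ℤ) + h i) + 1)) with hev
  set cc : ℕ → ℝ := fun p => localConst m * (if p ∈ bad then (p : ℝ)⁻¹ else (p : ℝ)⁻¹ ^ 2) with hcc
  have hcc0 : ∀ p, 0 ≤ cc p := fun p => by
    simp only [hcc]; split_ifs <;> positivity
  have h3 : 1 + 32 ^ m * (∏ p ∈ Q, (1 + 4 ^ m * cc p) - 1) ≤
      Real.exp (C * (w : ℝ)⁻¹) * P := by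
    refine (one_add_mul_prod_sub_le Q (c := fun p => 4 ^ m * cc p)
      (fun p _ => mul_nonneg (by positivity) (hcc0 p)) (one_le_pow₀ (by norm_num))).trans ?_
    refine le_trans (le_of_eq (Finset.prod_congr rfl fun p _ => ?_))
      (prod_one_add_ite_le hw hwn bad hC fun p hp => (Nat.prime_of_mem_primeFactors hp).one_le)
    simp only [hcc, hCdef]
    ring
  have h4 : ev ≤ (1 + ε) ^ m * Real.exp (C * (w : ℝ)⁻¹) * X ^ m * P := by
    have h5 : sieveForm Q R R ^ m ≤ (1 + ε) ^ m * X ^ m := by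
      rw [← mul_pow]
      exact pow_le_pow_left₀ (sieveForm_self_nonneg Q R) hform m
    have h6 : 0 ≤ ∏ p ∈ Q, (1 + 4 ^ m * cc p) - 1 := by
      have : 1 ≤ ∏ p ∈ Q, (1 + 4 ^ m * cc p) := Finset.one_le_prod fun p _ => by
        have := mul_nonneg (by positivity : (0 : ℝ) ≤ 4 ^ m) (hcc0 p)
        linarith
      linarith
    have h7 : 1 ≤ (1 + ε) ^ m := one_le_pow₀ (by linarith)
    have h8 : 0 ≤ 32 ^ m * X ^ m * (∏ p ∈ Q, (1 + 4 ^ m * cc p) - 1) := by positivity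
    calc ev ≤ _ := h2
      _ ≤ (1 + ε) ^ m * X ^ m + 32 ^ m * X ^ m * (∏ p ∈ Q, (1 + 4 ^ m * cc p) - 1) := by
          rw [mul_pow]; linarith
      _ ≤ (1 + ε) ^ m * X ^ m +
          (1 + ε) ^ m * (32 ^ m * X ^ m * (∏ p ∈ Q, (1 + 4 ^ m * cc p) - 1)) :=
          by linarith [le_mul_of_one_le_left h8 h7]
      _ = (1 + ε) ^ m * X ^ m * (1 + 32 ^ m * (∏ p ∈ Q, (1 + 4 ^ m * cc p) - 1)) := by ring
      _ ≤ (1 + ε) ^ m * X ^ m * (Real.exp (C * (w : ℝ)⁻¹) * P) :=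
          mul_le_mul_of_nonneg_left h3 (by positivity)
      _ = _ := by ring
  have h5 : (R * Real.log R) ^ (2 * m) ≤ V * (R⁻¹ * X ^ m * P) := by
    have h6 : R * Real.log R ≤ R ^ 2 := by
      rw [pow_two]
      exact mul_le_mul_of_nonneg_left ((Real.log_le_sub_one_of_pos hR0).trans (by linarith)) hR0.le
    have h7 : 1 ≤ X ^ m * P := one_le_mul_of_one_le_of_one_le (one_le_pow₀ hX1) hP1
    calc (R * Real.log R) ^ (2 * m) ≤ (R ^ 2) ^ (2 * m) := pow_le_pow_left₀ (by positivity) h6 _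
      _ = R ^ (4 * m) * R * R⁻¹ := by
          rw [mul_assoc, mul_inv_cancel₀ hR0.ne', mul_one, ← pow_mul]; ring_nf
      _ ≤ V * R⁻¹ := by
          refine mul_le_mul_of_nonneg_right (le_trans ?_ hac) (by positivity)
          rw [← pow_succ]
          exact pow_le_pow_right₀ hR (by omega)
      _ ≤ V * R⁻¹ * (X ^ m * P) := le_mul_of_one_le_right (by positivity) h7
      _ = _ := by ring
  rw [div_le_iff₀ (by linarith)]
  refine le_trans (le_of_eq (Finset.sum_congr rfl fun x hx => Finset.prod_congr rfl fun i _ => ?_))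
    (h1.trans ?_)
  · rw [LambdaR_linear_eq hR0.le hRn (hpos i x hx)]
    congr!
  have h6 := mul_le_mul_of_nonneg_left h4 (by linarith : 0 ≤ V)
  calc V * ev + (R * Real.log R) ^ (2 * m) ≤ _ := add_le_add h6 h5
    _ = _ := by ring

/-- Goldston–Yıldırım, correlation estimate:
`E(Λ_R(W(x+h_1)+1)² ⋯ Λ_R(W(x+h_m)+1)² | x ∈ B)
  ≤ (1+δ) (W log R/φ(W))^m ∏_{p | Δ} (1 + C_m p^{-1/2})` with `R = N^γ`. -/
theorem goldston_yildirim_correlation (m : ℕ) (hm : 1 ≤ m)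
    (γ : ℝ) (hγ0 : 0 < γ) (hγ1 : γ < 1) :
    ∃ C : ℝ, 0 < C ∧
      ∀ (w : ℕ → ℕ), Tendsto w atTop atTop →
        (∀ᶠ N : ℕ in atTop, (w N : ℝ) ≤ Real.log (Real.log N) / 2) →
        ∀ δ : ℝ, 0 < δ → ∃ N₀ : ℕ, ∀ N ≥ N₀,
          ∀ a c : ℤ, ((N : ℝ) ^ γ) ^ (10 * m) ≤ ((c - a + 1 : ℤ) : ℝ) →
          ∀ h : Fin m → ℤ, Function.Injective h →
            (∀ i, |h i| ≤ (N : ℤ) ^ 2) →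
            (∀ i, ∀ x ∈ Finset.Icc a c, 0 ≤ x + h i) →
            (∑ x ∈ Finset.Icc a c, ∏ i : Fin m,
                (LambdaR ((N : ℝ) ^ γ) (((Wprim w N : ℤ) * (x + h i) + 1).toNat)) ^ 2) /
              ((c - a + 1 : ℤ) : ℝ) ≤
            (1 + δ) * ((Wprim w N : ℝ) * Real.log ((N : ℝ) ^ γ) /
                (Nat.totient (Wprim w N))) ^ m *
              ∏ p ∈ (∏ i : Fin m, ∏ j : Fin m,
                  if i < j then |h i - h j| else 1).natAbs.primeFactors,
                (1 + C * (p : ℝ) ^ (-(1 / 2 : ℝ))) := by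
  have hloc : 0 < localConst m := by unfold localConst; positivity
  refine ⟨32 ^ m * 4 ^ m * localConst m, by positivity, fun w hw hwl δ hδ => ?_⟩
  obtain ⟨ε, hε, hεδ⟩ : ∃ ε : ℝ, 0 < ε ∧ (1 + ε) ^ m < 1 + δ := by
    have h1 : Tendsto (fun ε : ℝ => (1 + ε) ^ m) (nhdsWithin 0 (Set.Ioi 0)) (nhds ((1 + 0) ^ m)) :=
      ((by fun_prop : Continuous fun ε : ℝ => (1 + ε) ^ m).tendsto 0).mono_left nhdsWithin_le_nhds
    rw [add_zero, one_pow] at h1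
    exact ((eventually_mem_nhdsWithin.and (h1.eventually_lt_const (by linarith))).exists)
  have hlim : Tendsto (fun N : ℕ => (1 + ε) ^ m *
      Real.exp (32 ^ m * 4 ^ m * localConst m * (w N : ℝ)⁻¹) + ((N : ℝ) ^ γ)⁻¹) atTop
      (nhds ((1 + ε) ^ m * Real.exp (32 ^ m * 4 ^ m * localConst m * 0) + 0)) := by
    refine Tendsto.add (Tendsto.const_mul _ ?_) ?_
    · exact (Real.continuous_exp.tendsto _).comp
        ((tendsto_inv_atTop_zero.comp (tendsto_natCast_atTop_atTop.comp hw)).const_mul _)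
    · exact tendsto_inv_atTop_zero.comp ((tendsto_rpow_atTop hγ0).comp tendsto_natCast_atTop_atTop)
  rw [mul_zero, Real.exp_zero, mul_one, add_zero] at hlim
  obtain ⟨N₀, hN₀⟩ := eventually_atTop.1 ((eventually_sieveForm_le hγ0 hw hwl hε).and
    ((hlim.eventually_lt_const hεδ).and (hw.eventually_ne_atTop 0)))
  refine ⟨N₀, fun N hN a c hac h hh _ hpos => ?_⟩
  obtain ⟨⟨hR, hwn, hL, hform⟩, hlt, hw0⟩ := hN₀ N hN
  refine (avg_prod_LambdaR_sq_le hm hw0 hwn hR (Nat.le_ceil _) hL hε.le hform hac hh hpos).trans ?_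
  have hW : (Wprim w N : ℝ) * Real.log ((N : ℝ) ^ γ) / (Nat.totient (Wprim w N)) =
      mertensProd (w N) * Real.log ((N : ℝ) ^ γ) := by
    rw [mertensProd_eq, mul_div_right_comm]
    rfl
  rw [hW]
  have hlog := Real.log_nonneg hR
  have hM1 := one_le_mertensProd (w N)
  gcongr

end
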